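/- For every ε > 0 there exist δ₀ > 0 and C > 0 with the following property. Let 0 < δ < δ₀ and let u be a classical solution of the one-phase free boundary problem in the annulus {z ∈ ℂ : δ < |z| < 1} such that F(u) consists of exactly two disjoint connected curves, each with one end on the circle {|z| = 1} and the other on {|z| = δ}. Let T be the connected component of {z ∈ ℂ : δ < |z| < 1/C, u(z) > 0} whose closure intersects the circle {|z| = δ}. Then, after a rotation, T ∩ {Cδ < |z| < 1/C} = {z = x + iy ∈ ℂ : y > g(x)} ∩ {Cδ < |z| < 1/C} for some differentiable function g : ℝ → ℝ with |g′| ≤ ε. -/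

import Mathlib

open Complex Metric Set Filter MeasureTheory
open scoped Topology Classical NNReal

noncomputable section

/-- The positive phase of `u` in `Ω`. -/
def posSet (Ω : Set ℂ) (u : ℂ → ℝ) : Set ℂ := {z ∈ Ω | 0 < u z}

/-- The free boundary of `u` in `Ω`. -/
def FB (Ω : Set ℂ) (u : ℂ → ℝ) : Set ℂ := Ω ∩ frontier (posSet Ω u)

/-- The gradient of `u : ℂ → ℝ`, viewed as a complex number `∂ₓu + i ∂ᵧu`. -/
def grad2 (u : ℂ → ℝ) (z : ℂ) : ℂ :=
  ((fderiv ℝ u z 1 : ℝ) : ℂ) + ((fderiv ℝ u z Complex.I : ℝ) : ℂ) * Complex.I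

/-- Second derivative (Hessian) of `u : ℂ → ℝ` at `z` in directions `v, w`. -/
def hess (u : ℂ → ℝ) (z v w : ℂ) : ℝ := fderiv ℝ (fun x => fderiv ℝ u x v) z w

/-- `u` is harmonic on `s`: twice continuously differentiable with vanishing Laplacian. -/
def HarmonicOn2 (u : ℂ → ℝ) (s : Set ℂ) : Prop :=
  ContDiffOn ℝ 2 u s ∧ ∀ z ∈ s, hess u z 1 1 + hess u z Complex.I Complex.I = 0

/-- A classical solution of the one-phase free boundary problem `Δu = 0` in `{u>0}`,
`|∇u| = 1` on the free boundary, in the open set `Ω ⊆ ℝ² ≅ ℂ`. -/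
structure IsClassicalSolution (Ω : Set ℂ) (u : ℂ → ℝ) : Prop where
  contOn : ContinuousOn u Ω
  nonneg : ∀ z ∈ Ω, 0 ≤ u z
  harm : HarmonicOn2 u (posSet Ω u)
  smooth_ext : ∃ v : ℂ → ℝ, ContDiffOn ℝ (⊤ : ℕ∞) v (Ω ∩ closure (posSet Ω u)) ∧
    Set.EqOn u v (Ω ∩ closure (posSet Ω u))
  fb_manifold : ∀ z ∈ FB Ω u, ∃ V : Set ℂ, IsOpen V ∧ z ∈ V ∧ V ⊆ Ω ∧
    ∃ φ : ℂ → ℝ, ContDiffOn ℝ (⊤ : ℕ∞) φ V ∧ (∀ w ∈ V, fderiv ℝ φ w ≠ 0) ∧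
      V ∩ posSet Ω u = {w ∈ V | 0 < φ w} ∧
      V ∩ {w | u w = 0} = {w ∈ V | φ w ≤ 0} ∧
      V ∩ FB Ω u = {w ∈ V | φ w = 0}
  grad_one : ∀ z ∈ FB Ω u,
    Filter.Tendsto (fun w => ‖grad2 u w‖) (nhdsWithin z (posSet Ω u)) (nhds 1)

/-- One-plane solution `P(z) = max (Re z) 0`. -/
def Pfun (z : ℂ) : ℝ := max z.re 0

/-- Wedge solution `W_s(z) = s |Re z|`. -/
def Wfun (s : ℝ) (z : ℂ) : ℝ := s * |z.re|

/-- Two-plane solution `TP_a`. -/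
def TPfun (a : ℝ) (z : ℂ) : ℝ := max z.re 0 + max (-z.re - a) 0

/-- Rotation of the plane by angle `θ`. -/
def rot (θ : ℝ) (z : ℂ) : ℂ := Complex.exp (θ * Complex.I) * z

/-- The strip `S = {|Im ζ| < π/2}`. -/
def Sstrip : Set ℂ := {ζ : ℂ | |ζ.im| < Real.pi / 2}

/-- The hairpin domain `Ω₁ = {|x₂| < π/2 + cosh x₁}`. -/
def Omega1 : Set ℂ := {z : ℂ | |z.im| < Real.pi / 2 + Real.cosh z.re}

/-- Dilated hairpin domain `Ω_a = aΩ₁`. -/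
def OmegaA (a : ℝ) : Set ℂ := {z : ℂ | z / (a : ℂ) ∈ Omega1}

/-- The Hauswirth–Hélein–Pacard double hairpin solution `H = H₁`:
`H(z) = Re (cosh w)` where `w` is the unique point of the strip `S` with `w + sinh w = z`,
and `H(z) = 0` if there is no such point. -/
def hairpinH (z : ℂ) : ℝ :=
  if h : ∃ w : ℂ, w ∈ Sstrip ∧ w + Complex.sinh w = z then (Complex.cosh h.choose).re else 0

/-- The double hairpin solution `H_a(z) = a H(z/a)`. -/
def hairpin (a : ℝ) (z : ℂ) : ℝ := a * hairpinH (z / (a : ℂ))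

/-- Euclidean dot product of two complex numbers viewed as vectors in ℝ². -/
def dot2 (a b : ℂ) : ℝ := a.re * b.re + a.im * b.im

/-- Divergence of a vector field `ψ : ℂ → ℂ` on ℝ². -/
def div2 (ψ : ℂ → ℂ) (z : ℂ) : ℝ := (fderiv ℝ ψ z 1).re + (fderiv ℝ ψ z Complex.I).im

/-- A variational (weak) solution of the one-phase free boundary problem in `Ω`:
`u ∈ H¹_loc(Ω) ∩ C(Ω)`, `u ≥ 0`, `u ∈ C²({u>0})`, and the domain-variation
Euler–Lagrange identity holds for all compactly supported smooth vector fields. -/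
def VariationalSolution (Ω : Set ℂ) (u : ℂ → ℝ) : Prop :=
  ContinuousOn u Ω ∧ (∀ z ∈ Ω, 0 ≤ u z) ∧
  (∀ K : Set ℂ, K ⊆ Ω → IsCompact K →
    MeasureTheory.IntegrableOn (fun z => (u z) ^ 2 + ‖grad2 u z‖ ^ 2) K) ∧
  ContDiffOn ℝ 2 u (posSet Ω u) ∧
  ∀ ψ : ℂ → ℂ, ContDiff ℝ (⊤ : ℕ∞) ψ → HasCompactSupport ψ → tsupport ψ ⊆ Ω →
    ∫ z in Ω, ((‖grad2 u z‖ ^ 2 + Set.indicator {w | 0 < u w} (fun _ => (1 : ℝ)) z) * div2 ψ z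
      - 2 * dot2 (grad2 u z) (fderiv ℝ ψ z (grad2 u z))) = 0

/-- Average of `w` over the circle of radius `r` around `z`. -/
def circleAvg (w : ℂ → ℝ) (z : ℂ) (r : ℝ) : ℝ :=
  (1 / (2 * Real.pi)) * ∫ θ in (0 : ℝ)..(2 * Real.pi), w (z + r * Complex.exp (θ * Complex.I))

/-- Superharmonicity on `s` via the super-mean-value property. -/
def SuperharmonicOn2 (w : ℂ → ℝ) (s : Set ℂ) : Prop :=
  ∀ z ∈ s, ∀ r : ℝ, 0 < r → Metric.closedBall z r ⊆ s → circleAvg w z r ≤ w z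

/-- Subharmonicity on `s` via the sub-mean-value property. -/
def SubharmonicOn2 (w : ℂ → ℝ) (s : Set ℂ) : Prop :=
  ∀ z ∈ s, ∀ r : ℝ, 0 < r → Metric.closedBall z r ⊆ s → w z ≤ circleAvg w z r

/-- Non-tangential approach region in `B` at `x₀` with aperture `C`. -/
def NontangentialIn (B : Set ℂ) (x₀ : ℂ) (C : ℝ) : Set ℂ :=
  {x ∈ B | ‖x - x₀‖ ≤ C * Metric.infDist x Bᶜ}

/-- `w(x) = α ⟨x − x₀, ν⟩⁺ + o(|x − x₀|)` as `x → x₀` within the region `R`. -/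
def HasSlopeAt (w : ℂ → ℝ) (x₀ ν : ℂ) (α : ℝ) (R : Set ℂ) : Prop :=
  Filter.Tendsto (fun x => (w x - α * max (dot2 (x - x₀) ν) 0) / ‖x - x₀‖)
    (nhdsWithin x₀ R) (nhds 0)

/-- Viscosity supersolution of the one-phase free boundary problem in `Ω`. -/
structure ViscositySupersolution (Ω : Set ℂ) (w : ℂ → ℝ) : Prop where
  contOn : ContinuousOn w Ω
  nonneg : ∀ z ∈ Ω, 0 ≤ w z
  superharm : SuperharmonicOn2 w (posSet Ω w)
  slope : ∀ x₀ ∈ FB Ω w, ∀ (y : ℂ) (ρ : ℝ), 0 < ρ → Metric.ball y ρ ⊆ posSet Ω w →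
    dist x₀ y = ρ → ∃ α : ℝ, α ≤ 1 ∧ ∀ C : ℝ, 1 < C →
      HasSlopeAt w x₀ ((y - x₀) / (ρ : ℂ)) α (NontangentialIn (Metric.ball y ρ) x₀ C)

/-- Viscosity subsolution of the one-phase free boundary problem in `Ω`. -/
structure ViscositySubsolution (Ω : Set ℂ) (w : ℂ → ℝ) : Prop where
  contOn : ContinuousOn w Ω
  nonneg : ∀ z ∈ Ω, 0 ≤ w z
  subharm : SubharmonicOn2 w (posSet Ω w)
  slope : ∀ x₀ ∈ FB Ω w, ∀ (y : ℂ) (ρ : ℝ), 0 < ρ →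
    Metric.ball y ρ ⊆ {z ∈ Ω | w z = 0} → dist x₀ y = ρ →
    ∃ α : ℝ, 1 ≤ α ∧ ∀ C : ℝ, 1 < C →
      HasSlopeAt w x₀ ((x₀ - y) / (ρ : ℂ)) α
        (NontangentialIn (closure (Metric.ball y ρ))ᶜ x₀ C)

/-- Viscosity solution: both a supersolution and a subsolution. -/
def ViscositySolution (Ω : Set ℂ) (w : ℂ → ℝ) : Prop :=
  ViscositySupersolution Ω w ∧ ViscositySubsolution Ω w

/-- Non-degeneracy with constant `c`: linear growth away from the free boundary. -/
def Nondegenerate (Ω : Set ℂ) (w : ℂ → ℝ) (c : ℝ) : Prop :=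
  ∀ x ∈ FB Ω w, ∀ r : ℝ, 0 < r → Metric.ball x r ⊆ Ω → c * r ≤ sSup (w '' Metric.ball x r)

/-- The open annulus `{δ < |z| < R}`. -/
def ann (δ R : ℝ) : Set ℂ := {z : ℂ | δ < ‖z‖ ∧ ‖z‖ < R}

/-- Condition (A): the free boundary of `u` in the annulus `{δ < |z| < R}` consists of
exactly two connected components, each non-compact with closure meeting both boundary
circles. -/
def ConditionA (δ R : ℝ) (u : ℂ → ℝ) : Prop :=
  ∃ F₁ F₂ : Set ℂ,
    F₁.Nonempty ∧ F₂.Nonempty ∧ Disjoint F₁ F₂ ∧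
    F₁ ∪ F₂ = FB (ann δ R) u ∧
    (∀ z ∈ F₁, connectedComponentIn (FB (ann δ R) u) z = F₁) ∧
    (∀ z ∈ F₂, connectedComponentIn (FB (ann δ R) u) z = F₂) ∧
    ¬ IsCompact F₁ ∧ ¬ IsCompact F₂ ∧
    (closure F₁ ∩ Metric.sphere 0 δ).Nonempty ∧
    (closure F₁ ∩ Metric.sphere 0 R).Nonempty ∧
    (closure F₂ ∩ Metric.sphere 0 δ).Nonempty ∧
    (closure F₂ ∩ Metric.sphere 0 R).Nonempty

/-- `k` is the curvature of the set `S` at the point `p`, computed via an arc-length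
parametrization. -/
def IsCurvatureAt (S : Set ℂ) (p : ℂ) (k : ℝ) : Prop :=
  ∃ γ : ℝ → ℂ, ContDiff ℝ 2 γ ∧ γ 0 = p ∧ (∀ s : ℝ, ‖deriv γ s‖ = 1) ∧
    (∃ ε > 0, ∀ s ∈ Set.Ioo (-ε) ε, γ s ∈ S) ∧ ‖deriv (deriv γ) 0‖ = k

/-- A set has exactly two connected components. -/
def HasExactlyTwoComponents (S : Set ℂ) : Prop :=
  ∃ z₁ ∈ S, ∃ z₂ ∈ S, connectedComponentIn S z₁ ≠ connectedComponentIn S z₂ ∧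
    ∀ z ∈ S, connectedComponentIn S z = connectedComponentIn S z₁ ∨
      connectedComponentIn S z = connectedComponentIn S z₂

end

open Complex Metric Set Filter MeasureTheory
open scoped Topology Classical NNReal

lemma paramInt {V : Set ℂ} (hV : IsOpen V) {k : ℂ → ℝ → ℂ}
    (hc : ContinuousOn (fun p : ℂ × ℝ => k p.1 p.2) (V ×ˢ Icc (0:ℝ) 1))
    (hd : ∀ t ∈ Icc (0:ℝ) 1, DifferentiableOn ℂ (fun z => k z t) V) :
    DifferentiableOn ℂ (fun z => ∫ t in (0:ℝ)..1, k z t) V := by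
  intro z0 hz0
  obtain ⟨ε, hε, hεV⟩ := Metric.isOpen_iff.1 hV z0 hz0
  have hcb : closedBall z0 (ε/2) ⊆ V := (closedBall_subset_ball (by linarith)).trans hεV
  have hK : IsCompact (closedBall z0 (ε/2) ×ˢ Icc (0:ℝ) 1) :=
    (isCompact_closedBall _ _).prod isCompact_Icc
  obtain ⟨B, hB⟩ := hK.exists_bound_of_continuousOn (hc.mono (prod_mono_left hcb))
  have hI : Set.uIoc (0:ℝ) 1 ⊆ Icc 0 1 := by
    rw [uIoc_of_le zero_le_one]; exact Ioc_subset_Icc_self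
  have hct : ∀ z ∈ V, ContinuousOn (k z) (Icc 0 1) := fun z hz =>
    hc.comp (f := fun t : ℝ => (z, t)) (by fun_prop) (fun t ht => ⟨hz, ht⟩)
  have hm : ∀ z ∈ V, AEStronglyMeasurable (k z) (volume.restrict (Set.uIoc (0:ℝ) 1)) := fun z hz =>
    ((hct z hz).mono hI).aestronglyMeasurable measurableSet_uIoc
  have hda : ∀ t ∈ Set.uIoc (0:ℝ) 1, ∀ z ∈ V,
      HasDerivAt (fun z => k z t) (deriv (fun z => k z t) z) z := fun t ht z hz =>
    ((hd t (hI ht)).differentiableAt (hV.mem_nhds hz)).hasDerivAt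
  have := intervalIntegral.hasDerivAt_integral_of_dominated_loc_of_deriv_le (μ := volume)
    (a := 0) (b := 1) (F := k) (F' := fun z t => deriv (fun z => k z t) z) (x₀ := z0)
    (s := ball z0 (ε/4)) (bound := fun _ => B / (ε/4)) (ball_mem_nhds _ (by linarith))
    (by filter_upwards [hV.mem_nhds hz0] with z hz using hm z hz)
    (by
      apply ContinuousOn.intervalIntegrable
      rw [uIcc_of_le zero_le_one]; exact hct z0 hz0)
    (by
      have hlim : ∀ t ∈ Set.uIoc (0:ℝ) 1, Tendsto (fun n : ℕ =>
          slope (fun z => k z t) z0 (z0 + (((ε/2) * (1 / ((n:ℝ) + 1)) : ℝ) : ℂ))) atTop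
          (𝓝 (deriv (fun z => k z t) z0)) := by
        intro t ht
        refine (hasDerivAt_iff_tendsto_slope.1 (hda t ht z0 hz0)).comp ?_
        refine tendsto_nhdsWithin_iff.2 ⟨?_, ?_⟩
        · have h1 : Tendsto (fun n : ℕ => (ε/2) * (1 / ((n:ℝ) + 1))) atTop (𝓝 ((ε/2) * 0)) :=
            tendsto_one_div_add_atTop_nhds_zero_nat.const_mul _
          have := ((Complex.continuous_ofReal.tendsto _).comp h1).const_add z0
          simpa using this
        · refine Eventually.of_forall fun n => ?_
          have : 0 < (ε/2) * (1 / ((n:ℝ) + 1)) := by positivity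
          simp only [mem_compl_iff, mem_singleton_iff, add_eq_left]
          exact_mod_cast this.ne'
      refine aestronglyMeasurable_of_tendsto_ae (u := atTop) (f := fun (n : ℕ) t =>
          slope (fun z => k z t) z0 (z0 + (((ε/2) * (1 / ((n:ℝ) + 1)) : ℝ) : ℂ))) ?_ ?_
      · intro n
        simp only [slope, vsub_eq_sub]
        refine (AEStronglyMeasurable.sub (hm _ ?_) (hm _ hz0)).const_smul (_ : ℂ)
        apply hεV
        rw [mem_ball, dist_eq, add_sub_cancel_left, norm_real, Real.norm_eq_abs, abs_of_pos (by positivity)]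
        have : 1 / ((n:ℝ)+1) ≤ 1 := by
          rw [div_le_one (by positivity)]; have : (0:ℝ) ≤ n := n.cast_nonneg
          linarith
        nlinarith
      · exact (ae_restrict_iff' measurableSet_uIoc).2 (Eventually.of_forall hlim))
    (by
      refine Eventually.of_forall fun t ht z hz => ?_
      refine Complex.norm_deriv_le_of_forall_mem_sphere_norm_le (by linarith) ?_ ?_
      · refine DifferentiableOn.diffContOnCl ?_
        refine (hd t (hI ht)).mono ?_
        rw [closure_ball _ (by positivity)]
        intro w hw
        apply hcb
        simp only [mem_closedBall, mem_ball] at *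
        linarith [dist_triangle w z z0]
      · intro w hw
        refine hB (w, t) ⟨?_, hI ht⟩
        simp only [mem_closedBall, mem_ball, mem_sphere] at *
        linarith [dist_triangle w z z0])
    (by simp)
    (by
      refine Eventually.of_forall fun t ht z hz => hda t ht z ?_
      apply hεV; exact ball_subset_ball (by linarith) hz)
  exact this.2.differentiableAt.differentiableWithinAt

lemma dslope_continuousOn {W : Set ℂ} (hW : IsOpen W) {h : ℂ → ℂ} (hh : DifferentiableOn ℂ h W) :
    ContinuousOn (fun p : ℂ × ℂ => dslope h p.1 p.2) (W ×ˢ W) := by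
  rintro ⟨z, w⟩ ⟨hz, hw⟩
  apply ContinuousAt.continuousWithinAt
  simp only at hz hw
  have hcz := (hh.continuousOn.continuousAt (hW.mem_nhds hz))
  have hcw := (hh.continuousOn.continuousAt (hW.mem_nhds hw))
  by_cases hzw : w = z
  · subst hzw
    have hs : HasStrictDerivAt h (deriv h w) w :=
      (hh.analyticAt (hW.mem_nhds hw)).hasStrictDerivAt
    have hd : ContinuousAt (deriv h) w :=
      ((hh.analyticAt (hW.mem_nhds hw)).deriv).continuousAt
    rw [Metric.continuousAt_iff']
    intro ε hε
    have h1 := (hasStrictFDerivAt_iff_isLittleO.1 hs.hasStrictFDerivAt).def (half_pos hε)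
    have h2 : ∀ᶠ p : ℂ × ℂ in 𝓝 (w, w), dist (deriv h p.1) (deriv h w) < ε := by
      have := (Metric.continuousAt_iff'.1 hd) ε hε
      exact (continuous_fst.tendsto (w, w)).eventually this
    filter_upwards [h1, h2] with p hp1 hp2
    simp only [dslope_same]
    by_cases hp : p.2 = p.1
    · rw [hp, dslope_same]; exact hp2
    · rw [dslope_of_ne _ hp, slope_def_field, dist_eq]
      have hne : p.1 - p.2 ≠ 0 := sub_ne_zero.2 (Ne.symm hp)
      have e : (h p.2 - h p.1) / (p.2 - p.1) - deriv h w =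
        (h p.1 - h p.2 - (p.1 - p.2) * deriv h w) / (p.1 - p.2) := by
        have : p.2 - p.1 ≠ 0 := sub_ne_zero.2 hp
        field_simp; ring
      rw [e, norm_div, div_lt_iff₀ (norm_pos_iff.2 hne)]
      have : ‖h p.1 - h p.2 - (p.1 - p.2) * deriv h w‖ ≤ ε / 2 * ‖p.1 - p.2‖ := by
        simpa using hp1
      have := norm_pos_iff.2 hne
      nlinarith
  · have hev : (fun p : ℂ × ℂ => dslope h p.1 p.2) =ᶠ[𝓝 (z, w)]
        fun p => (h p.2 - h p.1) / (p.2 - p.1) := by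
      have : ∀ᶠ p : ℂ × ℂ in 𝓝 (z, w), p.2 ≠ p.1 :=
        (isOpen_ne_fun continuous_snd continuous_fst).mem_nhds hzw
      filter_upwards [this] with p hp
      rw [dslope_of_ne _ hp, slope_def_field]
    refine ContinuousAt.congr ?_ hev.symm
    refine ContinuousAt.div (ContinuousAt.sub ?_ ?_) (by fun_prop) (sub_ne_zero.2 hzw)
    · exact ContinuousAt.comp (f := Prod.snd) (x := (z, w)) hcw continuousAt_snd
    · exact ContinuousAt.comp (f := Prod.fst) (x := (z, w)) hcz continuousAt_fst

noncomputable def sg (a b : ℂ) (t : ℝ) : ℂ := a + t * (b - a)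

noncomputable def sInt (a b : ℂ) (h : ℂ → ℂ) : ℂ := ∫ t in (0:ℝ)..1, h (sg a b t) * (b - a)

noncomputable def lInt (L : List (ℂ × ℂ)) (h : ℂ → ℂ) : ℂ :=
  (L.map fun s => sInt s.1 s.2 h).sum

inductive IsP (W : Set ℂ) : ℂ → ℂ → List (ℂ × ℂ) → Prop
  | nil (x : ℂ) : IsP W x x []
  | cons (x y z : ℂ) (L : List (ℂ × ℂ)) : segment ℝ x y ⊆ W → IsP W y z L → IsP W x z ((x, y) :: L)

lemma sg_cont (a b : ℂ) : Continuous (sg a b) := by unfold sg; fun_prop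

lemma sg_mem {a b : ℂ} {t : ℝ} (ht : t ∈ Icc (0:ℝ) 1) : sg a b t ∈ segment ℝ a b := by
  rw [segment_eq_image']
  exact ⟨t, ht, by simp [sg]⟩

lemma segm_sg {a b w : ℂ} (hw : w ∈ segment ℝ a b) : ∃ t ∈ Icc (0:ℝ) 1, sg a b t = w := by
  rw [segment_eq_image'] at hw
  obtain ⟨t, ht, h⟩ := hw
  exact ⟨t, ht, by simpa [sg] using h⟩

lemma sInt_intble {a b : ℂ} {h : ℂ → ℂ} (hc : ContinuousOn h (segment ℝ a b)) :
    IntervalIntegrable (fun t => h (sg a b t) * (b - a)) volume 0 1 := by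
  apply ContinuousOn.intervalIntegrable
  rw [uIcc_of_le zero_le_one]
  exact (hc.comp (sg_cont a b).continuousOn (fun t ht => sg_mem ht)).mul continuousOn_const

lemma sInt_congr {a b : ℂ} {g h : ℂ → ℂ} (he : EqOn g h (segment ℝ a b)) :
    sInt a b g = sInt a b h := by
  apply intervalIntegral.integral_congr
  intro t ht
  rw [uIcc_of_le zero_le_one] at ht
  simp only [he (sg_mem ht)]

lemma sInt_prim {a b : ℂ} {P h : ℂ → ℂ} (hc : ContinuousOn h (segment ℝ a b))
    (hP : ∀ z ∈ segment ℝ a b, HasDerivAt P (h z) z) : sInt a b h = P b - P a := by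
  have : sInt a b h = P (sg a b 1) - P (sg a b 0) := by
    apply intervalIntegral.integral_eq_sub_of_hasDerivAt (f := fun t => P (sg a b t)) _
      (sInt_intble hc)
    intro t ht
    rw [uIcc_of_le zero_le_one] at ht
    have h1 : HasDerivAt (sg a b) (b - a) t := by
      unfold sg
      have := ((HasDerivAt.ofReal_comp (hasDerivAt_id t)).mul_const (b - a)).const_add a
      simpa using this
    exact (hP _ (sg_mem ht)).comp t h1
  simpa [sg] using this

lemma sInt_sub {a b : ℂ} {g h : ℂ → ℂ} (hg : ContinuousOn g (segment ℝ a b))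
    (hh : ContinuousOn h (segment ℝ a b)) (c : ℂ) :
    sInt a b (fun w => g w - c * h w) = sInt a b g - c * sInt a b h := by
  unfold sInt
  rw [← intervalIntegral.integral_const_mul, ← intervalIntegral.integral_sub (sInt_intble hg)
    ((sInt_intble hh).const_mul c)]
  congr 1; ext t; ring

lemma sInt_exp {a b c : ℂ} (hc : c ∉ segment ℝ a b) :
    exp (sInt a b (fun w => (w - c)⁻¹)) = (b - c) / (a - c) := by
  have hac : a - c ≠ 0 := sub_ne_zero.2 fun h => hc (h ▸ left_mem_segment ℝ a b)
  have hbc : b - c ≠ 0 := sub_ne_zero.2 fun h => hc (h ▸ right_mem_segment ℝ a b)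
  have hne : ∀ w ∈ segment ℝ a b, w - c ≠ 0 := fun w hw h => hc ((sub_eq_zero.1 h) ▸ hw)
  have hsl : ∀ w ∈ segment ℝ a b, (w - c) / (a - c) ∈ slitPlane := by
    intro w hw
    by_contra hcon
    rw [mem_slitPlane_iff_not_le_zero, not_not, Complex.le_def] at hcon
    obtain ⟨x, hx⟩ : ∃ x : ℝ, (w - c) / (a - c) = -x := ⟨-((w - c) / (a - c)).re, by
      apply Complex.ext <;> simp
      simpa using hcon.2⟩
    have hx0 : 0 ≤ x := by
      have := hcon.1; rw [hx] at this; simpa using this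
    have hx1 : (1 + (x:ℂ)) ≠ 0 := by exact_mod_cast (by linarith : (1 + x) ≠ 0)
    rw [div_eq_iff hac] at hx
    have : c = ((1 / (1 + x) : ℝ) : ℂ) * w + ((x / (1 + x) : ℝ) : ℂ) * a := by
      push_cast; field_simp; linear_combination -hx
    apply hc
    apply (convex_segment a b).segment_subset hw (left_mem_segment ℝ a b)
    exact ⟨1 / (1 + x), x / (1 + x), by positivity, by positivity,
      by field_simp, by rw [this]; simp⟩
  have := sInt_prim (a := a) (b := b) (P := fun w => Complex.log ((w - c) / (a - c)))
    (h := fun w => (w - c)⁻¹) ((continuousOn_id.sub continuousOn_const).inv₀ hne) (by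
      intro z hz
      have h1 : HasDerivAt (fun w : ℂ => (w - c) / (a - c)) (1 / (a - c)) z :=
        ((hasDerivAt_id z).sub_const c).div_const _
      convert h1.clog (hsl z hz) using 1
      have := hne z hz
      field_simp)
  rw [this, div_self hac, log_one, sub_zero, exp_log (div_ne_zero hbc hac)]

lemma sInt_rev (a b : ℂ) (h : ℂ → ℂ) : sInt b a h = - sInt a b h := by
  unfold sInt
  rw [← intervalIntegral.integral_neg]
  have := intervalIntegral.integral_comp_sub_left (a := 0) (b := 1)
    (fun t => h (sg b a t) * (a - b)) 1
  simp only [sub_self, sub_zero] at this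
  rw [← this]
  congr 1; ext t
  have : sg b a (1 - t) = sg a b t := by simp [sg]; ring
  rw [this]; ring

lemma lInt_append (L L' : List (ℂ × ℂ)) (h : ℂ → ℂ) : lInt (L ++ L') h = lInt L h + lInt L' h := by
  simp [lInt]

lemma IsP.append {W : Set ℂ} {x y z : ℂ} {L L' : List (ℂ × ℂ)} (h : IsP W x y L)
    (h' : IsP W y z L') : IsP W x z (L ++ L') := by
  induction h with
  | nil => exact h'
  | cons x y z L hs _ ih => exact IsP.cons _ _ _ _ hs (ih h')

lemma IsP.rev {W : Set ℂ} {x y : ℂ} {L : List (ℂ × ℂ)} (h : IsP W x y L) :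
    ∃ L', IsP W y x L' ∧ ∀ f, lInt L' f = - lInt L f := by
  induction h with
  | nil x => exact ⟨[], IsP.nil x, by simp [lInt]⟩
  | cons x y z L hs _ ih =>
    obtain ⟨L', h1, h2⟩ := ih
    refine ⟨L' ++ [(y, x)], h1.append (IsP.cons _ _ _ _ (segment_symm ℝ x y ▸ hs) (IsP.nil _)), ?_⟩
    intro f
    rw [lInt_append, h2]
    simp [lInt, sInt_rev x y]

lemma IsP.seg {W : Set ℂ} {x y : ℂ} {L : List (ℂ × ℂ)} (h : IsP W x y L) :
    ∀ s ∈ L, segment ℝ s.1 s.2 ⊆ W := by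
  induction h with
  | nil => simp
  | cons x y z L hs _ ih => intro s hs'; rcases List.mem_cons.1 hs' with rfl | h
                            · exact hs
                            · exact ih s h

lemma IsP.lexp {W : Set ℂ} {x y c : ℂ} {L : List (ℂ × ℂ)} (h : IsP W x y L)
    (hc : ∀ s ∈ L, c ∉ segment ℝ s.1 s.2) (hx : x ≠ c) :
    exp (lInt L (fun w => (w - c)⁻¹)) = (y - c) / (x - c) ∧ y ≠ c := by
  induction h with
  | nil x => simp [lInt, sub_ne_zero.2 hx, hx]
  | cons x y z L hs _ ih =>
    have hy : y ≠ c := fun h => hc (x, y) (by simp) (h ▸ right_mem_segment ℝ x y)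
    obtain ⟨h1, h2⟩ := ih (fun s hs => hc s (by simp [hs])) hy
    refine ⟨?_, h2⟩
    have : lInt ((x, y) :: L) (fun w => (w - c)⁻¹) = sInt x y (fun w => (w - c)⁻¹) +
      lInt L (fun w => (w - c)⁻¹) := by simp [lInt]
    rw [this, exp_add, sInt_exp (hc (x, y) (by simp)), h1]
    have := sub_ne_zero.2 hy
    have := sub_ne_zero.2 hx
    field_simp

lemma lInt_diff {V : Set ℂ} (hV : IsOpen V) {L : List (ℂ × ℂ)} {k : ℂ → ℂ → ℂ}
    (hc : ∀ s ∈ L, ContinuousOn (fun p : ℂ × ℂ => k p.1 p.2) (V ×ˢ segment ℝ s.1 s.2))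
    (hd : ∀ s ∈ L, ∀ w ∈ segment ℝ s.1 s.2, DifferentiableOn ℂ (fun z => k z w) V) :
    DifferentiableOn ℂ (fun z => lInt L (k z)) V := by
  induction L with
  | nil => simp [lInt]
  | cons s L ih =>
    have : (fun z => lInt (s :: L) (k z)) = fun z => sInt s.1 s.2 (k z) + lInt L (k z) := by
      ext z; simp [lInt]
    rw [this]
    refine DifferentiableOn.add ?_ (ih (fun s hs => hc s (by simp [hs]))
      (fun s hs => hd s (by simp [hs])))
    refine paramInt hV (k := fun z t => k z (sg s.1 s.2 t) * (s.2 - s.1)) ?_ ?_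
    · refine ContinuousOn.mul ?_ continuousOn_const
      refine (hc s (by simp)).comp (f := fun p : ℂ × ℝ => (p.1, sg s.1 s.2 p.2)) ?_ ?_
      · exact (continuous_fst.prodMk ((sg_cont _ _).comp continuous_snd)).continuousOn
      · exact fun p hp => ⟨hp.1, sg_mem hp.2⟩
    · exact fun t ht => (hd s (by simp) _ (sg_mem ht)).mul_const _

lemma lInt_sub {L : List (ℂ × ℂ)} {g h : ℂ → ℂ} (hg : ∀ s ∈ L, ContinuousOn g (segment ℝ s.1 s.2))
    (hh : ∀ s ∈ L, ContinuousOn h (segment ℝ s.1 s.2)) (c : ℂ) :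
    lInt L (fun w => g w - c * h w) = lInt L g - c * lInt L h := by
  induction L with
  | nil => simp [lInt]
  | cons s L ih =>
    have := ih (fun s hs => hg s (by simp [hs])) (fun s hs => hh s (by simp [hs]))
    have h2 := sInt_sub (hg s (by simp)) (hh s (by simp)) c
    simp only [lInt, List.map_cons, List.sum_cons] at this ⊢
    rw [h2, this]; ring

lemma lInt_congr {L : List (ℂ × ℂ)} {g h : ℂ → ℂ} (he : ∀ s ∈ L, EqOn g h (segment ℝ s.1 s.2)) :
    lInt L g = lInt L h := by
  unfold lInt
  congr 1
  exact List.map_congr_left fun s hs => sInt_congr (he s hs)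

def trc (L : List (ℂ × ℂ)) : Set ℂ := ⋃ s ∈ L, segment ℝ s.1 s.2

lemma trc_compact (L : List (ℂ × ℂ)) : IsCompact (trc L) := by
  have : trc L = ⋃ s ∈ L.toFinset, segment ℝ s.1 s.2 := by simp [trc]
  rw [this]
  refine L.toFinset.isCompact_biUnion fun s _ => ?_
  rw [segment_eq_image']
  exact isCompact_Icc.image (by fun_prop)

lemma mem_trc {L : List (ℂ × ℂ)} {w : ℂ} : w ∈ trc L ↔ ∃ s ∈ L, w ∈ segment ℝ s.1 s.2 := by
  simp [trc]

lemma cauchyT_diff (L : List (ℂ × ℂ)) {h : ℂ → ℂ} (hh : ContinuousOn h (trc L)) :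
    DifferentiableOn ℂ (fun z => lInt L (fun w => h w * (w - z)⁻¹)) (trc L)ᶜ := by
  have hsub : ∀ s ∈ L, segment ℝ s.1 s.2 ⊆ trc L := fun s hs w hw => mem_trc.2 ⟨s, hs, hw⟩
  refine lInt_diff (trc_compact L).isClosed.isOpen_compl (k := fun z w => h w * (w - z)⁻¹) ?_ ?_
  · intro s hs
    refine ContinuousOn.mul ?_ (ContinuousOn.inv₀ (by fun_prop) ?_)
    · exact (hh.mono (hsub s hs)).comp (f := Prod.snd) continuousOn_snd fun p hp => hp.2
    · rintro p ⟨h1, h2⟩ h3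
      exact h1 ((sub_eq_zero.1 h3) ▸ hsub s hs h2)
  · intro s hs w hw z hz
    refine DifferentiableAt.differentiableWithinAt ?_
    refine DifferentiableAt.const_mul (DifferentiableAt.inv (by fun_prop) ?_) _
    intro h3
    exact hz ((sub_eq_zero.1 h3) ▸ hsub s hs hw)

lemma norm_sInt_le {a b : ℂ} {h : ℂ → ℂ} {B : ℝ} (hB : ∀ w ∈ segment ℝ a b, ‖h w‖ ≤ B) :
    ‖sInt a b h‖ ≤ B * ‖b - a‖ := by
  have := intervalIntegral.norm_integral_le_of_norm_le_const (a := 0) (b := 1)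
    (f := fun t => h (sg a b t) * (b - a)) (C := B * ‖b - a‖) (by
      intro t ht
      rw [uIoc_of_le zero_le_one] at ht
      rw [norm_mul]
      exact mul_le_mul_of_nonneg_right (hB _ (sg_mem (Ioc_subset_Icc_self ht))) (norm_nonneg _))
  simpa [sInt] using this

lemma cauchyT_tendsto (L : List (ℂ × ℂ)) {h : ℂ → ℂ} (hh : ContinuousOn h (trc L)) :
    Tendsto (fun z => lInt L (fun w => h w * (w - z)⁻¹)) (cocompact ℂ) (𝓝 0) := by
  obtain ⟨B, hB⟩ := (trc_compact L).exists_bound_of_continuousOn hh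
  obtain ⟨R, hR⟩ := (trc_compact L).isBounded.exists_norm_le
  have hz : ∀ s ∈ L, Tendsto (fun z => sInt s.1 s.2 (fun w => h w * (w - z)⁻¹))
      (cocompact ℂ) (𝓝 0) := by
    intro s hs
    have hlim : Tendsto (fun z : ℂ => B * (‖z‖ - R)⁻¹ * ‖s.2 - s.1‖) (cocompact ℂ) (𝓝 0) := by
      have : Tendsto (fun z : ℂ => (‖z‖ - R)⁻¹) (cocompact ℂ) (𝓝 0) :=
        tendsto_inv_atTop_zero.comp
          (tendsto_atTop_add_const_right _ _ (tendsto_norm_cocompact_atTop (E := ℂ)))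
      simpa using (this.const_mul B).mul_const ‖s.2 - s.1‖
    refine squeeze_zero_norm' ?_ hlim
    filter_upwards [(tendsto_norm_cocompact_atTop (E := ℂ)).eventually_gt_atTop R] with z hz
    refine norm_sInt_le fun w hw => ?_
    have hw' : w ∈ trc L := mem_trc.2 ⟨s, hs, hw⟩
    rw [norm_mul, norm_inv]
    have : ‖z‖ - R ≤ ‖w - z‖ := by
      have := norm_sub_norm_le z w
      rw [norm_sub_rev] at this; linarith [hR w hw']
    exact mul_le_mul (hB w hw') (inv_anti₀ (by linarith) this) (by positivity)
      ((norm_nonneg _).trans (hB w hw'))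
  clear hB hR
  unfold lInt
  have : ∀ M : List (ℂ × ℂ), (∀ s ∈ M, s ∈ L) →
      Tendsto (fun z => (M.map fun s => sInt s.1 s.2 (fun w => h w * (w - z)⁻¹)).sum)
      (cocompact ℂ) (𝓝 0) := by
    intro M
    induction M with
    | nil => simp
    | cons s M ih =>
      intro hM
      simpa using (hz s (hM s (by simp))).add (ih fun s hs => hM s (by simp [hs]))
  exact this L fun _ h => h

lemma exp_one_small {z : ℂ} (h1 : exp z = 1) (h2 : ‖z‖ < 1) : z = 0 := by
  obtain ⟨n, hn⟩ := exp_eq_one_iff.1 h1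
  have : ‖z‖ = |(n:ℝ)| * (2 * Real.pi) := by
    rw [hn]; simp [abs_of_pos Real.pi_pos]
  have hn0 : n = 0 := by
    by_contra h0
    have : (1:ℝ) ≤ |(n:ℝ)| := by exact_mod_cast Int.one_le_abs h0
    nlinarith [Real.pi_gt_three]
  rw [hn, hn0]; simp

theorem dixon {W : Set ℂ} (hW : IsOpen W) {x : ℂ} (hx : x ∈ W) {L : List (ℂ × ℂ)}
    (hL : IsP W x x L) (hbd : ∀ᶠ z in cocompact ℂ, z ∉ W)
    (hwn : ∀ c ∉ W, lInt L (fun w => (w - c)⁻¹) = 0) {h : ℂ → ℂ} (hh : DifferentiableOn ℂ h W) :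
    lInt L h = 0 := by
  have htr : trc L ⊆ W := by
    intro w hw
    obtain ⟨s, hs, hw⟩ := mem_trc.1 hw
    exact hL.seg s hs hw
  have hsub : ∀ s ∈ L, segment ℝ s.1 s.2 ⊆ trc L := fun s hs w hw => mem_trc.2 ⟨s, hs, hw⟩
  set g : ℂ → ℂ := fun w => h w * (w - x) with hg
  have hgd : DifferentiableOn ℂ g W := hh.mul (by fun_prop)
  have hgt : ContinuousOn g (trc L) := hgd.continuousOn.mono htr
  set Φ : ℂ → ℂ := fun z => if z ∈ W then lInt L (dslope g z) else
    lInt L (fun w => g w * (w - z)⁻¹) with hΦ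
  have hΦd : Differentiable ℂ Φ := by
    intro c
    by_cases hc : c ∈ W
    · have h1 : DifferentiableOn ℂ (fun z => lInt L (dslope g z)) W := by
        refine lInt_diff hW (k := fun z w => dslope g z w) ?_ ?_
        · exact fun s hs => (dslope_continuousOn hW hgd).mono (prod_mono_right (hL.seg s hs))
        · intro s hs w hw
          have hwW := hL.seg s hs hw
          refine ((Complex.differentiableOn_dslope (hW.mem_nhds hwW)).2 hgd).congr ?_
          intro z _
          by_cases hzw : z = w
          · rw [hzw]
          · rw [dslope_of_ne _ hzw, dslope_of_ne _ (Ne.symm hzw), slope_comm]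
      refine (h1.differentiableAt (hW.mem_nhds hc)).congr_of_eventuallyEq ?_
      filter_upwards [hW.mem_nhds hc] with z hz
      simp [hΦ, hz]
    · have hct : c ∈ (trc L)ᶜ := fun h => hc (htr h)
      have hop := (trc_compact L).isClosed.isOpen_compl
      have h1 := (cauchyT_diff L hgt).differentiableAt (hop.mem_nhds hct)
      refine h1.congr_of_eventuallyEq ?_
      have h2 := (cauchyT_diff L (h := fun _ => 1) continuousOn_const).continuousOn.continuousAt
        (hop.mem_nhds hct)
      simp only [one_mul] at h2
      have h3 := (Metric.continuousAt_iff'.1 h2) 1 one_pos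
      simp only [hwn c hc, dist_zero_right] at h3
      filter_upwards [h3, hop.mem_nhds hct] with z hz1 hz2
      by_cases hzW : z ∈ W
      · simp only [hΦ, hzW, if_true]
        have hzs : ∀ s ∈ L, z ∉ segment ℝ s.1 s.2 := fun s hs h => hz2 (hsub s hs h)
        have hN : lInt L (fun w => (w - z)⁻¹) = 0 := by
          by_cases hxz : x = z
          · have : L = [] := by
              cases hL with
              | nil => rfl
              | cons _ y _ L hs h => exact absurd (left_mem_segment ℝ x y) (hxz ▸ hzs (x, y) (by simp))
            simp [this, lInt]
          · have := (hL.lexp hzs hxz).1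
            rw [div_self (sub_ne_zero.2 hxz)] at this
            exact exp_one_small this hz1
        have hcont : ∀ s ∈ L, ContinuousOn (fun w => (w - z)⁻¹) (segment ℝ s.1 s.2) := fun s hs =>
          (by fun_prop : ContinuousOn (fun w => w - z) _).inv₀ fun w hw h0 =>
            hzs s hs ((sub_eq_zero.1 h0) ▸ hw)
        have := lInt_sub (L := L) (g := fun w => g w * (w - z)⁻¹) (h := fun w => (w - z)⁻¹)
          (fun s hs => (hgt.mono (hsub s hs)).mul (hcont s hs)) hcont (g z)
        rw [hN, mul_zero, sub_zero] at this
        rw [← this]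
        refine lInt_congr fun s hs w hw => ?_
        have hwz : w ≠ z := fun h => hzs s hs (h ▸ hw)
        rw [dslope_of_ne _ hwz, slope_def_field, div_eq_mul_inv]; ring
      · simp [hΦ, hzW]
  have hlim : Tendsto Φ (cocompact ℂ) (𝓝 0) := by
    refine (cauchyT_tendsto L hgt).congr' ?_
    filter_upwards [hbd] with z hz
    simp [hΦ, hz]
  have h0 := hΦd.apply_eq_of_tendsto_cocompact x hlim
  simp only [hΦ, hx, if_true] at h0
  rw [← h0]
  refine lInt_congr fun s hs w hw => ?_
  have hwW := hL.seg s hs hw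
  by_cases hwx : w = x
  · rw [hwx, dslope_same]
    have := ((hh.differentiableAt (hW.mem_nhds hx)).hasDerivAt.mul
      ((hasDerivAt_id x).sub_const x)).deriv
    simp only [id, sub_self, mul_zero, mul_one, zero_add] at this
    exact this.symm
  · rw [dslope_of_ne _ hwx, slope_def_field]
    simp only [hg, sub_self, mul_zero, sub_zero]
    rw [mul_div_assoc, div_self (sub_ne_zero.2 hwx), mul_one]

theorem primitive_of_wn {W : Set ℂ} (hW : IsOpen W) (hbd : ∀ᶠ z in cocompact ℂ, z ∉ W)
    (hwn : ∀ x ∈ W, ∀ L, IsP W x x L → ∀ c ∉ W, lInt L (fun w => (w - c)⁻¹) = 0) {h : ℂ → ℂ}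
    (hh : DifferentiableOn ℂ h W) : ∃ P : ℂ → ℂ, ∀ z ∈ W, HasDerivAt P (h z) z := by
  let b : ℂ → ℂ := fun z => if hn : (connectedComponentIn W z).Nonempty then hn.some else 0
  have hb : ∀ z ∈ W, b z ∈ connectedComponentIn W z := by
    intro z hz
    have hn : (connectedComponentIn W z).Nonempty := ⟨z, mem_connectedComponentIn hz⟩
    simp only [b, hn, dif_pos]; exact hn.some_mem
  have hball : ∀ z ∈ W, ∃ ε > 0, ball z ε ⊆ W := fun z hz => Metric.isOpen_iff.1 hW z hz
  have hseg : ∀ z ε, 0 < ε → ball z ε ⊆ W → ∀ w ∈ ball z ε, segment ℝ z w ⊆ W := fun z ε h0 h w hw =>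
    ((convex_ball z ε).segment_subset (mem_ball_self h0) hw).trans h
  have hreach : ∀ z ∈ W, ∃ L, IsP W (b z) z L := by
    intro z hz
    have hpc := isPreconnected_connectedComponentIn (F := W) (x := z)
    set S := {w | w ∈ W ∧ ∃ L, IsP W (b z) w L} with hS
    have hSo : IsOpen S := by
      rw [Metric.isOpen_iff]
      rintro w ⟨hw, L, hL⟩
      obtain ⟨ε, h0, h1⟩ := hball w hw
      exact ⟨ε, h0, fun y hy => ⟨h1 hy, _, hL.append (IsP.cons _ _ _ _ (hseg w ε h0 h1 y hy) (IsP.nil _))⟩⟩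
    have hSc : IsOpen (W \ S) := by
      rw [Metric.isOpen_iff]
      rintro w ⟨hw, hwS⟩
      obtain ⟨ε, h0, h1⟩ := hball w hw
      refine ⟨ε, h0, fun y hy => ⟨h1 hy, fun hyS => hwS ⟨hw, ?_⟩⟩⟩
      obtain ⟨_, L, hL⟩ := hyS
      exact ⟨_, hL.append (IsP.cons _ _ _ _ (segment_symm ℝ w y ▸ hseg w ε h0 h1 y hy) (IsP.nil _))⟩
    have hbW := connectedComponentIn_subset W z (hb z hz)
    have := hpc.subset_left_of_subset_union hSo hSc disjoint_sdiff_self_right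
      (by rw [union_sdiff_cancel (fun w hw => hw.1)]; exact connectedComponentIn_subset W z)
      ⟨b z, hb z hz, hbW, [], IsP.nil _⟩
    exact (this (mem_connectedComponentIn hz)).2
  choose! Lf hLf using hreach
  refine ⟨fun z => lInt (Lf z) h, fun z hz => ?_⟩
  obtain ⟨ε, h0, h1⟩ := hball z hz
  obtain ⟨P, hP⟩ := (hh.mono h1).isExactOn_ball
  have hev : (fun w => lInt (Lf w) h) =ᶠ[𝓝 z] fun w => lInt (Lf z) h + (P w - P z) := by
    filter_upwards [ball_mem_nhds z h0] with w hw
    have hbe : b w = b z := by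
      have : connectedComponentIn W w = connectedComponentIn W z := by
        apply connectedComponentIn_eq
        exact (convex_ball z ε).isPreconnected.subset_connectedComponentIn hw h1
          (mem_ball_self h0)
      simp only [b, this]
    have hs := hseg z ε h0 h1 w hw
    have hsb : segment ℝ z w ⊆ ball z ε := (convex_ball z ε).segment_subset (mem_ball_self h0) hw
    obtain ⟨L', hL', hI⟩ := (hLf w (h1 hw)).rev
    have hcl := (hLf z hz).append ((IsP.cons _ _ _ _ hs (IsP.nil _)).append (hbe ▸ hL'))
    have hbW := connectedComponentIn_subset W z (hb z hz)
    have := dixon hW hbW hcl hbd (hwn _ hbW _ hcl) hh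
    rw [lInt_append, lInt_append, hI] at this
    have h3 : lInt [(z, w)] h = P w - P z := by
      simp only [lInt, List.map_cons, List.map_nil, List.sum_cons, List.sum_nil, add_zero]
      exact sInt_prim (hh.continuousOn.mono hs) fun y hy => hP y (hsb hy)
    rw [h3] at this
    linear_combination -this
  have := ((hP z (mem_ball_self h0)).sub_const (P z)).const_add (lInt (Lf z) h)
  exact this.congr_of_eventuallyEq hev

lemma exp_const {X : Type*} [TopologicalSpace X] {S : Set X} (hS : IsPreconnected S) {N : X → ℂ}
    (hc : ContinuousOn N S) (h1 : ∀ c ∈ S, exp (N c) = 1) {x y : X} (hx : x ∈ S) (hy : y ∈ S) :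
    N x = N y := by
  have hT : ({w : ℂ | exp w = 1}).Countable := by
    refine (countable_range (fun n : ℤ => (n:ℂ) * (2 * Real.pi * I))).mono ?_
    intro w hw
    obtain ⟨n, hn⟩ := exp_eq_one_iff.1 hw
    exact ⟨n, hn.symm⟩
  exact hT.isTotallyDisconnected (N '' S) (by rintro _ ⟨c, hc, rfl⟩; exact h1 c hc)
    (hS.image N hc) (mem_image_of_mem N hx) (mem_image_of_mem N hy)

lemma isPreconnected_far : IsPreconnected {z : ℂ | 1 ≤ ‖z‖} := by
  have h1 : IsPreconnected ((fun p : ℝ × ℝ => (p.1 : ℂ) * exp (p.2 * I)) '' (Ici 1 ×ˢ univ)) :=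
    (isPreconnected_Ici.prod isPreconnected_univ).image _ (by fun_prop)
  convert h1 using 1
  ext z
  constructor
  · intro hz
    exact ⟨(‖z‖, arg z), ⟨hz, trivial⟩, by simp⟩
  · rintro ⟨p, ⟨hp, -⟩, rfl⟩
    simp only [mem_Ici] at hp
    simp only [mem_ofPred_eq, norm_mul, norm_real, Real.norm_eq_abs, norm_exp_ofReal_mul_I, mul_one]
    exact hp.trans (le_abs_self _)

theorem prim_ann {δ : ℝ} {F₁ F₂ : Set ℂ}
    (hcl : ann δ 1 ∩ closure (F₁ ∪ F₂) ⊆ F₁ ∪ F₂)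
    (hp1 : IsPreconnected F₁) (hp2 : IsPreconnected F₂)
    (h1 : (closure F₁ ∩ sphere 0 δ).Nonempty) (h2 : (closure F₁ ∩ sphere 0 1).Nonempty)
    (h3 : (closure F₂ ∩ sphere 0 δ).Nonempty)
    {h : ℂ → ℂ} (hh : DifferentiableOn ℂ h (ann δ 1 \ (F₁ ∪ F₂))) :
    ∃ P : ℂ → ℂ, ∀ z ∈ ann δ 1 \ (F₁ ∪ F₂), HasDerivAt P (h z) z := by
  set W := ann δ 1 \ (F₁ ∪ F₂) with hWd
  have hao : IsOpen (ann δ 1) := by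
    simp only [ann, ofPred_and]
    exact (isOpen_lt continuous_const continuous_norm).inter
      (isOpen_lt continuous_norm continuous_const)
  have hW : IsOpen W := by
    have : W = ann δ 1 \ closure (F₁ ∪ F₂) := by
      ext z; constructor
      · rintro ⟨ha, hb⟩; exact ⟨ha, fun hc => hb (hcl ⟨ha, hc⟩)⟩
      · rintro ⟨ha, hb⟩; exact ⟨ha, fun hc => hb (subset_closure hc)⟩
    rw [this]; exact hao.sdiff isClosed_closure
  have hbd : ∀ᶠ z in cocompact ℂ, z ∉ W := by
    filter_upwards [(tendsto_norm_cocompact_atTop (E := ℂ)).eventually_ge_atTop 1] with z hz hzW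
    exact absurd hzW.1.2 (not_lt.2 hz)
  have hWc : Wᶜ = {z : ℂ | 1 ≤ ‖z‖} ∪ closure F₁ ∪ closedBall 0 δ ∪ closure F₂ := by
    ext z
    simp only [hWd, mem_compl_iff, Set.mem_sdiff, not_and, not_not, mem_union, mem_ofPred_eq,
      mem_closedBall, dist_zero_right]
    constructor
    · intro hz
      by_cases ha : z ∈ ann δ 1
      · rcases hz ha with hz | hz
        · exact Or.inl (Or.inl (Or.inr (subset_closure hz)))
        · exact Or.inr (subset_closure hz)
      · simp only [ann, mem_ofPred_eq, not_and, not_lt] at ha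
        by_cases hd : δ < ‖z‖
        · exact Or.inl (Or.inl (Or.inl (ha hd)))
        · exact Or.inl (Or.inr (not_lt.1 hd))
    · intro hz ha
      rcases hz with ((hz | hz) | hz) | hz
      · exact absurd ha.2 (not_lt.2 hz)
      · exact hcl ⟨ha, closure_mono subset_union_left hz⟩
      · exact absurd ha.1 (not_lt.2 hz)
      · exact hcl ⟨ha, closure_mono subset_union_right hz⟩
  have hpre : IsPreconnected Wᶜ := by
    rw [hWc]
    obtain ⟨a, ha, ha'⟩ := h1
    obtain ⟨b, hb, hb'⟩ := h2
    obtain ⟨c, hc, hc'⟩ := h3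
    simp only [mem_sphere, dist_zero_right] at ha' hb' hc'
    refine ((isPreconnected_far.union b ?_ hb hp1.closure).union a ?_ ?_
      (convex_closedBall _ _).isPreconnected).union c ?_ hc hp2.closure
    · exact hb'.ge
    · exact Or.inr ha
    · simp [ha']
    · exact Or.inr (by simp [hc'])
  refine primitive_of_wn hW hbd ?_ hh
  intro x hx L hL c hc
  have htr : trc L ⊆ W := by
    intro w hw
    obtain ⟨s, hs, hw⟩ := mem_trc.1 hw
    exact hL.seg s hs hw
  have hcont : ContinuousOn (fun c => lInt L (fun w => (w - c)⁻¹)) Wᶜ := by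
    have := (cauchyT_diff L (h := fun _ => 1) continuousOn_const).continuousOn.mono
      (compl_subset_compl.2 htr)
    simpa using this
  have hexp : ∀ c ∈ Wᶜ, exp (lInt L (fun w => (w - c)⁻¹)) = 1 := by
    intro c hc
    have hxc : x ≠ c := fun h => hc (h ▸ hx)
    rw [(hL.lexp (fun s hs h => hc (hL.seg s hs h)) hxc).1, div_self (sub_ne_zero.2 hxc)]
  have hlim := cauchyT_tendsto L (h := fun _ => 1) continuousOn_const
  simp only [one_mul] at hlim
  have hlim2 : Tendsto (fun z => lInt L (fun w => (w - z)⁻¹)) (cocompact ℂ)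
      (𝓝 (lInt L (fun w => (w - c)⁻¹))) := by
    refine tendsto_const_nhds.congr' ?_
    filter_upwards [hbd] with z hz
    exact exp_const hpre hcont hexp hc hz
  exact tendsto_nhds_unique hlim2 hlim

lemma log_of_prim {W : Set ℂ} (hW : IsOpen W) {h P : ℂ → ℂ} (hh : DifferentiableOn ℂ h W)
    (h0 : ∀ z ∈ W, h z ≠ 0) (hP : ∀ z ∈ W, HasDerivAt P (deriv h z / h z) z) :
    ∃ l : ℂ → ℂ, DifferentiableOn ℂ l W ∧ ∀ z ∈ W, exp (l z) = h z := by
  set q : ℂ → ℂ := fun z => h z * exp (- P z) with hq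
  have hqd : ∀ z ∈ W, HasDerivAt q 0 z := by
    intro z hz
    have h1 := (hh.differentiableAt (hW.mem_nhds hz)).hasDerivAt.mul (hP z hz).neg.cexp
    refine h1.congr_deriv ?_
    have e : h z * (deriv h z / h z) = deriv h z := mul_div_cancel₀ _ (h0 z hz)
    simp only [Pi.neg_apply]
    linear_combination -exp (-P z) * e
  refine ⟨fun z => P z + Complex.log (q z), fun z hz => ?_, fun z hz => ?_⟩
  · obtain ⟨ε, he, hb⟩ := Metric.isOpen_iff.1 hW z hz
    have hcst : ∀ w ∈ ball z ε, q w = q z := fun w hw =>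
      (convex_ball z ε).is_const_of_fderivWithin_eq_zero
        (𝕜 := ℂ) (fun y hy => (hqd y (hb hy)).differentiableAt.differentiableWithinAt)
        (fun y hy => by
          rw [fderivWithin_of_isOpen isOpen_ball hy, (hqd y (hb hy)).hasFDerivAt.fderiv]; simp)
        hw (mem_ball_self he)
    have hd : DifferentiableAt ℂ (fun w => P w + Complex.log (q z)) z :=
      ((hP z hz).differentiableAt).add_const _
    refine (hd.congr_of_eventuallyEq ?_).differentiableWithinAt
    filter_upwards [ball_mem_nhds z he] with w hw
    rw [hcst w hw]
  · have : q z ≠ 0 := mul_ne_zero (h0 z hz) (exp_ne_zero _)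
    rw [exp_add, exp_log this, hq]
    simp only
    rw [mul_left_comm, ← exp_add]; simp

lemma maxLim {D : Set ℂ} (hD : IsOpen D) (hb : Bornology.IsBounded D) {Φ : ℂ → ℂ}
    (hΦ : DifferentiableOn ℂ Φ D) {B : ℝ}
    (h : ∀ ζ ∈ frontier D, ∀ η > 0, ∀ᶠ z in 𝓝[D] ζ, ‖Φ z‖ ≤ B + η) :
    ∀ z ∈ D, ‖Φ z‖ ≤ B := by
  intro z hz
  by_contra! hlt
  obtain ⟨η, hη, hlt'⟩ : ∃ η > 0, B + η < ‖Φ z‖ := ⟨(‖Φ z‖ - B) / 2, by linarith, by linarith⟩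
  set V := D ∩ (fun z => ‖Φ z‖) ⁻¹' Ioi (B + η) with hVd
  have hV : IsOpen V := hΦ.continuousOn.norm.isOpen_inter_preimage hD isOpen_Ioi
  have hcl : closure V ⊆ D := by
    intro ζ hζ
    by_contra hn
    have hfr : ζ ∈ frontier D := by
      rw [hD.frontier_eq]; exact ⟨closure_mono inter_subset_left hζ, hn⟩
    have h1 : ∃ᶠ z in 𝓝 ζ, z ∈ V := mem_closure_iff_frequently.1 hζ
    have h2 := eventually_nhdsWithin_iff.1 (h ζ hfr η hη)
    obtain ⟨w, hw, hw2⟩ := (h1.and_eventually h2).exists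
    exact absurd (hw2 hw.1) (not_le.2 hw.2)
  have := norm_le_of_forall_mem_frontier_norm_le (hb.subset inter_subset_left : Bornology.IsBounded V)
    (f := Φ) (C := B + η) ⟨hΦ.mono inter_subset_left, hΦ.continuousOn.mono hcl⟩ (fun w hw => by
      rw [hV.frontier_eq] at hw
      by_contra! hc
      exact hw.2 ⟨hcl hw.1, hc⟩) (subset_closure ⟨hz, hlt'⟩)
  linarith

lemma cayley {c : ℂ} {R : ℝ} {h : ℂ → ℂ} (hR : 0 < R)
    (hd : DifferentiableOn ℂ h (ball c R)) (hp : ∀ z ∈ ball c R, 0 < (h z).im) :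
    ‖deriv h c‖ ≤ 2 * (h c).im / R ∧ ∀ z ∈ ball c R,
      ‖h z - h c‖ * R ≤ ‖z - c‖ * ‖h z - (starRingEnd ℂ) (h c)‖ := by
  set w := (starRingEnd ℂ) (h c) with hw
  have hc := mem_ball_self (x := c) hR
  have hne : ∀ z ∈ ball c R, h z - w ≠ 0 := fun z hz h0 => by
    have := congrArg Complex.im h0
    simp [hw] at this
    linarith [hp z hz, hp c hc]
  set φ : ℂ → ℂ := fun z => (h z - h c) / (h z - w) with hφ
  have hφd : DifferentiableOn ℂ φ (ball c R) :=
    (hd.sub_const _).div (hd.sub_const _) hne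
  have hφc : φ c = 0 := by simp [hφ]
  have hm : MapsTo φ (ball c R) (ball (φ c) 1) := by
    intro z hz
    rw [hφc, mem_ball_zero_iff, hφ]
    simp only [norm_div]
    rw [div_lt_one (norm_pos_iff.2 (hne z hz))]
    refine lt_of_pow_lt_pow_left₀ 2 (norm_nonneg _) ?_
    rw [Complex.sq_norm, Complex.sq_norm, normSq_apply, normSq_apply]
    simp [hw]
    nlinarith [hp z hz, hp c hc]
  refine ⟨?_, fun z hz => ?_⟩
  · have h1 := norm_deriv_le_div_of_mapsTo_ball hφd (hm.mono_right ball_subset_closedBall) hR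
    have h2 : HasDerivAt φ (deriv h c / (h c - w)) c := by
      have hh := (hd.differentiableAt (ball_mem_nhds c hR)).hasDerivAt
      refine ((hh.sub_const (h c)).div (hh.sub_const w) (hne c hc)).congr_deriv ?_
      have := hne c hc
      field_simp
      ring
    rw [h2.deriv, norm_div] at h1
    have h3 : ‖h c - w‖ = 2 * (h c).im := by
      rw [hw, sub_conj]; simp [abs_of_pos (hp c hc)]
    rw [h3, div_le_div_iff₀ (by linarith [hp c hc]) hR] at h1
    rw [le_div_iff₀ hR]; linarith
  · have h1 := dist_le_div_mul_dist_of_mapsTo_ball hφd (hm.mono_right ball_subset_closedBall) hz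
    rw [hφc, dist_zero_right, hφ] at h1
    simp only [norm_div] at h1
    rw [div_le_iff₀ (norm_pos_iff.2 (hne z hz)), dist_eq_norm] at h1
    calc _ ≤ (1 / R * ‖z - c‖ * ‖h z - w‖) * R := by gcongr
      _ = _ := by field_simp

lemma harnack {c : ℂ} {R : ℝ} {h : ℂ → ℂ} (hR : 0 < R)
    (hd : DifferentiableOn ℂ h (ball c R)) (hp : ∀ z ∈ ball c R, 0 < (h z).im) {z : ℂ}
    (hz : z ∈ ball c R) :
    (h c).im * (R - ‖z - c‖) ≤ (h z).im * (R + ‖z - c‖) := by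
  have h1 := (cayley hR hd hp).2 z hz
  rw [mem_ball, dist_eq_norm] at hz
  have h2 : (‖h z - h c‖ * R) ^ 2 ≤ (‖z - c‖ * ‖h z - (starRingEnd ℂ) (h c)‖) ^ 2 := by gcongr
  rw [mul_pow, mul_pow, Complex.sq_norm (h z - h c), Complex.sq_norm (h z - _), normSq_apply,
    normSq_apply] at h2
  simp at h2
  have p1 := hp c (mem_ball_self hR)
  have p2 := hp z (by simpa [dist_eq_norm] using hz)
  have hn := norm_nonneg (z - c)
  set a := (h z).im
  set y := (h c).im
  set x := (h z).re - (h c).re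
  set ρ := ‖z - c‖
  have h3 : ((y - a) * R) ^ 2 ≤ (ρ * (a + y)) ^ 2 := by
    nlinarith [mul_nonneg (sq_nonneg x) (by nlinarith : 0 ≤ R ^ 2 - ρ ^ 2)]
  have := abs_le_of_sq_le_sq' h3 (by positivity)
  nlinarith [this.2]

lemma ann_open (a b : ℝ) : IsOpen (ann a b) := by
  simp only [ann, ofPred_and]
  exact (isOpen_lt continuous_const continuous_norm).inter
    (isOpen_lt continuous_norm continuous_const)

noncomputable def fU (u : ℂ → ℝ) (z : ℂ) : ℂ :=
  I * ((fderiv ℝ u z 1 : ℝ) - I * (fderiv ℝ u z I : ℝ))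

lemma fU_norm (u : ℂ → ℝ) (z : ℂ) : ‖fU u z‖ = ‖grad2 u z‖ := by
  rw [fU, norm_mul, norm_I, one_mul, grad2, ← Complex.norm_conj]
  congr 1
  simp [mul_comm]

lemma fU_im (u : ℂ → ℝ) (z e : ℂ) : (fU u z * e).im = fderiv ℝ u z e := by
  conv_rhs => rw [show e = e.re • (1:ℂ) + e.im • I by simp]
  rw [map_add, map_smul, map_smul, fU]
  simp
  ring

section
variable {Ω : Set ℂ} {u : ℂ → ℝ}

lemma posSet_open (hΩ : IsOpen Ω) (h : IsClassicalSolution Ω u) : IsOpen (posSet Ω u) := by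
  have := h.contOn.isOpen_inter_preimage hΩ (isOpen_Ioi (a := (0:ℝ)))
  exact this

lemma fU_diff (hΩ : IsOpen Ω) (h : IsClassicalSolution Ω u) :
    DifferentiableOn ℂ (fU u) (posSet Ω u) := by
  intro z hz
  have ho := posSet_open hΩ h
  have hH : InnerProductSpace.HarmonicAt u z := by
    refine ⟨h.harm.1.contDiffAt (ho.mem_nhds hz), ?_⟩
    filter_upwards [ho.mem_nhds hz] with w hw
    have h2 := h.harm.2 w hw
    have hd : DifferentiableAt ℝ (fderiv ℝ u) w :=
      ((h.harm.1.contDiffAt (ho.mem_nhds hw)).fderiv_right (m := 1) (by norm_num)).differentiableAt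
        (by norm_num)
    simp only [InnerProductSpace.laplacian_eq_iteratedFDeriv_complexPlane, iteratedFDeriv_two_apply]
    simp only [hess] at h2
    have e : ∀ a b : ℂ, fderiv ℝ (fun x => fderiv ℝ u x a) w b = fderiv ℝ (fderiv ℝ u) w b a := by
      intro a b
      rw [fderiv_clm_apply hd (by fun_prop)]; simp
    rw [e, e] at h2
    simpa using h2
  exact ((HarmonicAt.differentiableAt_complex_partial hH).const_mul I).differentiableWithinAt

lemma fU_lim (hΩ : IsOpen Ω) (h : IsClassicalSolution Ω u) {p : ℂ} (hp : p ∈ FB Ω u) :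
    ∃ L : ℂ, ‖L‖ = 1 ∧ Tendsto (fU u) (𝓝[posSet Ω u] p) (𝓝 L) := by
  have ho := posSet_open hΩ h
  have hpc : p ∈ closure (posSet Ω u) := frontier_subset_closure hp.2
  obtain ⟨v, hv, huv⟩ := h.smooth_ext
  have hpS : p ∈ Ω ∩ closure (posSet Ω u) := ⟨hp.1, hpc⟩
  have h1 : ContDiffWithinAt ℝ ((0:ℕ) + 1) v (Ω ∩ closure (posSet Ω u)) p :=
    (hv p hpS).of_le (by norm_cast)
  obtain ⟨t, ht, hts, -, D, hD, hDc⟩ := (contDiffWithinAt_succ_iff_hasFDerivWithinAt' (by simp)).1 h1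
  rw [insert_eq_of_mem hpS] at ht
  have hsub : posSet Ω u ⊆ Ω ∩ closure (posSet Ω u) := fun z hz => ⟨hz.1, subset_closure hz⟩
  have hlim : Tendsto (fderiv ℝ u) (𝓝[posSet Ω u] p) (𝓝 (D p)) := by
    refine (hDc.continuousWithinAt.mono hsub).tendsto.congr' ?_
    filter_upwards [nhdsWithin_mono p hsub ht, self_mem_nhdsWithin] with z hz hzU
    have h2 := ((hD z hz).mono hsub).hasFDerivAt (ho.mem_nhds hzU)
    refine (h2.congr_of_eventuallyEq ?_).fderiv.symm
    filter_upwards [ho.mem_nhds hzU] with w hw using huv (hsub hw)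
  have hl2 : Tendsto (fU u) (𝓝[posSet Ω u] p) (𝓝 (I * ((D p 1 : ℝ) - I * (D p I : ℝ)))) := by
    have e1 : ∀ a : ℂ, Tendsto (fun z => ((fderiv ℝ u z a : ℝ) : ℂ)) (𝓝[posSet Ω u] p)
        (𝓝 ((D p a : ℝ) : ℂ)) := fun a =>
      (continuous_ofReal.tendsto _).comp (((ContinuousLinearMap.apply ℝ ℝ a).continuous.tendsto _).comp hlim)
    exact ((e1 1).sub ((e1 I).const_mul I)).const_mul I
  refine ⟨_, ?_, hl2⟩
  have := mem_closure_iff_nhdsWithin_neBot.mp hpc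
  refine tendsto_nhds_unique hl2.norm ?_
  simpa only [fU_norm] using h.grad_one p hp

lemma cone_lem (hΩ : IsOpen Ω) (h : IsClassicalSolution Ω u) {p L : ℂ} (hp : p ∈ Ω)
    (hl : Tendsto (fU u) (𝓝[posSet Ω u] p) (𝓝 L)) :
    ∃ ρ > 0, ∀ z ∈ posSet Ω u, ∀ e : ℂ, z ∈ ball p ρ → z + e ∈ ball p ρ →
      ‖e‖ / 2 ≤ (L * e).im → z + e ∈ posSet Ω u := by
  have ho := posSet_open hΩ h
  have h1 : ∀ᶠ z in 𝓝 p, z ∈ posSet Ω u → ‖fU u z - L‖ < 1 / 4 := by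
    have := (tendsto_iff_norm_sub_tendsto_zero.1 hl).eventually_lt_const (show (0:ℝ) < 1/4 by norm_num)
    exact eventually_nhdsWithin_iff.1 this
  obtain ⟨ρ, hρ, hb⟩ := Metric.eventually_nhds_iff_ball.1 (h1.and (hΩ.mem_nhds hp))
  refine ⟨ρ, hρ, fun z hz e hzb heb hc => ?_⟩
  rcases eq_or_ne e 0 with rfl | he
  · simpa using hz
  have he' : 0 < ‖e‖ := norm_pos_iff.2 he
  have hseg : ∀ t ∈ Icc (0:ℝ) 1, z + t * e ∈ ball p ρ := by
    intro t ht
    have := (convex_ball p ρ).add_smul_sub_mem hzb heb ht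
    simpa using this
  set φ : ℝ → ℝ := fun t => u (z + t * e) with hφ
  have hφc : ContinuousOn φ (Icc 0 1) := by
    refine h.contOn.comp (by fun_prop) (fun t ht => (hb _ (hseg t ht)).2)
  have key : Icc (0:ℝ) 1 ⊆ {t | u z ≤ φ t} := by
    refine IsClosed.Icc_subset_of_forall_exists_gt ?_ (by simp [hφ]) ?_
    · have := hφc.preimage_isClosed_of_isClosed isClosed_Icc (isClosed_Ici (a := u z))
      rwa [inter_comm] at this
    · rintro x ⟨hx, hx01⟩ y hy
      have hxU : z + x * e ∈ posSet Ω u :=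
        ⟨(hb _ (hseg x ⟨hx01.1, hx01.2.le⟩)).2, lt_of_lt_of_le hz.2 hx⟩
      have hd : HasDerivAt φ (fU u (z + x * e) * e).im x := by
        rw [fU_im]
        have h3 : HasFDerivAt u (fderiv ℝ u (z + x * e)) (z + x * e) :=
          ((h.harm.1.contDiffAt (ho.mem_nhds hxU)).differentiableAt (by norm_num)).hasFDerivAt
        have h4 : HasDerivAt (fun t : ℝ => z + t * e) e x := by
          simpa using ((hasDerivAt_id x).ofReal_comp.mul_const e).const_add z
        exact h3.comp_hasDerivAt x h4
      have hpos : 0 < (fU u (z + x * e) * e).im := by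
        have h5 := (hb _ (hseg x ⟨hx01.1, hx01.2.le⟩)).1 hxU
        have h6 : |((fU u (z + x * e) - L) * e).im| ≤ 1 / 4 * ‖e‖ := by
          refine (abs_im_le_norm _).trans ?_
          rw [norm_mul]; gcongr
        rw [sub_mul, sub_im] at h6
        linarith [(abs_le.1 h6).1]
      have h7 := (hasDerivAt_iff_tendsto_slope.1 hd).eventually_const_lt hpos
      have h8 : ∀ᶠ t in 𝓝[>] x, 0 < slope φ x t := nhdsWithin_mono x (fun t (ht : x < t) => ht.ne') h7
      obtain ⟨t, ht, htx⟩ := (h8.and (Ioc_mem_nhdsGT hy)).exists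
      refine ⟨t, ?_, htx⟩
      rw [slope_def_field, div_pos_iff_of_pos_right (by linarith [htx.1])] at ht
      simp only [mem_ofPred_eq] at hx ⊢
      linarith
  have h9 := key (right_mem_Icc.2 zero_le_one)
  simp only [mem_ofPred_eq, hφ, ofReal_one, one_mul] at h9
  exact ⟨(hb _ heb).2, lt_of_lt_of_le hz.2 h9⟩
end

def Cone (U : Set ℂ) (p L : ℂ) (ρ : ℝ) : Prop :=
  ∀ z ∈ U, ∀ e : ℂ, z ∈ ball p ρ → z + e ∈ ball p ρ → ‖e‖ / 2 ≤ (L * e).im → z + e ∈ U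

lemma seg_mvt {U : Set ℂ} {G f : ℂ → ℂ} (hG : ∀ z ∈ U, HasDerivAt G (f z) z) {a b L : ℂ} {η : ℝ}
    (hs : ∀ w ∈ segment ℝ a b, w ∈ U ∧ ‖f w - L‖ ≤ η) :
    ‖G b - G a - L * (b - a)‖ ≤ η * ‖b - a‖ := by
  have := (convex_segment (𝕜 := ℝ) a b).norm_image_sub_le_of_norm_hasDerivWithin_le
    (f := fun w => G w - L * w) (f' := fun w => f w - L) (C := η) (x := a) (y := b)
    (fun w hw => by
      have h1 := ((hG w (hs w hw).1).sub ((hasDerivAt_id w).const_mul L)).hasDerivWithinAt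
        (s := segment ℝ a b)
      rw [mul_one] at h1; exact h1)
    (fun w hw => (hs w hw).2) (left_mem_segment _ _ _) (right_mem_segment _ _ _)
  refine le_trans (le_of_eq ?_) this
  congr 1; ring

lemma exists_n {L : ℂ} (hL : ‖L‖ = 1) : ∃ n : ℂ, ‖n‖ = 1 ∧ L * n = I := by
  have : L ≠ 0 := fun h => by simp [h] at hL
  exact ⟨I / L, by simp [hL], by field_simp⟩

lemma L3a0 {U : Set ℂ} {G f : ℂ → ℂ} (hG : ∀ z ∈ U, HasDerivAt G (f z) z) {p L : ℂ} {ρ₀ : ℝ}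
    (hL : ‖L‖ = 1) (hl : Tendsto f (𝓝[U] p) (𝓝 L)) (hρ : 0 < ρ₀) (hc : Cone U p L ρ₀) {η : ℝ}
    (hη : 0 < η) :
    ∃ ρ > 0, ∀ z ∈ U ∩ ball p ρ, ∀ z' ∈ U ∩ ball p ρ,
      ‖G z' - G z - L * (z' - z)‖ ≤ η * ‖z' - z‖ := by
  have h1 : ∀ᶠ z in 𝓝 p, z ∈ U → ‖f z - L‖ < η / 9 := by
    have := (tendsto_iff_norm_sub_tendsto_zero.1 hl).eventually_lt_const (show (0:ℝ) < η/9 by linarith)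
    exact eventually_nhdsWithin_iff.1 this
  obtain ⟨ρ₁, hρ₁, hb⟩ := Metric.eventually_nhds_iff_ball.1 h1
  obtain ⟨n, hn, hLn⟩ := exists_n hL
  have hLi : ∀ r : ℝ, (L * ((r : ℂ) * n)).im = r := fun r => by rw [mul_left_comm, hLn]; simp
  set m := min ρ₀ ρ₁
  have hm : 0 < m := lt_min hρ hρ₁
  refine ⟨m / 20, by linarith, fun z hz z' hz' => ?_⟩
  set d := ‖z' - z‖ with hd
  have hz1 : ‖z - p‖ < m / 20 := by simpa [dist_eq_norm] using hz.2
  have hz2 : ‖z' - p‖ < m / 20 := by simpa [dist_eq_norm] using hz'.2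
  have hd0 : 0 ≤ d := norm_nonneg _
  have hd1 : d < m / 10 := by
    have := norm_sub_le_norm_sub_add_norm_sub z' p z
    rw [norm_sub_rev p z] at this; linarith
  have good : ∀ x ∈ U ∩ ball p (m/20), ∀ e : ℂ, ‖e‖ ≤ 5 * d → ‖e‖ / 2 ≤ (L * e).im →
      x + e ∈ U ∧ ‖f (x + e) - L‖ ≤ η / 9 := by
    intro x hx e he hce
    have hx1 : ‖x - p‖ < m / 20 := by simpa [dist_eq_norm] using hx.2
    have hxe : ‖x + e - p‖ < m := by
      have := norm_add_le (x - p) e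
      rw [show x + e - p = x - p + e by ring]; linarith
    have hU : x + e ∈ U := hc x hx.1 e (by rw [mem_ball, dist_eq_norm]; linarith [min_le_left ρ₀ ρ₁])
      (by rw [mem_ball, dist_eq_norm]; linarith [min_le_left ρ₀ ρ₁]) hce
    exact ⟨hU, (hb _ (by rw [mem_ball, dist_eq_norm]; linarith [min_le_right ρ₀ ρ₁]) hU).le⟩
  have up : ∀ x ∈ U ∩ ball p (m/20), ∀ w ∈ segment ℝ x (x + (4 * d : ℝ) * n), w ∈ U ∧ ‖f w - L‖ ≤ η / 9 := by
    intro x hx w hw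
    obtain ⟨t, ht, rfl⟩ := segm_sg hw
    have : sg x (x + (4 * d : ℝ) * n) t = x + ((t * (4 * d) : ℝ) : ℂ) * n := by
      simp [sg]; ring
    rw [this]
    have h0 : 0 ≤ t * (4 * d) := mul_nonneg ht.1 (by linarith)
    have hne : ‖((t * (4 * d) : ℝ) : ℂ) * n‖ = t * (4 * d) := by
      rw [norm_mul, hn, norm_real, Real.norm_of_nonneg h0, mul_one]
    refine good x hx _ ?_ ?_
    · rw [hne]; nlinarith [ht.2]
    · rw [hne, hLi]; linarith
  have e1 := seg_mvt hG (up z hz)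
  have e3 := seg_mvt hG (up z' hz')
  have e2 := seg_mvt hG (a := z + (4 * d : ℝ) * n) (b := z' + (4 * d : ℝ) * n) (L := L) (η := η / 9) (by
    intro w hw
    obtain ⟨t, ht, rfl⟩ := segm_sg hw
    have : sg (z + (4 * d : ℝ) * n) (z' + (4 * d : ℝ) * n) t = z + ((4 * d : ℝ) * n + t * (z' - z)) := by
      simp [sg]; ring
    rw [this]
    have ha : ‖((4 * d : ℝ) : ℂ) * n‖ = 4 * d := by
      rw [norm_mul, hn, norm_real, Real.norm_of_nonneg (by linarith), mul_one]
    have hb' : ‖(t : ℂ) * (z' - z)‖ ≤ d := by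
      rw [norm_mul, norm_real, Real.norm_of_nonneg ht.1]; nlinarith [ht.2]
    have hne := norm_add_le (((4 * d : ℝ) : ℂ) * n) (t * (z' - z))
    refine good z hz _ (by linarith) ?_
    have hi := abs_im_le_norm (L * (t * (z' - z)))
    rw [norm_mul, hL, one_mul] at hi
    rw [mul_add, add_im, hLi]
    linarith [(abs_le.1 hi).1])
  have ha : ‖((4 * d : ℝ) : ℂ) * n‖ = 4 * d := by
    rw [norm_mul, hn, norm_real, Real.norm_of_nonneg (by linarith), mul_one]
  rw [add_sub_cancel_left, ha] at e1 e3
  rw [add_sub_add_right_eq_sub, ← hd] at e2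
  set A := G (z + (4 * d : ℝ) * n)
  set B := G (z' + (4 * d : ℝ) * n)
  have : G z' - G z - L * (z' - z) = (A - G z - L * ((4 * d : ℝ) * n)) + (B - A - L * (z' - z))
    - (B - G z' - L * ((4 * d : ℝ) * n)) := by ring
  rw [this]
  refine (norm_sub_le _ _).trans ((add_le_add_left (norm_add_le _ _) _).trans ?_)
  linarith

structure Sol (δ : ℝ) (U : Set ℂ) (F : Bool → Set ℂ) (G f : ℂ → ℂ) : Prop where
  hδ : 0 < δ
  Uo : IsOpen U
  UΩ : U ⊆ ann δ 1
  FΩ : ∀ i, F i ⊆ ann δ 1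
  FU : ∀ i, Disjoint (F i) U
  FF : ∀ i, Disjoint (F i) (F !i)
  clU : ∀ z ∈ ann δ 1, z ∈ closure U → z ∈ U ∨ ∃ i, z ∈ F i
  Fcl : ∀ i, F i ⊆ closure U
  Frc : ∀ i, ∀ z ∈ ann δ 1, z ∈ closure (F i) → z ∈ F i
  Fco : ∀ i, IsPreconnected (F i)
  Fin : ∀ i, (closure (F i) ∩ sphere 0 δ).Nonempty
  Fout : ∀ i, (closure (F i) ∩ sphere 0 1).Nonempty
  der : ∀ z ∈ U, HasDerivAt G (f z) z
  fd : DifferentiableOn ℂ f U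
  pos : ∀ z ∈ U, 0 < (G z).im
  Gc : ContinuousOn G (U ∪ ⋃ i, F i)
  Gr : ∀ i, ∀ z ∈ F i, (G z).im = 0
  loc : ∀ i, ∀ p ∈ F i, ∃ L : ℂ, ‖L‖ = 1 ∧ Tendsto f (𝓝[U] p) (𝓝 L) ∧ ∃ ρ > 0, Cone U p L ρ

theorem exists_Sol {δ : ℝ} (hδ : 0 < δ) {u : ℂ → ℝ} (h : IsClassicalSolution (ann δ 1) u)
    (hA : ConditionA δ 1 u) : ∃ F G f, Sol δ (posSet (ann δ 1) u) F G f := by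
  obtain ⟨F₁, F₂, hn1, hn2, hdis, hun, hc1, hc2, -, -, hi1, ho1, hi2, ho2⟩ := hA
  set Ω := ann δ 1 with hΩd
  set U := posSet Ω u with hUd
  have hΩ : IsOpen Ω := ann_open _ _
  have hU : IsOpen U := posSet_open hΩ h
  set F : Bool → Set ℂ := fun i => if i then F₁ else F₂ with hF
  have hFB : ∀ i, F i ⊆ FB Ω u := by
    intro i; cases i <;> simp [hF, ← hun]
  have hFc : ∀ i, ∀ z ∈ F i, connectedComponentIn (FB Ω u) z = F i := by
    intro i; cases i <;> simpa [hF]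
  have hFn : ∀ i, (F i).Nonempty := by intro i; cases i <;> simpa [hF]
  have hFco : ∀ i, IsPreconnected (F i) := by
    intro i
    obtain ⟨z, hz⟩ := hFn i
    rw [← hFc i z hz]; exact isPreconnected_connectedComponentIn
  have hFBnU : ∀ z ∈ FB Ω u, z ∉ U := fun z hz => by
    have := hz.2; rw [hU.frontier_eq] at this; exact this.2
  have hFBmem : ∀ z ∈ FB Ω u, ∃ i, z ∈ F i := by
    intro z hz; rw [← hun] at hz
    rcases hz with hz | hz
    · exact ⟨true, by simpa [hF]⟩
    · exact ⟨false, by simpa [hF]⟩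
  have hpr : ∃ P : ℂ → ℂ, ∀ z ∈ Ω \ (F₁ ∪ F₂), HasDerivAt P (U.indicator (fU u) z) z := by
    have hp1 := hFco true
    have hp2 := hFco false
    simp only [hF, if_true, Bool.false_eq_true, if_false] at hp1 hp2
    refine prim_ann ?_ hp1 hp2 hi1 ho1 hi2 ?_
    · rw [hun]; rintro z ⟨hz, hz'⟩
      refine ⟨hz, ?_⟩
      exact closure_minimal inter_subset_right isClosed_frontier hz'
    · rw [hun]
      intro z hz
      by_cases hzU : z ∈ U
      · refine (((fU_diff hΩ h).differentiableAt (hU.mem_nhds hzU)).congr_of_eventuallyEq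
          ?_).differentiableWithinAt
        filter_upwards [hU.mem_nhds hzU] with w hw
        rw [indicator_of_mem hw]
      · have hzc : z ∉ closure U := fun hc => hz.2 ⟨hz.1, by rw [hU.frontier_eq]; exact ⟨hc, hzU⟩⟩
        refine ((differentiableAt_const (0:ℂ)).congr_of_eventuallyEq ?_).differentiableWithinAt
        filter_upwards [isClosed_closure.isOpen_compl.mem_nhds hzc] with w hw
        rw [indicator_of_notMem (fun hh => hw (subset_closure hh))]
  obtain ⟨P, hP⟩ := hpr
  have hPU : ∀ z ∈ U, HasDerivAt P (fU u z) z := fun z hz => by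
    have := hP z ⟨hz.1, by rw [hun]; exact fun hh => hFBnU z hh hz⟩
    rwa [indicator_of_mem hz] at this
  set G₀ : ℂ → ℂ := fun z => P z - I * (((P z).im - u z : ℝ) : ℂ) with hG₀
  have hGim : ∀ z, (G₀ z).im = u z := fun z => by simp [hG₀]
  have hGd : ∀ z ∈ U, HasDerivAt G₀ (fU u z) z := by
    intro z hz
    obtain ⟨ε, he, hb⟩ := Metric.isOpen_iff.1 hU z hz
    have hqd : ∀ w ∈ U, HasFDerivAt (fun z => (P z).im - u z) (0 : ℂ →L[ℝ] ℝ) w := by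
      intro w hw
      have h1 := (hPU w hw).hasFDerivAt.restrictScalars ℝ
      have h2 : HasFDerivAt u (fderiv ℝ u w) w :=
        ((h.harm.1.contDiffAt (hU.mem_nhds hw)).differentiableAt (by norm_num)).hasFDerivAt
      refine ((imCLM.hasFDerivAt.comp w h1).sub h2).congr_fderiv ?_
      refine ContinuousLinearMap.ext fun e => ?_
      have := fU_im u w e
      simp [mul_comm] at this ⊢
      linarith
    have hcst : ∀ w ∈ ball z ε, (P w).im - u w = (P z).im - u z := fun w hw =>
      (convex_ball z ε).is_const_of_fderivWithin_eq_zero (𝕜 := ℝ)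
        (fun y hy => (hqd y (hb hy)).differentiableAt.differentiableWithinAt)
        (fun y hy => by rw [fderivWithin_of_isOpen isOpen_ball hy, (hqd y (hb hy)).fderiv])
        hw (mem_ball_self he)
    refine ((hPU z hz).sub_const (I * (((P z).im - u z : ℝ) : ℂ))).congr_of_eventuallyEq ?_
    filter_upwards [ball_mem_nhds z he] with w hw
    simp only [hG₀]; rw [hcst w hw]
  have hloc : ∀ i, ∀ p ∈ F i, ∃ L : ℂ, ‖L‖ = 1 ∧ Tendsto (fU u) (𝓝[U] p) (𝓝 L) ∧
      ∃ ρ > 0, Cone U p L ρ := by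
    intro i p hp
    obtain ⟨L, hL, hl⟩ := fU_lim hΩ h (hFB i hp)
    exact ⟨L, hL, hl, cone_lem hΩ h (hFB i hp).1 hl⟩
  have hFcl : ∀ i, F i ⊆ closure U := fun i z hz => frontier_subset_closure (hFB i hz).2
  have hG₀c : ContinuousOn G₀ U := fun z hz => (hGd z hz).continuousAt.continuousWithinAt
  have hlim : ∀ i, ∀ p ∈ F i, ∃ y, Tendsto G₀ (𝓝[U] p) (𝓝 y) := by
    intro i p hp
    obtain ⟨L, hL, hl, ρ₀, hρ₀, hcone⟩ := hloc i p hp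
    obtain ⟨ρ, hρ, hl3⟩ := L3a0 hGd hL hl hρ₀ hcone one_pos
    have hne := mem_closure_iff_nhdsWithin_neBot.mp (hFcl i hp)
    refine cauchy_map_iff_exists_tendsto.1 (Metric.cauchy_iff.2 ⟨inferInstance, fun ε hε => ?_⟩)
    set r := min ρ (ε / 8)
    have hr : 0 < r := lt_min hρ (by linarith)
    refine ⟨G₀ '' (U ∩ ball p r), image_mem_map (inter_mem self_mem_nhdsWithin
      (mem_nhdsWithin_of_mem_nhds (ball_mem_nhds p hr))), ?_⟩
    rintro _ ⟨z, hz, rfl⟩ _ ⟨w, hw, rfl⟩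
    have hb := ball_subset_ball (x := p) (min_le_left ρ (ε/8))
    have h1 := hl3 w ⟨hw.1, hb hw.2⟩ z ⟨hz.1, hb hz.2⟩
    have h2 : ‖z - w‖ < ε / 4 := by
      rw [← dist_eq_norm]
      have := dist_triangle_right z w p
      have a := mem_ball.1 hz.2
      have b := mem_ball.1 hw.2
      linarith [min_le_right ρ (ε/8)]
    rw [dist_eq_norm]
    have h3 := norm_add_le (G₀ z - G₀ w - L * (z - w)) (L * (z - w))
    rw [sub_add_cancel, norm_mul, hL] at h3
    linarith
  have hex : ∀ z ∈ U, extendFrom U G₀ z = G₀ z := extendFrom_extends hG₀c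
  refine ⟨F, extendFrom U G₀, fU u, hδ, hU, fun z hz => hz.1, fun i z hz => (hFB i hz).1,
    fun i => Set.disjoint_left.2 fun z hz => hFBnU z (hFB i hz), ?_, ?_, hFcl, ?_, hFco, ?_, ?_, ?_,
    fU_diff hΩ h, ?_, ?_, ?_, hloc⟩
  · intro i; cases i
    · simpa [hF] using hdis.symm
    · simpa [hF] using hdis
  · intro z hz hzc
    by_cases hzU : z ∈ U
    · exact Or.inl hzU
    · exact Or.inr (hFBmem z ⟨hz, by rw [hU.frontier_eq]; exact ⟨hzc, hzU⟩⟩)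
  · intro i z hz hzc
    obtain ⟨w, hw⟩ := hFn i
    have h1 : z ∈ FB Ω u := ⟨hz, closure_minimal ((hFB i).trans inter_subset_right)
      isClosed_frontier hzc⟩
    have h2 : IsPreconnected (insert z (F i)) := (hFco i).subset_closure (subset_insert _ _)
      (insert_subset hzc subset_closure)
    rw [← hFc i w hw]
    exact h2.subset_connectedComponentIn (mem_insert_of_mem _ hw) (insert_subset h1 (hFB i))
      (mem_insert _ _)
  · intro i; cases i <;> simpa [hF]
  · intro i; cases i <;> simpa [hF]
  · intro z hz
    refine (hGd z hz).congr_of_eventuallyEq ?_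
    filter_upwards [hU.mem_nhds hz] with w hw using hex w hw
  · intro z hz; rw [hex z hz, hGim]; exact hz.2
  · refine continuousOn_extendFrom (union_subset subset_closure (iUnion_subset hFcl)) ?_
    rintro z (hz | hz)
    · exact ⟨_, hG₀c z hz⟩
    · obtain ⟨i, hi⟩ := mem_iUnion.1 hz
      exact hlim i z hi
  · intro i p hp
    obtain ⟨y, hy⟩ := hlim i p hp
    rw [extendFrom_eq (hFcl i hp) hy]
    have hne := mem_closure_iff_nhdsWithin_neBot.mp (hFcl i hp)
    have h1 : Tendsto (fun z => (G₀ z).im) (𝓝[U] p) (𝓝 y.im) := (continuous_im.tendsto y).comp hy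
    simp only [hGim] at h1
    have h2 : Tendsto u (𝓝[U] p) (𝓝 (u p)) :=
      (h.contOn p (hFB i hp).1).mono_left (nhdsWithin_mono p (fun z hz => hz.1))
    rw [tendsto_nhds_unique h1 h2]
    refine le_antisymm ?_ (h.nonneg p (hFB i hp).1)
    by_contra! hlt
    exact hFBnU p (hFB i hp) ⟨(hFB i hp).1, hlt⟩

def LC (Y : Set ℂ) (p : ℂ) : Prop := ∀ ρ > 0, ∃ ρ' > 0, ∃ K, IsPreconnected K ∧
  Y ∩ ball p ρ' ⊆ K ∧ K ⊆ Y ∩ ball p ρ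

lemma LC_of {Y : Set ℂ} {p n : ℂ} {r : ℝ} (hr : 0 < r) (hn : ‖n‖ = 1)
    (h1 : ∀ z ∈ Y ∩ ball p r, ∀ s : ℝ, 0 ≤ s → z + s * n ∈ ball p r → z + s * n ∈ Y)
    (h2 : ∀ h : ℝ, 0 < h → h < r / 2 → ball (p + h * n) (h / 4) ⊆ Y) : LC Y p := by
  intro ρ hρ
  set m := min ρ r
  have hm : 0 < m := lt_min hρ hr
  set h := m / 4 with hh
  have hh0 : 0 < h := by positivity
  have hnr : ∀ s : ℝ, 0 ≤ s → ‖(s : ℂ) * n‖ = s := fun s hs => by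
    rw [norm_mul, hn, norm_real, Real.norm_of_nonneg hs, mul_one]
  have hb : ball (p + h * n) (h / 4) ⊆ Y ∩ ball p m := by
    refine fun z hz => ⟨h2 h hh0 (by linarith [min_le_right ρ r]) hz, ?_⟩
    rw [mem_ball, dist_eq_norm] at hz ⊢
    have := norm_add_le (z - (p + h * n)) (h * n)
    rw [hnr h hh0.le, show z - (p + h * n) + h * n = z - p by ring] at this
    linarith
  have hseg : ∀ z ∈ Y ∩ ball p (h / 4), segment ℝ z (z + h * n) ⊆ Y ∩ ball p m := by
    intro z hz w hw
    obtain ⟨t, ht, rfl⟩ := segm_sg hw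
    have e : sg z (z + h * n) t = z + ((t * h : ℝ) : ℂ) * n := by simp [sg]; ring
    have hz' := hz.2
    rw [mem_ball, dist_eq_norm] at hz'
    have hth : 0 ≤ t * h := mul_nonneg ht.1 hh0.le
    have hbm : z + ((t * h : ℝ) : ℂ) * n ∈ ball p m := by
      rw [mem_ball, dist_eq_norm]
      have := norm_add_le (z - p) (((t * h : ℝ) : ℂ) * n)
      rw [hnr _ hth, show z - p + ((t * h : ℝ) : ℂ) * n = z + ((t * h : ℝ) : ℂ) * n - p by ring] at this
      nlinarith [ht.2]
    rw [e]
    refine ⟨h1 z ⟨hz.1, ball_subset_ball ?_ hz.2⟩ _ hth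
      (ball_subset_ball (min_le_right _ _) hbm), hbm⟩
    linarith [min_le_right ρ r]
  refine ⟨h / 4, by positivity, (⋃ z ∈ Y ∩ ball p (h / 4), segment ℝ z (z + h * n)) ∪
    ball (p + h * n) (h / 4), ?_, ?_, ?_⟩
  · refine isPreconnected_of_forall (p + h * n) ?_
    rintro y (hy | hy)
    · obtain ⟨z, hz, hy⟩ := mem_iUnion₂.1 hy
      refine ⟨segment ℝ z (z + h * n) ∪ ball (p + h * n) (h / 4), ?_, ?_, Or.inl hy, ?_⟩
      · exact union_subset_union_left _ (subset_iUnion₂_of_subset z hz Subset.rfl)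
      · exact Or.inr (mem_ball_self (by positivity))
      · refine IsPreconnected.union (z + h * n) (right_mem_segment _ _ _) ?_
          (convex_segment _ _).isPreconnected (convex_ball _ _).isPreconnected
        have := hz.2
        rw [mem_ball, dist_eq_norm] at this ⊢
        rwa [add_sub_add_right_eq_sub]
    · exact ⟨_, subset_union_right, mem_ball_self (by positivity), hy, (convex_ball _ _).isPreconnected⟩
  · exact fun z hz => Or.inl (mem_iUnion₂.2 ⟨z, hz, left_mem_segment _ _ _⟩)
  · have hmρ : Y ∩ ball p m ⊆ Y ∩ ball p ρ :=
      inter_subset_inter_right _ (ball_subset_ball (min_le_left _ _))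
    exact (union_subset (iUnion₂_subset hseg) hb).trans hmρ

lemma log_ext {Y : Set ℂ} {p : ℂ} (hL : LC Y p) {l h : ℂ → ℂ} (hl : ContinuousOn l Y)
    (hh : ContinuousAt h p) (hp : h p ≠ 0) (hc : ∀ᶠ z in 𝓝 p, ContinuousAt h z)
    (he : ∀ z ∈ Y, exp (l z) = h z) : ∃ y, Tendsto l (𝓝[Y] p) (𝓝 y) := by
  set b : ℂ → ℂ := fun z => Complex.log (h z / h p) with hb
  have h1 : ∀ᶠ z in 𝓝 p, h z / h p ∈ slitPlane := by
    refine (hh.div_const (h p)).eventually_mem (isOpen_slitPlane.mem_nhds ?_)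
    simp [div_self hp]
  obtain ⟨ρ, hρ, hρb⟩ := Metric.eventually_nhds_iff_ball.1 (h1.and hc)
  obtain ⟨ρ', hρ', K, hK, hK1, hK2⟩ := hL ρ hρ
  rcases (Y ∩ ball p ρ').eq_empty_or_nonempty with hem | ⟨z₀, hz₀⟩
  · refine ⟨0, ?_⟩
    have : 𝓝[Y] p = ⊥ := by
      rw [← empty_mem_iff_bot, ← hem]
      exact inter_mem self_mem_nhdsWithin (mem_nhdsWithin_of_mem_nhds (ball_mem_nhds p hρ'))
    rw [this]; exact tendsto_bot
  have hbc : ∀ z ∈ ball p ρ, ContinuousAt b z := fun z hz =>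
    ((hρb z hz).2.div_const _).clog (hρb z hz).1
  have heb : ∀ z ∈ ball p ρ, exp (b z) = h z / h p := fun z hz =>
    exp_log (slitPlane_ne_zero (hρb z hz).1)
  have hne : ∀ z ∈ ball p ρ, h z / h p ≠ 0 := fun z hz => slitPlane_ne_zero (hρb z hz).1
  set N : ℂ → ℂ := fun z => l z - b z - (l z₀ - b z₀) with hN
  have hNe : ∀ z ∈ K, exp (N z) = 1 := by
    have key : ∀ z ∈ Y ∩ ball p ρ, exp (l z - b z) = h p := fun z hz => by
      rw [exp_sub, he z hz.1, heb z hz.2]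
      have := hne z hz.2
      have h2 : h z ≠ 0 := fun h0 => this (by simp [h0])
      field_simp
    intro z hz
    simp only [hN]; rw [exp_sub, key z (hK2 hz), key z₀ (hK2 (hK1 hz₀)), div_self hp]
  have hNc : ContinuousOn N K := by
    refine ContinuousOn.sub (ContinuousOn.sub (hl.mono (hK2.trans inter_subset_left)) ?_)
      continuousOn_const
    exact fun z hz => (hbc z (hK2 hz).2).continuousWithinAt
  have hcst : ∀ z ∈ Y ∩ ball p ρ', l z = b z + (l z₀ - b z₀) := by
    intro z hz
    have h3 := exp_const hK hNc hNe (hK1 hz) (hK1 hz₀)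
    simp only [hN] at h3
    linear_combination h3
  refine ⟨b p + (l z₀ - b z₀), ?_⟩
  have h4 : Tendsto (fun z => b z + (l z₀ - b z₀)) (𝓝[Y] p) (𝓝 (b p + (l z₀ - b z₀))) :=
    ((hbc p (mem_ball_self hρ)).add continuousAt_const).mono_left nhdsWithin_le_nhds
  refine h4.congr' ?_
  filter_upwards [self_mem_nhdsWithin, mem_nhdsWithin_of_mem_nhds (ball_mem_nhds p hρ')] with z hz hz'
  exact (hcst z ⟨hz, hz'⟩).symm

section
variable {δ : ℝ} {U : Set ℂ} {F : Bool → Set ℂ} {G f : ℂ → ℂ}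

lemma Sol.cone_pt (h : Sol δ U F G f) {i : Bool} {p : ℂ} (hp : p ∈ F i) {L : ℂ} {ρ : ℝ}
    (hc : Cone U p L ρ) {x : ℂ} (hx : x ∈ closure U) (hxb : x ∈ ball p ρ) {e : ℂ}
    (he : x + e ∈ ball p ρ) (hs : ‖e‖ / 2 < (L * e).im) : x + e ∈ U := by
  have h1 : ∃ᶠ z in 𝓝 x, z ∈ U := mem_closure_iff_frequently.1 hx
  have h2 : ∀ᶠ z in 𝓝 x, z ∈ ball p ρ := isOpen_ball.mem_nhds hxb
  have h3 : ∀ᶠ z in 𝓝 x, ‖x + e - z‖ / 2 < (L * (x + e - z)).im := by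
    refine ContinuousAt.eventually_lt (by fun_prop) (by fun_prop) (by simpa using hs)
  obtain ⟨z, hz, hzb, hz3⟩ := (h1.and_eventually (h2.and h3)).exists
  have := hc z hz (x + e - z) hzb (by rwa [add_sub_cancel]) hz3.le
  rwa [add_sub_cancel] at this

lemma Sol.im_cone {L n : ℂ} (hL : ‖L‖ = 1) (hLn : L * n = I) (hn : ‖n‖ = 1) {h : ℝ} (hh : 0 < h)
    {e : ℂ} (he : ‖e - h * n‖ < h / 4) : ‖e‖ / 2 < (L * e).im := by
  have h1 := norm_add_le (e - h * n) (h * n)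
  rw [sub_add_cancel, norm_mul, hn, norm_real, Real.norm_of_nonneg hh.le, mul_one] at h1
  have h2 := abs_im_le_norm (L * (e - h * n))
  rw [norm_mul, hL, one_mul, mul_sub, mul_left_comm, hLn] at h2
  simp only [sub_im, mul_im, ofReal_re, I_im, mul_one, ofReal_im, zero_mul, add_zero] at h2
  have := (abs_le.1 h2).1
  rw [mul_im]
  linarith

lemma Sol.lcU (h : Sol δ U F G f) {i : Bool} {p : ℂ} (hp : p ∈ F i) : LC U p := by
  obtain ⟨L, hL, -, ρ, hρ, hc⟩ := h.loc i p hp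
  obtain ⟨n, hn, hLn⟩ := exists_n hL
  refine LC_of hρ hn (fun z hz s hs hzs => hc z hz.1 _ hz.2 hzs ?_) (fun r hr hr2 w hw => ?_)
  · rw [norm_mul, hn, norm_real, Real.norm_of_nonneg hs, mul_one, mul_left_comm, hLn]
    simp; linarith
  · rw [mem_ball, dist_eq_norm] at hw
    have hw' : ‖(w - p) - r * n‖ < r / 4 := by rwa [sub_sub]
    have := h.cone_pt hp hc (h.Fcl i hp) (mem_ball_self hρ) (e := w - p) (by
      rw [add_sub_cancel, mem_ball, dist_eq_norm]
      have h1 := norm_add_le (w - p - r * n) (r * n)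
      rw [sub_add_cancel, norm_mul, hn, norm_real, Real.norm_of_nonneg hr.le, mul_one] at h1
      linarith) (Sol.im_cone hL hLn hn hr hw')
    rwa [add_sub_cancel] at this

lemma Sol.lcZ (h : Sol δ U F G f) {i : Bool} {p : ℂ} (hp : p ∈ F i) :
    LC (ann δ 1 \ closure U) p ∧ p ∈ closure (ann δ 1 \ closure U) := by
  obtain ⟨L, hL, -, ρ₀, hρ₀, hc₀⟩ := h.loc i p hp
  obtain ⟨ρ₁, hρ₁, hb⟩ := Metric.isOpen_iff.1 (ann_open δ 1) p (h.FΩ i hp)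
  obtain ⟨n, hn, hLn⟩ := exists_n hL
  set ρ := min ρ₀ ρ₁
  have hρ : 0 < ρ := lt_min hρ₀ hρ₁
  have hbρ : ball p ρ ⊆ ball p ρ₀ := ball_subset_ball (min_le_left _ _)
  have hc : Cone U p L ρ := fun z hz e h1 h2 => hc₀ z hz e (hbρ h1) (hbρ h2)
  have hb' : ball p ρ ⊆ ann δ 1 := (ball_subset_ball (min_le_right _ _)).trans hb
  have hpU : p ∉ U := Set.disjoint_left.1 (h.FU i) hp
  have hbb : ∀ r : ℝ, 0 < r → r < ρ / 2 → ball (p + r * (-n)) (r / 4) ⊆ ann δ 1 \ closure U := by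
    intro r hr hr2 w hw
    rw [mem_ball, dist_eq_norm] at hw
    have hw' : ‖(p - w) - r * n‖ < r / 4 := by
      rw [show p - w - r * n = -(w - (p + r * -n)) by ring, norm_neg]; exact hw
    have hwb : w ∈ ball p ρ := by
      rw [mem_ball, dist_eq_norm, norm_sub_rev]
      have h1 := norm_add_le (p - w - r * n) (r * n)
      rw [sub_add_cancel, norm_mul, hn, norm_real, Real.norm_of_nonneg hr.le, mul_one] at h1
      linarith
    refine ⟨hb' hwb, fun hwc => hpU ?_⟩
    have := h.cone_pt hp hc hwc hwb (e := p - w) (by rw [add_sub_cancel]; exact mem_ball_self hρ)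
      (Sol.im_cone hL hLn hn hr hw')
    rwa [add_sub_cancel] at this
  refine ⟨LC_of hρ (n := -n) (by simpa) (fun z hz s hs hzs => ⟨hb' hzs, fun hcl => hz.1.2 ?_⟩) hbb, ?_⟩
  · rcases hs.eq_or_lt with rfl | hs
    · simpa using hcl
    refine subset_closure ?_
    have := h.cone_pt hp hc hcl hzs (e := s * n) (by simpa using hz.2) (by
      rw [norm_mul, hn, norm_real, Real.norm_of_nonneg hs.le, mul_one, mul_left_comm, hLn]
      simp; linarith)
    simpa using this
  · rw [Metric.mem_closure_iff]
    intro ε hε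
    set r := min (ε / 2) (ρ / 4)
    have hr : 0 < r := by positivity
    refine ⟨p + r * (-n), hbb r hr (by linarith [min_le_right (ε/2) (ρ/4)])
      (mem_ball_self (by positivity)), ?_⟩
    rw [dist_eq_norm, sub_add_cancel_left, norm_neg, norm_mul, norm_neg, hn, norm_real,
      Real.norm_of_nonneg hr.le]
    linarith [min_le_left (ε/2) (ρ/4)]
end

section
variable {δ : ℝ} {U : Set ℂ} {F : Bool → Set ℂ} {G f : ℂ → ℂ}

lemma Sol.Xcl (h : Sol δ U F G f) : U ∪ ⋃ i, F i ⊆ closure U :=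
  union_subset subset_closure (iUnion_subset h.Fcl)

lemma Sol.FX (i : Bool) : F i ⊆ U ∪ ⋃ i, F i :=
  (subset_iUnion F i).trans subset_union_right

lemma Sol.clX (h : Sol δ U F G f) {z : ℂ} (hz : z ∈ ann δ 1) (hc : z ∈ closure U) :
    z ∈ U ∪ ⋃ i, F i := (h.clU z hz hc).imp id mem_iUnion.2

lemma Sol.FnotU (h : Sol δ U F G f) {i : Bool} {p : ℂ} (hp : p ∈ F i) : p ∉ U :=
  Set.disjoint_left.1 (h.FU i) hp

lemma Sol.XU (h : Sol δ U F G f) {z : ℂ} (hz : z ∈ U ∪ ⋃ i, F i) (hp : 0 < (G z).im) : z ∈ U := by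
  rcases hz with hz | hz
  · exact hz
  · obtain ⟨i, hi⟩ := mem_iUnion.1 hz
    exact absurd (h.Gr i z hi) hp.ne'

lemma Sol.exp1 (h : Sol δ U F G f) {i : Bool} {p : ℂ} (hp : p ∈ F i) :
    ∃ L : ℂ, ‖L‖ = 1 ∧ Tendsto f (𝓝[U] p) (𝓝 L) ∧ ∀ η > 0, ∃ ρ > 0,
      ∀ z ∈ (U ∪ ⋃ i, F i) ∩ ball p ρ, ∀ z' ∈ (U ∪ ⋃ i, F i) ∩ ball p ρ,
      ‖G z' - G z - L * (z' - z)‖ ≤ η * ‖z' - z‖ := by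
  obtain ⟨L, hL, hl, ρ₀, hρ₀, hc⟩ := h.loc i p hp
  refine ⟨L, hL, hl, fun η hη => ?_⟩
  obtain ⟨ρ, hρ, h3⟩ := L3a0 h.der hL hl hρ₀ hc hη
  refine ⟨ρ, hρ, fun z hz z' hz' => ?_⟩
  have hne : ∀ x ∈ (U ∪ ⋃ i, F i) ∩ ball p ρ, (𝓝[U] x).NeBot := fun x hx =>
    mem_closure_iff_nhdsWithin_neBot.mp (h.Xcl hx.1)
  have ht : ∀ x ∈ (U ∪ ⋃ i, F i) ∩ ball p ρ, Tendsto G (𝓝[U] x) (𝓝 (G x)) := fun x hx =>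
    (h.Gc x hx.1).mono_left (nhdsWithin_mono x subset_union_left)
  have hi : ∀ x, Tendsto (fun y : ℂ => y) (𝓝[U] x) (𝓝 x) := fun x => nhdsWithin_le_nhds
  have := hne z hz
  have := hne z' hz'
  have e1 : Tendsto (fun q : ℂ × ℂ => ‖G q.2 - G q.1 - L * (q.2 - q.1)‖) (𝓝[U] z ×ˢ 𝓝[U] z')
      (𝓝 ‖G z' - G z - L * (z' - z)‖) :=
    ((((ht z' hz').comp tendsto_snd).sub ((ht z hz).comp tendsto_fst)).sub
      ((((hi z').comp tendsto_snd).sub ((hi z).comp tendsto_fst)).const_mul L)).norm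
  have e2 : Tendsto (fun q : ℂ × ℂ => η * ‖q.2 - q.1‖) (𝓝[U] z ×ˢ 𝓝[U] z') (𝓝 (η * ‖z' - z‖)) :=
    ((((hi z').comp tendsto_snd).sub ((hi z).comp tendsto_fst)).norm.const_mul η)
  refine le_of_tendsto_of_tendsto e1 e2 ?_
  have m1 : ∀ x ∈ (U ∪ ⋃ i, F i) ∩ ball p ρ, U ∩ ball p ρ ∈ 𝓝[U] x := fun x hx =>
    inter_mem self_mem_nhdsWithin (mem_nhdsWithin_of_mem_nhds (isOpen_ball.mem_nhds hx.2))
  filter_upwards [prod_mem_prod (m1 z hz) (m1 z' hz')] with q hq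
  exact h3 q.1 hq.1 q.2 hq.2

lemma Sol.bilip (h : Sol δ U F G f) {i : Bool} {p : ℂ} (hp : p ∈ F i) :
    ∃ ρ > 0, ∀ z ∈ (U ∪ ⋃ i, F i) ∩ ball p ρ, ∀ z' ∈ (U ∪ ⋃ i, F i) ∩ ball p ρ,
      ‖z' - z‖ ≤ 2 * ‖G z' - G z‖ := by
  obtain ⟨L, hL, -, he⟩ := h.exp1 hp
  obtain ⟨ρ, hρ, hb⟩ := he (1/2) (by norm_num)
  refine ⟨ρ, hρ, fun z hz z' hz' => ?_⟩
  have h1 := hb z hz z' hz'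
  have h2 := norm_sub_norm_le (L * (z' - z)) (G z' - G z)
  rw [norm_mul, hL, one_mul, norm_sub_rev (L * (z' - z))] at h2
  linarith

lemma Sol.surj (h : Sol δ U F G f) {i : Bool} {p : ℂ} (hp : p ∈ F i) {ρ : ℝ} (hρ : 0 < ρ) :
    ∃ σ > 0, ∀ w : ℂ, 0 ≤ w.im → ‖w - G p‖ < σ → ∃ z ∈ (U ∪ ⋃ i, F i) ∩ ball p ρ, G z = w := by
  obtain ⟨L, hL, hl, he⟩ := h.exp1 hp
  have hpX : p ∈ U ∪ ⋃ i, F i := Sol.FX i hp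
  obtain ⟨ρ₁, hρ₁, hb₁⟩ := h.bilip hp
  obtain ⟨ρ₂, hρ₂, hb₂⟩ := Metric.isOpen_iff.1 (ann_open δ 1) p (h.FΩ i hp)
  have hf0 : ∀ᶠ z in 𝓝 p, z ∈ U → f z ≠ 0 := by
    have hL0 : L ≠ 0 := fun h0 => by simp [h0] at hL
    exact eventually_nhdsWithin_iff.1 (hl.eventually_ne hL0)
  obtain ⟨ρ₃, hρ₃, hb₃⟩ := Metric.eventually_nhds_iff_ball.1 hf0
  set r := min (min ρ ρ₁) (min ρ₂ ρ₃)
  have hr : 0 < r := lt_min (lt_min hρ hρ₁) (lt_min hρ₂ hρ₃)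
  have r0 : ball p r ⊆ ball p ρ := ball_subset_ball ((min_le_left _ _).trans (min_le_left _ _))
  have r1 : ball p r ⊆ ball p ρ₁ := ball_subset_ball ((min_le_left _ _).trans (min_le_right _ _))
  have r2 : ball p r ⊆ ball p ρ₂ := ball_subset_ball ((min_le_right _ _).trans (min_le_left _ _))
  have r3 : ball p r ⊆ ball p ρ₃ := ball_subset_ball ((min_le_right _ _).trans (min_le_right _ _))
  set C := closure U ∩ closedBall p (r / 2)
  have hcb : closedBall p (r / 2) ⊆ ball p r := closedBall_subset_ball (by linarith)
  have hCX : C ⊆ (U ∪ ⋃ i, F i) ∩ ball p r := fun z hz =>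
    ⟨h.clX (hb₂ (r2 (hcb hz.2))) hz.1, hcb hz.2⟩
  have hCc : IsCompact C := (isCompact_closedBall p (r / 2)).inter_left isClosed_closure
  set A := G '' C
  have hA : IsClosed A := (hCc.image_of_continuousOn (h.Gc.mono (hCX.trans inter_subset_left))).isClosed
  set O := G '' (U ∩ ball p r)
  have hO : IsOpen O := by
    rw [isOpen_iff_mem_nhds]
    rintro _ ⟨z, hz, rfl⟩
    have hsd : HasStrictDerivAt G (f z) z := by
      have hd : DifferentiableOn ℂ G U := fun w hw => (h.der w hw).differentiableAt.differentiableWithinAt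
      have := ((hd.analyticAt (h.Uo.mem_nhds hz.1)).hasStrictDerivAt)
      rwa [(h.der z hz.1).deriv] at this
    rw [← hsd.map_nhds_eq (hb₃ z (r3 hz.2) hz.1)]
    exact image_mem_map ((h.Uo.inter isOpen_ball).mem_nhds hz)
  set H := ball (G p) (r / 4) ∩ {w | 0 < w.im}
  have hHc : Convex ℝ H := (convex_ball _ _).inter (convex_halfSpace_im_gt 0)
  have hOA' : O ∩ ball (G p) (r / 4) ⊆ A := by
    rintro _ ⟨⟨z, hz, rfl⟩, hw⟩
    have h1 := hb₁ p ⟨hpX, r1 (mem_ball_self hr)⟩ z ⟨Or.inl hz.1, r1 hz.2⟩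
    rw [mem_ball, dist_eq_norm] at hw
    exact ⟨z, ⟨subset_closure hz.1, by rw [mem_closedBall, dist_eq_norm]; linarith⟩, rfl⟩
  have hHO : H ⊆ O ∩ ball (G p) (r / 4) := by
    refine hHc.isPreconnected.subset_left_of_subset_union (hO.inter isOpen_ball) hA.isOpen_compl
      ?_ ?_ ?_
    · rw [Set.disjoint_left]
      exact fun w hw hn => hn (hOA' hw)
    · intro w hw
      by_cases hwA : w ∈ A
      · obtain ⟨z, hz, rfl⟩ := hwA
        exact Or.inl ⟨⟨z, ⟨h.XU (hCX hz).1 hw.2, (hCX hz).2⟩, rfl⟩, hw.1⟩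
      · exact Or.inr hwA
    · have hne := mem_closure_iff_nhdsWithin_neBot.mp (h.Fcl i hp)
      have ht : Tendsto G (𝓝[U] p) (𝓝 (G p)) :=
        (h.Gc p hpX).mono_left (nhdsWithin_mono p subset_union_left)
      have h1 : ∀ᶠ z in 𝓝[U] p, z ∈ U ∩ ball p r := inter_mem self_mem_nhdsWithin
        (mem_nhdsWithin_of_mem_nhds (ball_mem_nhds p hr))
      obtain ⟨z, hz, hz2⟩ := (h1.and (ht.eventually_mem (ball_mem_nhds (G p)
        (show 0 < r / 4 by linarith)))).exists
      exact ⟨G z, ⟨hz2, h.pos z hz.1⟩, ⟨z, hz, rfl⟩, hz2⟩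
  refine ⟨r / 4, by linarith, fun w hw hwσ => ?_⟩
  have hOA : H ⊆ A := hHO.trans hOA'
  have hwA : w ∈ A := by
    have : w ∈ closure H := by
      rw [Metric.mem_closure_iff]
      intro ε hε
      set s := min (ε / 2) ((r / 4 - ‖w - G p‖) / 2)
      have hs : 0 < s := lt_min (by linarith) (by linarith)
      refine ⟨w + s * I, ⟨?_, ?_⟩, ?_⟩
      · rw [mem_ball, dist_eq_norm]
        have := norm_add_le (w - G p) (s * I)
        rw [norm_mul, norm_I, norm_real, Real.norm_of_nonneg hs.le, mul_one,
          show w - G p + s * I = w + s * I - G p by ring] at this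
        linarith [min_le_right (ε / 2) ((r / 4 - ‖w - G p‖) / 2)]
      · simp; linarith
      · rw [dist_eq_norm, sub_add_cancel_left, norm_neg, norm_mul, norm_I, norm_real,
          Real.norm_of_nonneg hs.le]
        linarith [min_le_left (ε / 2) ((r / 4 - ‖w - G p‖) / 2)]
    exact closure_minimal hOA hA this
  obtain ⟨z, hz, rfl⟩ := hwA
  exact ⟨z, ⟨(hCX hz).1, r0 (hCX hz).2⟩, rfl⟩

end

structure Sec (A : Set ℂ) (G : ℂ → ℂ) (J : Set ℝ) (κ : ℝ → ℂ) : Prop where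
  o : IsOpen J
  c : IsPreconnected J
  k : ContinuousOn κ J
  m : ∀ t ∈ J, κ t ∈ A
  s : ∀ t ∈ J, G (κ t) = t

section
variable {δ : ℝ} {U : Set ℂ} {F : Bool → Set ℂ} {G f : ℂ → ℂ}

lemma Sol.Floc (h : Sol δ U F G f) {i : Bool} {p : ℂ} (hp : p ∈ F i) :
    ∀ᶠ z in 𝓝 p, z ∈ U ∪ ⋃ i, F i → z ∉ U → z ∈ F i := by
  have h1 : p ∉ closure (F !i) := fun hc =>
    Set.disjoint_left.1 (h.FF i) hp (h.Frc _ p (h.FΩ i hp) hc)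
  filter_upwards [isClosed_closure.isOpen_compl.mem_nhds h1] with z hz hzX hzU
  obtain ⟨j, hj⟩ := mem_iUnion.1 (hzX.resolve_left hzU)
  by_cases hji : j = i
  · rwa [← hji]
  · have : j = !i := by revert hji; cases i <;> cases j <;> simp
    exact absurd (subset_closure (this ▸ hj)) hz

lemma Sol.Gre (h : Sol δ U F G f) {i : Bool} {p : ℂ} (hp : p ∈ F i) : G p = ((G p).re : ℂ) := by
  apply Complex.ext <;> simp [h.Gr i p hp]

lemma Sol.locSec (h : Sol δ U F G f) {i : Bool} {p : ℂ} (hp : p ∈ F i) {ε : ℝ} (hε : 0 < ε) :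
    ∃ J κ, Sec (F i ∩ ball p ε) G J κ ∧ (G p).re ∈ J ∧
      ∀ᶠ q in 𝓝[F i] p, (G q).re ∈ J ∧ κ (G q).re = q := by
  obtain ⟨ρ₁, hρ₁, hb₁⟩ := h.bilip hp
  obtain ⟨ρ₂, hρ₂, hb₂⟩ := Metric.eventually_nhds_iff_ball.1 (h.Floc hp)
  set r := min (min ρ₁ ρ₂) ε
  have hr : 0 < r := lt_min (lt_min hρ₁ hρ₂) hε
  have r1 : ball p r ⊆ ball p ρ₁ := ball_subset_ball ((min_le_left _ _).trans (min_le_left _ _))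
  have r2 : ball p r ⊆ ball p ρ₂ := ball_subset_ball ((min_le_left _ _).trans (min_le_right _ _))
  have r3 : ball p r ⊆ ball p ε := ball_subset_ball (min_le_right _ _)
  obtain ⟨σ, hσ, hs⟩ := h.surj hp hr
  have hs' : ∀ t : ℝ, ∃ z : ℂ, t ∈ ball (G p).re σ → z ∈ F i ∩ ball p r ∧ G z = t := by
    intro t
    by_cases ht : t ∈ ball (G p).re σ
    · obtain ⟨z, hz, hzt⟩ := hs t (by simp) (by
        rw [h.Gre hp, ← ofReal_sub, norm_real]; simpa [dist_eq_norm] using ht)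
      refine ⟨z, fun _ => ⟨⟨hb₂ z (r2 hz.2) hz.1 fun hzU => ?_, hz.2⟩, hzt⟩⟩
      have := h.pos z hzU
      rw [hzt] at this; simp at this
    · exact ⟨0, fun h' => absurd h' ht⟩
  choose κ hκ using hs'
  have hX : ∀ z ∈ F i ∩ ball p r, z ∈ (U ∪ ⋃ i, F i) ∩ ball p ρ₁ := fun z hz =>
    ⟨Sol.FX i hz.1, r1 hz.2⟩
  refine ⟨ball (G p).re σ, κ, ⟨isOpen_ball, (convex_ball _ _).isPreconnected, ?_,
    fun t ht => ⟨(hκ t ht).1.1, r3 (hκ t ht).1.2⟩, fun t ht => (hκ t ht).2⟩, mem_ball_self hσ, ?_⟩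
  · refine (LipschitzOnWith.of_dist_le_mul (K := 2) fun s hs t ht => ?_).continuousOn
    have := hb₁ _ (hX _ (hκ t ht).1) _ (hX _ (hκ s hs).1)
    rw [(hκ t ht).2, (hκ s hs).2, ← ofReal_sub, norm_real] at this
    rw [dist_eq_norm, dist_eq_norm]; exact this
  · have hre : Tendsto (fun q => (G q).re) (𝓝[F i] p) (𝓝 (G p).re) :=
      (continuous_re.tendsto _).comp ((h.Gc p (Sol.FX i hp)).mono_left (nhdsWithin_mono p (Sol.FX i)))
    filter_upwards [hre.eventually_mem (ball_mem_nhds _ hσ), self_mem_nhdsWithin,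
      mem_nhdsWithin_of_mem_nhds (ball_mem_nhds p hr)] with q hq hqF hqb
    refine ⟨hq, ?_⟩
    have := hb₁ _ (hX _ ⟨hqF, hqb⟩) _ (hX _ (hκ _ hq).1)
    rw [(hκ _ hq).2, ← h.Gre hqF, sub_self, norm_zero, mul_zero] at this
    exact sub_eq_zero.1 (norm_le_zero_iff.1 this)

lemma Sol.secUniq (h : Sol δ U F G f) {i : Bool} {J : Set ℝ} {κ₁ κ₂ : ℝ → ℂ}
    (h1 : Sec (F i) G J κ₁) (h2 : Sec (F i) G J κ₂) {t s : ℝ} (ht : t ∈ J) (hs : s ∈ J)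
    (he : κ₁ t = κ₂ t) : κ₁ s = κ₂ s := by
  refine (h1.c.induction₂ (fun a b => κ₁ a = κ₂ a ↔ κ₁ b = κ₂ b) ?_ ?_ ?_ ht hs).1 he
  · intro x hx
    by_cases hxe : κ₁ x = κ₂ x
    · obtain ⟨ρ, hρ, hb⟩ := h.bilip (h1.m x hx)
      filter_upwards [(h1.k x hx).eventually_mem (ball_mem_nhds _ hρ),
        (h2.k x hx).eventually_mem (by rw [← hxe]; exact ball_mem_nhds _ hρ), self_mem_nhdsWithin] with y hy1 hy2 hy
      have := hb _ ⟨Sol.FX i (h1.m y hy), hy1⟩ _ ⟨Sol.FX i (h2.m y hy), hy2⟩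
      rw [h1.s y hy, h2.s y hy, sub_self, norm_zero, mul_zero] at this
      exact ⟨fun _ => (sub_eq_zero.1 (norm_le_zero_iff.1 this)).symm, fun _ => hxe⟩
    · have := ((h1.k x hx).sub (h2.k x hx)).eventually_ne (sub_ne_zero.2 hxe)
      filter_upwards [this] with y hy
      exact ⟨fun h => absurd h hxe, fun h => absurd h (sub_ne_zero.1 hy)⟩
  · exact fun x y z _ _ _ hxy hyz => hxy.trans hyz
  · exact fun x y _ _ hxy => hxy.symm

lemma Sol.Finj (h : Sol δ U F G f) {i : Bool} {p q : ℂ} (hp : p ∈ F i) (hq : q ∈ F i)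
    (hpq : (G p).re = (G q).re) : p = q := by
  set P : ℂ → ℂ → Prop := fun x y => ∃ J κ, Sec (F i) G J κ ∧ (∃ s ∈ J, κ s = x) ∧ ∃ t ∈ J, κ t = y
    with hPd
  have key : P p q := by
    refine (h.Fco i).induction₂ P ?_ ?_ ?_ hp hq
    · intro x hx
      obtain ⟨J, κ, hS, hxJ, hev⟩ := h.locSec hx one_pos
      have hxx := hev.self_of_nhdsWithin hx
      filter_upwards [hev] with y hy
      exact ⟨J, κ, ⟨hS.o, hS.c, hS.k, fun t ht => (hS.m t ht).1, hS.s⟩, ⟨_, hxx⟩, ⟨_, hy⟩⟩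
    · rintro x y z hx hy hz ⟨J₁, κ₁, h1, ⟨a, ha, hax⟩, b, hb, hby⟩ ⟨J₂, κ₂, h2, ⟨c, hc, hcy⟩, d, hd, hdz⟩
      have hbc : b = c := by
        have e1 := h1.s b hb
        have e2 := h2.s c hc
        rw [hby] at e1; rw [hcy] at e2
        exact_mod_cast e1.symm.trans e2
      subst hbc
      have hJp : IsPreconnected (J₁ ∩ J₂) := by
        rw [isPreconnected_iff_ordConnected]
        exact (isPreconnected_iff_ordConnected.1 h1.c).inter (isPreconnected_iff_ordConnected.1 h2.c)
      have hag : ∀ t ∈ J₁ ∩ J₂, κ₁ t = κ₂ t := fun t ht =>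
        h.secUniq (J := J₁ ∩ J₂) ⟨h1.o.inter h2.o, hJp, h1.k.mono inter_subset_left,
          fun t ht => h1.m t ht.1, fun t ht => h1.s t ht.1⟩
          ⟨h1.o.inter h2.o, hJp, h2.k.mono inter_subset_right,
          fun t ht => h2.m t ht.2, fun t ht => h2.s t ht.2⟩ ⟨hb, hc⟩ ht (hby.trans hcy.symm)
      set κ : ℝ → ℂ := fun t => if t ∈ J₁ then κ₁ t else κ₂ t
      have k1 : ∀ t ∈ J₁, κ t = κ₁ t := fun t ht => if_pos ht
      have k2 : ∀ t ∈ J₂, κ t = κ₂ t := fun t ht => by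
        by_cases h' : t ∈ J₁
        · rw [k1 t h', hag t ⟨h', ht⟩]
        · exact if_neg h'
      refine ⟨J₁ ∪ J₂, κ, ⟨h1.o.union h2.o, h1.c.union b hb hc h2.c, ?_, ?_, ?_⟩,
        ⟨a, Or.inl ha, by rw [k1 a ha, hax]⟩, d, Or.inr hd, by rw [k2 d hd, hdz]⟩
      · rintro t (ht | ht)
        · refine (((h1.k.continuousAt (h1.o.mem_nhds ht)).congr ?_)).continuousWithinAt
          filter_upwards [h1.o.mem_nhds ht] with y hy using (k1 y hy).symm
        · refine (((h2.k.continuousAt (h2.o.mem_nhds ht)).congr ?_)).continuousWithinAt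
          filter_upwards [h2.o.mem_nhds ht] with y hy using (k2 y hy).symm
      · rintro t (ht | ht)
        · rw [k1 t ht]; exact h1.m t ht
        · rw [k2 t ht]; exact h2.m t ht
      · rintro t (ht | ht)
        · rw [k1 t ht]; exact h1.s t ht
        · rw [k2 t ht]; exact h2.s t ht
    · rintro x y hx hy ⟨J, κ, hS, h1, h2⟩
      exact ⟨J, κ, hS, h2, h1⟩
  obtain ⟨J, κ, hS, ⟨s, hs, rfl⟩, t, ht, rfl⟩ := key
  rw [hS.s s hs, hS.s t ht] at hpq
  simp at hpq
  rw [hpq]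

theorem Sol.param (h : Sol δ U F G f) (i : Bool) : ∃ J γ, Sec (F i) G J γ ∧
    (∀ p ∈ F i, (G p).re ∈ J ∧ γ (G p).re = p) ∧
    ∀ s ∈ J, ∀ t ∈ J, ‖γ s - γ t‖ ≤ |s - t| := by
  set J := (fun p => (G p).re) '' F i with hJ
  have hvc : ContinuousOn (fun p => (G p).re) (F i) :=
    continuous_re.comp_continuousOn (h.Gc.mono (Sol.FX i))
  have hex : ∀ t : ℝ, ∃ p : ℂ, t ∈ J → p ∈ F i ∧ (G p).re = t := fun t => by
    by_cases ht : t ∈ J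
    · obtain ⟨p, hp, hpt⟩ := ht
      exact ⟨p, fun _ => ⟨hp, hpt⟩⟩
    · exact ⟨0, fun h' => absurd h' ht⟩
  choose γ hγ using hex
  have hγv : ∀ p ∈ F i, (G p).re ∈ J ∧ γ (G p).re = p := fun p hp =>
    ⟨⟨p, hp, rfl⟩, h.Finj (hγ _ ⟨p, hp, rfl⟩).1 hp (hγ _ ⟨p, hp, rfl⟩).2⟩
  have hs : ∀ t ∈ J, G (γ t) = t := fun t ht => by rw [h.Gre (hγ t ht).1, (hγ t ht).2]
  have hJo : IsOpen J := by
    rw [isOpen_iff_mem_nhds]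
    rintro _ ⟨p, hp, rfl⟩
    obtain ⟨J', κ, hS, hpJ, -⟩ := h.locSec hp one_pos
    filter_upwards [hS.o.mem_nhds hpJ] with t ht
    exact ⟨κ t, (hS.m t ht).1, by simp [hS.s t ht]⟩
  have hγc : ∀ t ∈ J, ContinuousAt γ t := by
    intro t ht
    rw [Metric.continuousAt_iff']
    intro ε hε
    obtain ⟨J', κ, hS, hpJ, -⟩ := h.locSec (hγ t ht).1 hε
    rw [(hγ t ht).2] at hpJ
    filter_upwards [hS.o.mem_nhds hpJ] with s hs'
    have : γ s = κ s := by
      have h1 := (hγv _ (hS.m s hs').1).2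
      rwa [hS.s s hs', ofReal_re] at h1
    rw [this]
    exact (hS.m s hs').2
  have hJc : IsPreconnected J := (h.Fco i).image _ hvc
  refine ⟨J, γ, ⟨hJo, hJc, fun t ht => (hγc t ht).continuousWithinAt, fun t ht => (hγ t ht).1, hs⟩,
    hγv, ?_⟩
  have hd : ∀ t ∈ J, ∃ L : ℂ, ‖L‖ = 1 ∧ HasDerivAt γ L t := by
    intro t ht
    obtain ⟨L, hL, -, he⟩ := h.exp1 (hγ t ht).1
    have hL0 : L ≠ 0 := fun h0 => by simp [h0] at hL
    refine ⟨L⁻¹, by simp [hL], ?_⟩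
    rw [hasDerivAt_iff_isLittleO, Asymptotics.isLittleO_iff]
    intro c hc
    obtain ⟨ρ, hρ, hb⟩ := he (min (1/2) (c / 2)) (by positivity)
    filter_upwards [(hγc t ht).eventually_mem (ball_mem_nhds _ hρ), hJo.mem_nhds ht] with s hsb hsJ
    have h1 := hb _ ⟨Sol.FX i (hγ t ht).1, mem_ball_self hρ⟩ _ ⟨Sol.FX i (hγ s hsJ).1, hsb⟩
    rw [hs s hsJ, hs t ht] at h1
    set d := γ s - γ t
    have h2 : ‖d‖ ≤ 2 * ‖s - t‖ := by
      have h3 := norm_sub_norm_le (L * d) (((s:ℂ) - t))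
      rw [norm_mul, hL, one_mul, norm_sub_rev (L * d), ← ofReal_sub, norm_real] at h3
      rw [← ofReal_sub] at h1
      have := mul_le_mul_of_nonneg_right (min_le_left (1/2) (c/2)) (norm_nonneg d)
      linarith
    have e : d - (s - t) • L⁻¹ = - (L⁻¹ * ((s:ℂ) - t - L * d)) := by
      rw [mul_sub, inv_mul_cancel_left₀ hL0, real_smul, ofReal_sub]; ring
    rw [e, norm_neg, norm_mul, norm_inv, hL, inv_one, one_mul]
    have := mul_le_mul_of_nonneg_right (min_le_right (1/2) (c/2)) (norm_nonneg d)
    nlinarith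
  choose! L hL hLd using hd
  intro s hs' t ht
  have := (isPreconnected_iff_ordConnected.1 hJc).convex.norm_image_sub_le_of_norm_hasDerivWithin_le
    (f := γ) (f' := L) (C := 1) (fun x hx => (hLd x hx).hasDerivWithinAt)
    (fun x hx => (hL x hx).le) ht hs'
  simpa using this
end

lemma first_hit {E : Set ℝ} (hE : IsClosed E) {T : ℝ} (h : T ∈ E) (h0 : 0 ≤ T) :
    ∃ t ∈ E, 0 ≤ t ∧ t ≤ T ∧ ∀ t', 0 ≤ t' → t' < t → t' ∉ E := by
  have hne : (E ∩ Ici 0).Nonempty := ⟨T, h, h0⟩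
  have hb : BddBelow (E ∩ Ici 0) := ⟨0, fun x hx => hx.2⟩
  have hm := (hE.inter isClosed_Ici).csInf_mem hne hb
  exact ⟨_, hm.1, hm.2, csInf_le hb ⟨h, h0⟩, fun t' h1 h2 h3 => notMem_of_lt_csInf h2 hb ⟨h3, h1⟩⟩

lemma bool_ne {i j : Bool} (h : i ≠ j) : i = !j := by revert h; cases i <;> cases j <;> simp

noncomputable def cc (s θ : ℝ) : ℂ := s * exp (θ * I)

lemma cc_cont (s : ℝ) : Continuous (cc s) := by unfold cc; fun_prop

lemma cc_norm {s : ℝ} (hs : 0 ≤ s) (θ : ℝ) : ‖cc s θ‖ = s := by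
  rw [cc, norm_mul, norm_exp_ofReal_mul_I, norm_real, Real.norm_of_nonneg hs, mul_one]

lemma cc_per (s θ : ℝ) (n : ℤ) : cc s (θ + n * (2 * Real.pi)) = cc s θ := by
  have : ((θ + n * (2 * Real.pi) : ℝ) : ℂ) * I = θ * I + n * (2 * Real.pi * I) := by push_cast; ring
  rw [cc, cc, this, exp_periodic.int_mul]

lemma cc_surj (z : ℂ) : ∃ θ, cc ‖z‖ θ = z := ⟨arg z, norm_mul_exp_arg_mul_I z⟩

lemma cc_hd (s θ : ℝ) : HasDerivAt (cc s) (cc s θ * I) θ := by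
  have h1 : HasDerivAt (fun θ : ℝ => (θ : ℂ) * I) (1 * I) θ := (hasDerivAt_id θ).ofReal_comp.mul_const I
  refine (h1.cexp.const_mul (s : ℂ)).congr_deriv ?_
  rw [cc]; ring

section
variable {δ : ℝ} {U : Set ℂ} {F : Bool → Set ℂ} {G f : ℂ → ℂ}

lemma Sol.stay (h : Sol δ U F G f) {S : Set ℂ} (hS : IsPreconnected S) (h1 : S ⊆ ann δ 1)
    (h2 : ∀ i, ∀ z ∈ S, z ∉ F i) (h3 : (S ∩ U).Nonempty) : S ⊆ U := by
  refine hS.subset_left_of_subset_union h.Uo isClosed_closure.isOpen_compl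
    (Set.disjoint_left.2 fun z hz hz' => hz' (subset_closure hz)) (fun z hz => ?_) h3
  by_cases hc : z ∈ closure U
  · rcases h.clU z (h1 hz) hc with h4 | ⟨i, h4⟩
    · exact Or.inl h4
    · exact absurd h4 (h2 i z hz)
  · exact Or.inr hc

lemma cc_ann (h : Sol δ U F G f) {s : ℝ} (h1 : δ < s) (h2 : s < 1) (θ : ℝ) : cc s θ ∈ ann δ 1 := by
  have := cc_norm (h.hδ.trans h1).le θ
  exact ⟨by rw [this]; exact h1, by rw [this]; exact h2⟩

lemma Sol.hit (h : Sol δ U F G f) {s : ℝ} (h1 : δ < s) (h2 : s < 1) (i : Bool) :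
    ∃ p ∈ F i, ‖p‖ = s := by
  obtain ⟨a, ha, ha'⟩ := h.Fin i
  obtain ⟨b, hb, hb'⟩ := h.Fout i
  rw [mem_sphere_zero_iff_norm] at ha' hb'
  obtain ⟨x, hx, hx'⟩ := mem_closure_iff_nhds.1 ha {z | ‖z‖ < s}
    ((isOpen_lt continuous_norm continuous_const).mem_nhds (by simpa [ha'] using h1))
  obtain ⟨y, hy, hy'⟩ := mem_closure_iff_nhds.1 hb {z | s < ‖z‖}
    ((isOpen_lt continuous_const continuous_norm).mem_nhds (by simpa [hb'] using h2))
  obtain ⟨p, hp, hps⟩ := (h.Fco i).intermediate_value hx' hy' continuous_norm.continuousOn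
    ⟨le_of_lt hx, le_of_lt hy⟩
  exact ⟨p, hp, hps⟩

lemma Sol.cF_closed (h : Sol δ U F G f) {s : ℝ} (h1 : δ < s) (h2 : s < 1) (i : Bool) :
    IsClosed (cc s ⁻¹' F i) := by
  refine isClosed_of_closure_subset fun x hx => h.Frc i _ (cc_ann h h1 h2 x) ?_
  have := (cc_cont s).closure_preimage_subset (F i) hx
  exact this

lemma Sol.exit (h : Sol δ U F G f) {s : ℝ} (h1 : δ < s) (h2 : s < 1) {θ : ℝ} (hθ : cc s θ ∈ U)
    (σ : ℝ) (hσ : σ = 1 ∨ σ = -1) :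
    ∃ t > 0, ∃ i, cc s (θ + σ * t) ∈ F i ∧ ∀ t', 0 ≤ t' → t' < t → cc s (θ + σ * t') ∈ U := by
  have hcont : Continuous fun t : ℝ => θ + σ * t := by fun_prop
  set E : Set ℝ := ⋃ i, (fun t => θ + σ * t) ⁻¹' (cc s ⁻¹' F i) with hE
  have hEc : IsClosed E := isClosed_iUnion_of_finite fun i => (h.cF_closed h1 h2 i).preimage hcont
  have hT : ∃ T ∈ E, 0 ≤ T := by
    obtain ⟨p, hp, hps⟩ := h.hit h1 h2 true
    obtain ⟨φ, hφ⟩ := cc_surj p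
    rw [hps] at hφ
    obtain ⟨n, hn⟩ := exists_nat_gt (|φ - θ| / (2 * Real.pi))
    have hπ := Real.pi_pos
    rw [div_lt_iff₀ (by positivity)] at hn
    have h3 := abs_le.1 hn.le
    refine ⟨σ * (φ - θ) + n * (2 * Real.pi), mem_iUnion.2 ⟨true, ?_⟩, ?_⟩
    · have hσ2 : σ * σ = 1 := by rcases hσ with rfl | rfl <;> norm_num
      rcases hσ with rfl | rfl
      · have := cc_per s φ n
        simp only [mem_preimage]
        rw [show θ + 1 * (1 * (φ - θ) + n * (2 * Real.pi)) = φ + (n:ℤ) * (2 * Real.pi) by push_cast; ring,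
          this, hφ]
        exact hp
      · have := cc_per s φ (-n)
        simp only [mem_preimage]
        rw [show θ + -1 * (-1 * (φ - θ) + n * (2 * Real.pi)) = φ + (-n:ℤ) * (2 * Real.pi) by
          push_cast; ring, this, hφ]
        exact hp
    · rcases hσ with rfl | rfl <;> linarith
  obtain ⟨T, hTE, hT0⟩ := hT
  obtain ⟨t, htE, ht0, -, ht⟩ := first_hit hEc hTE hT0
  obtain ⟨i, hi⟩ := mem_iUnion.1 htE
  have htp : 0 < t := by
    refine lt_of_le_of_ne ht0 fun h0 => h.FnotU (i := i) hi ?_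
    subst h0; simpa using hθ
  refine ⟨t, htp, i, hi, fun t' h3 h4 => ?_⟩
  have hcc : Continuous fun t : ℝ => cc s (θ + σ * t) := (cc_cont s).comp hcont
  refine h.stay ((isPreconnected_Ico (a := 0) (b := t)).image _ hcc.continuousOn) ?_ ?_
    ⟨_, mem_image_of_mem _ ⟨le_rfl, htp⟩, by simpa using hθ⟩ (mem_image_of_mem _ ⟨h3, h4⟩)
  · rintro _ ⟨x, -, rfl⟩; exact cc_ann h h1 h2 _
  · rintro j _ ⟨x, hx, rfl⟩ hF; exact ht x hx.1 hx.2 (mem_iUnion.2 ⟨j, hF⟩)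

lemma Sol.logW (h : Sol δ U F G f) {m : ℂ → ℂ}
    (hm : DifferentiableOn ℂ m (ann δ 1 \ (F true ∪ F false)))
    (h0 : ∀ z ∈ ann δ 1 \ (F true ∪ F false), m z ≠ 0) :
    ∃ l : ℂ → ℂ, DifferentiableOn ℂ l (ann δ 1 \ (F true ∪ F false)) ∧
      ∀ z ∈ ann δ 1 \ (F true ∪ F false), exp (l z) = m z := by
  have hcl : ann δ 1 ∩ closure (F true ∪ F false) ⊆ F true ∪ F false := by
    rintro z ⟨hz, hc⟩
    rw [closure_union] at hc
    exact hc.imp (h.Frc _ z hz) (h.Frc _ z hz)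
  have hWo : IsOpen (ann δ 1 \ (F true ∪ F false)) := by
    have : ann δ 1 \ (F true ∪ F false) = ann δ 1 \ closure (F true ∪ F false) := by
      ext z; exact ⟨fun hz => ⟨hz.1, fun hc => hz.2 (hcl ⟨hz.1, hc⟩)⟩, fun hz => ⟨hz.1, fun hc => hz.2 (subset_closure hc)⟩⟩
    rw [this]
    exact (ann_open _ _).sdiff isClosed_closure
  obtain ⟨P, hP⟩ := prim_ann hcl (h.Fco _) (h.Fco _) (h.Fin _) (h.Fout _) (h.Fin _)
    (h := fun z => deriv m z / m z) ((hm.deriv hWo).div hm h0)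
  exact log_of_prim hWo hm h0 hP

lemma Sol.UW (h : Sol δ U F G f) : U ⊆ ann δ 1 \ (F true ∪ F false) := fun z hz =>
  ⟨h.UΩ hz, fun hc => hc.elim (fun hc => h.FnotU hc hz) (fun hc => h.FnotU hc hz)⟩

lemma Sol.log_data (h : Sol δ U F G f) : ∃ lU lZ : ℂ → ℂ, ∃ J : Bool → ℂ,
    ContinuousOn lU (U ∪ ⋃ i, F i) ∧ ContinuousOn lZ ((ann δ 1 \ closure U) ∪ ⋃ i, F i) ∧
    (∀ z ∈ U, exp (lU z) = z) ∧ (∀ z ∈ (ann δ 1 \ closure U) ∪ ⋃ i, F i, exp (lZ z) = z) ∧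
    (∀ i, ∀ z ∈ F i, lU z = lZ z + J i) ∧ ∀ i, exp (J i) = 1 := by
  set Z := ann δ 1 \ closure U with hZ
  set W := ann δ 1 \ (F true ∪ F false) with hW
  have hne : ∀ z ∈ ann δ 1, z ≠ 0 := by
    rintro z hz rfl
    have := hz.1; rw [norm_zero] at this; exact absurd this h.hδ.not_gt
  obtain ⟨l, hl, hel⟩ := h.logW (m := fun z => z) differentiableOn_id (fun z hz => hne z hz.1)
  have hUW := h.UW
  have hZW : Z ⊆ W := fun z hz => ⟨hz.1, fun hc => hz.2 (hc.elim (fun hc => h.Fcl _ hc) (fun hc => h.Fcl _ hc))⟩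
  have key : ∀ Y : Set ℂ, IsOpen Y → Y ⊆ W → (∀ i, ∀ p ∈ F i, LC Y p ∧ p ∈ closure Y) →
      ContinuousOn (extendFrom Y l) (Y ∪ ⋃ i, F i) ∧
        ∀ z ∈ Y ∪ ⋃ i, F i, exp (extendFrom Y l z) = z := by
    intro Y hY hYW hLC
    have hc1 : Y ∪ ⋃ i, F i ⊆ closure Y :=
      union_subset subset_closure (iUnion_subset fun i p hp => (hLC i p hp).2)
    have hlim : ∀ z ∈ Y ∪ ⋃ i, F i, ∃ y, Tendsto l (𝓝[Y] z) (𝓝 y) := by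
      rintro z (hz | hz)
      · exact ⟨l z, (hl.continuousOn.mono hYW) z hz⟩
      · obtain ⟨i, hi⟩ := mem_iUnion.1 hz
        exact log_ext (h := fun z => z) (hLC i z hi).1 (hl.continuousOn.mono hYW) continuousAt_id
          (hne z (h.FΩ i hi)) (Eventually.of_forall fun _ => continuousAt_id) (fun z hz => hel z (hYW hz))
    refine ⟨continuousOn_extendFrom hc1 hlim, fun z hz => ?_⟩
    have h1 := tendsto_extendFrom (hlim z hz)
    have : (𝓝[Y] z).NeBot := mem_closure_iff_nhdsWithin_neBot.1 (hc1 hz)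
    refine tendsto_nhds_unique (f := fun z => z) ?_ (tendsto_id.mono_left nhdsWithin_le_nhds : Tendsto id (𝓝[Y] z) (𝓝 z))
    refine ((continuous_exp.tendsto _).comp h1).congr' ?_
    filter_upwards [self_mem_nhdsWithin] with y hy using hel y (hYW hy)
  obtain ⟨hU1, hU2⟩ := key U h.Uo hUW (fun i p hp => ⟨h.lcU hp, h.Fcl i hp⟩)
  obtain ⟨hZ1, hZ2⟩ := key Z ((ann_open _ _).sdiff isClosed_closure) hZW (fun i p hp => h.lcZ hp)
  have hFn : ∀ i, (F i).Nonempty := fun i => closure_nonempty_iff.1 ((h.Fin i).mono inter_subset_left)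
  have hFZ : ∀ i, F i ⊆ Z ∪ ⋃ i, F i := fun i => (subset_iUnion F i).trans subset_union_right
  have he : ∀ i, ∀ z ∈ F i, exp (extendFrom U l z - extendFrom Z l z) = 1 := by
    intro i z hz
    rw [exp_sub, hU2 z (Sol.FX i hz), hZ2 z (hFZ i hz), div_self (hne z (h.FΩ i hz))]
  refine ⟨_, _, fun i => extendFrom U l (hFn i).some - extendFrom Z l (hFn i).some, hU1, hZ1,
    fun z hz => hU2 z (Or.inl hz), hZ2, fun i z hz => ?_, fun i => he i _ (hFn i).some_mem⟩
  have := exp_const (h.Fco i) ((hU1.mono (Sol.FX i)).sub (hZ1.mono (hFZ i))) (he i) hz (hFn i).some_mem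
  simp only [Pi.sub_apply] at this ⊢
  rw [← this]; ring

theorem Sol.circle (h : Sol δ U F G f) {s : ℝ} (h1 : δ < s) (h2 : s < 1) (A : Set ℝ)
    (hper : 0 ∈ A ↔ 2 * Real.pi ∈ A)
    (hA1 : ∀ θ, cc s θ ∈ U → ∀ᶠ θ' in 𝓝 θ, (θ' ∈ A ↔ θ ∈ A))
    (hA2 : ∀ i θ, cc s θ ∈ F i → ∀ᶠ θ' in 𝓝 θ, cc s θ' ∈ U → (θ' ∈ A ↔ i = true)) : False := by
  obtain ⟨lU, lZ, J, hU, hZ, eU, eZ, hJ, eJ⟩ := h.log_data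
  have hcont := cc_cont s
  have hann := cc_ann h h1 h2
  set Λ : ℝ → ℂ := fun θ => if cc s θ ∈ U then lU (cc s θ) - J (decide (θ ∈ A)) else lZ (cc s θ) with hΛ
  have hnU : ∀ θ, cc s θ ∉ U → cc s θ ∈ (ann δ 1 \ closure U) ∪ ⋃ i, F i := by
    intro θ hθ
    by_cases hc : cc s θ ∈ closure U
    · exact Or.inr (mem_iUnion.2 ((h.clU _ (hann θ) hc).resolve_left hθ))
    · exact Or.inl ⟨hann θ, hc⟩
  have hexp : ∀ θ, exp (Λ θ) = cc s θ := by
    intro θ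
    by_cases hθ : cc s θ ∈ U
    · simp only [hΛ, if_pos hθ]; rw [exp_sub, eU _ hθ, eJ, div_one]
    · simp only [hΛ, if_neg hθ]; exact eZ _ (hnU θ hθ)
  have hΛc : Continuous Λ := by
    refine continuous_iff_continuousAt.2 fun θ => ?_
    by_cases hθ : cc s θ ∈ U
    · have e : (fun θ' => lU (cc s θ') - J (decide (θ ∈ A))) =ᶠ[𝓝 θ] Λ := by
        filter_upwards [hA1 θ hθ, hcont.continuousAt.eventually_mem (h.Uo.mem_nhds hθ)] with θ' h3 h4
        simp only [hΛ, if_pos h4, h3]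
      refine ContinuousAt.congr ?_ e
      have : ContinuousAt lU (cc s θ) := hU.continuousAt (mem_of_superset (h.Uo.mem_nhds hθ) subset_union_left)
      exact (ContinuousAt.comp (f := cc s) this hcont.continuousAt).sub continuousAt_const
    · by_cases hF : ∃ i, cc s θ ∈ F i
      · obtain ⟨i, hi⟩ := hF
        have tU : Tendsto (fun θ' => lU (cc s θ')) (𝓝[cc s ⁻¹' U] θ) (𝓝 (lU (cc s θ))) :=
          Tendsto.comp (hU _ (Sol.FX i hi)) (tendsto_nhdsWithin_iff.2 ⟨hcont.continuousAt.mono_left nhdsWithin_le_nhds,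
            mem_of_superset self_mem_nhdsWithin fun x hx => Or.inl hx⟩)
        have tZ : Tendsto (fun θ' => lZ (cc s θ')) (𝓝[(cc s ⁻¹' U)ᶜ] θ) (𝓝 (lZ (cc s θ))) :=
          Tendsto.comp (hZ _ (Or.inr (mem_iUnion.2 ⟨i, hi⟩))) (tendsto_nhdsWithin_iff.2 ⟨hcont.continuousAt.mono_left nhdsWithin_le_nhds,
            mem_of_superset self_mem_nhdsWithin fun x hx => hnU x hx⟩)
        have hval : Λ θ = lZ (cc s θ) := by simp only [hΛ, if_neg hθ]
        rw [ContinuousAt, hval, ← nhdsWithin_univ, ← union_compl_self (cc s ⁻¹' U), nhdsWithin_union]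
        refine tendsto_sup.2 ⟨?_, ?_⟩
        · have := tU.sub_const (J i)
          rw [hJ i _ hi, add_sub_cancel_right] at this
          refine this.congr' ?_
          filter_upwards [self_mem_nhdsWithin, nhdsWithin_le_nhds (hA2 i θ hi)] with θ' h3 h4
          have h5 := h4 h3
          have h6 : decide (θ' ∈ A) = i := by
            rw [h5]; cases i <;> simp
          simp only [hΛ, if_pos (show cc s θ' ∈ U from h3), h6]
        · refine tZ.congr' ?_
          filter_upwards [self_mem_nhdsWithin] with θ' h3
          simp only [hΛ, if_neg (show cc s θ' ∉ U from h3)]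
      · have hc : cc s θ ∉ closure U := fun hc => (h.clU _ (hann θ) hc).elim hθ hF
        have ho : (closure U)ᶜ ∈ 𝓝 (cc s θ) := isClosed_closure.isOpen_compl.mem_nhds hc
        have hoZ : (ann δ 1 \ closure U) ∪ ⋃ i, F i ∈ 𝓝 (cc s θ) := by
          filter_upwards [ho, (ann_open δ 1).mem_nhds (hann θ)] with z hz hz' using Or.inl ⟨hz', hz⟩
        refine ContinuousAt.congr (ContinuousAt.comp (f := cc s) (hZ.continuousAt hoZ) hcont.continuousAt) ?_
        filter_upwards [hcont.continuousAt.eventually_mem ho] with θ' h3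
        simp only [hΛ, Function.comp, if_neg (fun h4 => h3 (subset_closure h4))]
  have hs0 : (s : ℂ) ≠ 0 := by exact_mod_cast (h.hδ.trans h1).ne'
  have := exp_const (S := univ) isPreconnected_univ (N := fun θ : ℝ => Λ θ - θ * I - Complex.log s)
    (by fun_prop) (fun θ _ => by
      rw [exp_sub, exp_sub, hexp, exp_log hs0, cc]; field_simp [exp_ne_zero]) (mem_univ 0) (mem_univ (2 * Real.pi))
  have hp : Λ (2 * Real.pi) = Λ 0 := by
    have := cc_per s 0 1
    simp only [Int.cast_one, one_mul, zero_add] at this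
    simp only [hΛ, this, hper]
  rw [hp] at this
  have h5 := congrArg Complex.im this
  simp at h5
  linarith [Real.pi_pos]

theorem Sol.exists_arc (h : Sol δ U F G f) {s : ℝ} (h1 : δ < s) (h2 : s < 1) :
    ∃ i a b, a < b ∧ cc s a ∈ F i ∧ cc s b ∈ F (!i) ∧ ∀ θ ∈ Ioo a b, cc s θ ∈ U := by
  by_contra hcon
  have hex : ∀ θ, cc s θ ∈ U → ∃ a b i, a < θ ∧ θ < b ∧ cc s a ∈ F i ∧ cc s b ∈ F i ∧
      ∀ x ∈ Ioo a b, cc s x ∈ U := by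
    intro θ hθ
    obtain ⟨t, ht, i, hi, hu⟩ := h.exit h1 h2 hθ 1 (Or.inl rfl)
    obtain ⟨t', ht', j, hj, hu'⟩ := h.exit h1 h2 hθ (-1) (Or.inr rfl)
    have hall : ∀ x ∈ Ioo (θ + -1 * t') (θ + 1 * t), cc s x ∈ U := by
      rintro x ⟨hx, hx'⟩
      rcases le_total θ x with h3 | h3
      · have := hu (x - θ) (by linarith) (by linarith)
        rwa [show θ + 1 * (x - θ) = x by ring] at this
      · have := hu' (θ - x) (by linarith) (by linarith)
        rwa [show θ + -1 * (θ - x) = x by ring] at this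
    refine ⟨_, _, i, by linarith, by linarith, ?_, hi, hall⟩
    by_contra hne
    have hji : i = !j := bool_ne fun e => hne (e ▸ hj)
    exact hcon ⟨j, _, _, by linarith, hj, hji ▸ hi, hall⟩
  have hFF : ∀ {z i j}, z ∈ F i → z ∈ F j → i = j := by
    intro z i j hi hj
    by_contra hne
    have : j = !i := bool_ne fun e => hne e.symm
    exact Set.disjoint_left.1 (h.FF i) hi (this ▸ hj)
  set A : Set ℝ := {θ | ∃ b, θ < b ∧ (∀ x ∈ Ico θ b, cc s x ∈ U) ∧ cc s b ∈ F true} with hA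
  have hAi : ∀ θ a b i, a < θ → θ < b → cc s b ∈ F i → (∀ x ∈ Ioo a b, cc s x ∈ U) →
      (θ ∈ A ↔ i = true) := by
    intro θ a b i ha hb hbi hu
    constructor
    · rintro ⟨b', hb', hu', hbF⟩
      rcases lt_trichotomy b b' with h3 | h3 | h3
      · exact absurd (hu' b ⟨hb.le, h3⟩) (h.FnotU hbi)
      · exact hFF hbi (h3 ▸ hbF)
      · exact absurd (hu b' ⟨ha.trans hb', h3⟩) (h.FnotU hbF)
    · rintro rfl
      exact ⟨b, hb, fun x hx => hu x ⟨ha.trans_le hx.1, hx.2⟩, hbi⟩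
  refine h.circle h1 h2 A ?_ ?_ ?_
  · have hp : ∀ x, cc s (x + 2 * Real.pi) = cc s x := fun x => by simpa using cc_per s x 1
    have hp' : ∀ x, cc s (x - 2 * Real.pi) = cc s x := fun x => by
      have := hp (x - 2 * Real.pi); rw [sub_add_cancel] at this; exact this.symm
    constructor
    · rintro ⟨b, hb, hu, hF⟩
      refine ⟨b + 2 * Real.pi, by linarith, fun x hx => ?_, by rwa [hp]⟩
      rw [← hp']; exact hu _ ⟨by linarith [hx.1], by linarith [hx.2]⟩
    · rintro ⟨b, hb, hu, hF⟩
      refine ⟨b - 2 * Real.pi, by linarith, fun x hx => ?_, by rwa [hp']⟩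
      rw [← hp]; exact hu _ ⟨by linarith [hx.1], by linarith [hx.2]⟩
  · intro θ hθ
    obtain ⟨a, b, i, ha, hb, -, hbi, hu⟩ := hex θ hθ
    filter_upwards [Ioo_mem_nhds ha hb] with θ' hθ'
    rw [hAi θ a b i ha hb hbi hu, hAi θ' a b i hθ'.1 hθ'.2 hbi hu]
  · intro i θ hi
    obtain ⟨η, hη, hn⟩ := Metric.eventually_nhds_iff_ball.1 ((cc_cont s).continuousAt.eventually (h.Floc hi))
    have hn' : ∀ x j, |x - θ| < η → cc s x ∈ F j → j = i := fun x j hx hj =>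
      hFF hj (hn x (by rwa [mem_ball, Real.dist_eq]) (Sol.FX j hj) (h.FnotU hj))
    filter_upwards [ball_mem_nhds θ hη] with θ' hθ' hU
    rw [mem_ball, Real.dist_eq, abs_lt] at hθ'
    obtain ⟨a, b, j, ha, hb, haj, hbj, hu⟩ := hex θ' hU
    rw [hAi θ' a b j ha hb hbj hu]
    have : j = i := by
      rcases lt_trichotomy θ' θ with h3 | h3 | h3
      · refine hn' b j ?_ hbj
        have : b ≤ θ := by
          by_contra hc; exact h.FnotU hi (hu θ ⟨by linarith, by linarith⟩)
        rw [abs_lt]; constructor <;> linarith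
      · exact absurd (h3 ▸ hU) (h.FnotU hi)
      · refine hn' a j ?_ haj
        have : θ ≤ a := by
          by_contra hc; exact h.FnotU hi (hu θ ⟨by linarith, by linarith⟩)
        rw [abs_lt]; constructor <;> linarith
    rw [this]
end

lemma gron {y y' : ℝ → ℝ} {t k : ℝ} (hd : ∀ τ ∈ Icc 0 t, HasDerivAt y (y' τ) τ)
    (hb : ∀ τ ∈ Icc 0 t, |y' τ| ≤ k * y τ) {τ : ℝ} (hτ : τ ∈ Icc 0 t) :
    y τ ≤ y 0 * Real.exp (k * τ) ∧ y 0 ≤ y τ * Real.exp (k * τ) := by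
  have hD : ∀ m : ℝ, ∀ τ ∈ Icc 0 t, HasDerivAt (fun τ => y τ * Real.exp (m * τ))
      ((y' τ + m * y τ) * Real.exp (m * τ)) τ := by
    intro m τ hτ
    refine ((hd τ hτ).mul (((hasDerivAt_id τ).const_mul m).exp)).congr_deriv ?_
    simp; ring
  have hc : ∀ m : ℝ, ContinuousOn (fun τ => y τ * Real.exp (m * τ)) (Icc 0 t) := fun m τ hτ =>
    (hD m τ hτ).continuousAt.continuousWithinAt
  have h0 : (0:ℝ) ∈ Icc 0 t := ⟨le_rfl, hτ.1.trans hτ.2⟩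
  constructor
  · have := antitoneOn_of_deriv_nonpos (convex_Icc 0 t) (hc (-k))
      (fun x hx => (hD _ x (interior_subset hx)).differentiableAt.differentiableWithinAt)
      (fun x hx => by
        rw [(hD _ x (interior_subset hx)).deriv]
        have := (abs_le.1 (hb x (interior_subset hx))).2
        exact mul_nonpos_of_nonpos_of_nonneg (by linarith) (Real.exp_pos _).le) h0 hτ hτ.1
    simp only [mul_zero, Real.exp_zero, mul_one] at this
    calc y τ = y τ * Real.exp (-k * τ) * Real.exp (k * τ) := by
          rw [mul_assoc, ← Real.exp_add]; simp
      _ ≤ _ := mul_le_mul_of_nonneg_right this (Real.exp_pos _).le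
  · have := monotoneOn_of_deriv_nonneg (convex_Icc 0 t) (hc k)
      (fun x hx => (hD _ x (interior_subset hx)).differentiableAt.differentiableWithinAt)
      (fun x hx => by
        rw [(hD _ x (interior_subset hx)).deriv]
        have := (abs_le.1 (hb x (interior_subset hx))).1
        exact mul_nonneg (by linarith) (Real.exp_pos _).le) h0 hτ hτ.1
    simpa using this

section
variable {δ : ℝ} {U : Set ℂ} {F : Bool → Set ℂ} {G f : ℂ → ℂ}

lemma Sol.ballU (h : Sol δ U F G f) {z : ℂ} (hz : z ∈ U) {R : ℝ} (hR : 0 < R)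
    (hd : R ≤ infDist z (⋃ i, F i)) (hb : ball z R ⊆ ann δ 1) : ball z R ⊆ U := by
  refine h.stay (convex_ball z R).isPreconnected hb (fun i w hw hF => ?_) ⟨z, mem_ball_self hR, hz⟩
  have := infDist_le_dist_of_mem (x := z) (mem_iUnion.2 ⟨i, hF⟩)
  rw [mem_ball, dist_comm] at hw
  linarith

lemma Sol.fball (h : Sol δ U F G f) {z : ℂ} {R : ℝ} (hR : 0 < R) (hb : ball z R ⊆ U) :
    ‖f z‖ ≤ 2 * (G z).im / R := by
  have := (cayley hR (h := G) (fun w hw => (h.der w (hb hw)).differentiableAt.differentiableWithinAt)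
    (fun w hw => h.pos w (hb hw))).1
  rwa [(h.der z (hb (mem_ball_self hR))).deriv] at this

lemma Sol.near (h : Sol δ U F G f) {z : ℂ} (hz : z ∈ U)
    (hb : closedBall z (infDist z (⋃ i, F i)) ⊆ ann δ 1) :
    ∃ i, ∃ p ∈ F i, 0 < infDist z (⋃ i, F i) ∧ dist z p = infDist z (⋃ i, F i) ∧
      ball z (infDist z (⋃ i, F i)) ⊆ U ∧ (G z).im ≤ 4 * infDist z (⋃ i, F i) ∧ ‖f z‖ ≤ 8 := by
  set d := infDist z (⋃ i, F i) with hd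
  have hne : (closure (⋃ i, F i)).Nonempty := by
    obtain ⟨p, hp, -⟩ := h.Fin true
    exact ⟨p, closure_mono (subset_iUnion F true) hp⟩
  obtain ⟨p, hp, hpd⟩ := isClosed_closure.exists_infDist_eq_dist hne z
  rw [infDist_closure, ← hd] at hpd
  have hpΩ : p ∈ ann δ 1 := hb (by rw [mem_closedBall, dist_comm, hpd])
  rw [closure_iUnion_of_finite, mem_iUnion] at hp
  obtain ⟨i, hi⟩ := hp
  have hi := h.Frc i p hpΩ hi
  have hd0 : 0 < d := by
    rw [hpd, dist_pos]; rintro rfl; exact h.FnotU hi hz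
  have hbU : ball z d ⊆ U := h.ballU hz hd0 le_rfl (ball_subset_closedBall.trans hb)
  have hu : (G z).im ≤ 4 * d := by
    obtain ⟨L, hL, -, hex⟩ := h.exp1 hi
    obtain ⟨ρ, hρ, he⟩ := hex 1 one_pos
    set t := min (1/2) (ρ / (2 * d)) with ht
    have ht0 : 0 < t := lt_min (by norm_num) (by positivity)
    have ht1 : t ≤ 1/2 := min_le_left _ _
    have ht2 : t * d < ρ := by
      have : t ≤ ρ / (2 * d) := min_le_right _ _
      rw [le_div_iff₀ (by positivity)] at this; linarith
    set w : ℂ := p + t * (z - p) with hw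
    have n1 : ‖z - p‖ = d := by rw [← dist_eq_norm, hpd]
    have n2 : ‖w - p‖ = t * d := by
      rw [hw, add_sub_cancel_left, norm_mul, norm_real, Real.norm_of_nonneg ht0.le, n1]
    have n3 : ‖w - z‖ = (1 - t) * d := by
      rw [show w - z = ((1 - t : ℝ) : ℂ) * (p - z) by rw [hw]; push_cast; ring, norm_mul, norm_real,
        Real.norm_of_nonneg (by linarith), norm_sub_rev, n1]
    have hwb : w ∈ ball z d := by rw [mem_ball, dist_eq_norm, n3]; nlinarith
    have hH := harnack hd0 (h := G) (fun w hw => (h.der w (hbU hw)).differentiableAt.differentiableWithinAt)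
      (fun w hw => h.pos w (hbU hw)) hwb
    have hE := he p ⟨Sol.FX i hi, mem_ball_self hρ⟩ w ⟨Or.inl (hbU hwb), by rwa [mem_ball, dist_eq_norm, n2]⟩
    have h3 : ‖G w - G p‖ ≤ 2 * (t * d) := by
      have := norm_add_le (G w - G p - L * (w - p)) (L * (w - p))
      rw [sub_add_cancel, norm_mul, hL, n2] at this
      rw [n2] at hE; linarith
    have h4 := (abs_le.1 ((abs_im_le_norm _).trans h3)).2
    rw [sub_im, h.Gr i p hi, sub_zero] at h4
    rw [n3] at hH
    have h5 : (G z).im * (t * d) ≤ (4 * d) * (t * d) := by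
      have : (G w).im * (d + (1 - t) * d) ≤ (2 * (t * d)) * (d + (1 - t) * d) :=
        mul_le_mul_of_nonneg_right h4 (by nlinarith)
      nlinarith [mul_pos ht0 hd0, mul_pos ht0 (mul_pos hd0 hd0)]
    exact le_of_mul_le_mul_right h5 (by positivity)
  refine ⟨i, p, hi, hd0, hpd.symm, hbU, hu, (h.fball hd0 hbU).trans ?_⟩
  rw [div_le_iff₀ hd0]; linarith

lemma ann_ball {s R : ℝ} {z : ℂ} (hz : ‖z‖ = s) (h1 : δ < s - R) (h2 : s + R < 1) :
    closedBall z R ⊆ ann δ 1 := by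
  intro w hw
  rw [mem_closedBall, dist_eq_norm] at hw
  have := abs_le.1 ((abs_norm_sub_norm_le w z).trans hw)
  constructor <;> linarith

lemma Sol.travel (h : Sol δ U F G f) {z : ℂ} (hz : z ∈ U) (h1 : 2 * δ ≤ ‖z‖) (h2 : ‖z‖ ≤ 1 / 2)
    {κ : ℝ} (hκ : 0 < κ) (hκ1 : κ ≤ 1 / 4) : ∃ w ∈ U, ‖w‖ = ‖z‖ ∧
      infDist w (⋃ i, F i) ≤ κ * ‖z‖ ∧ (G z).im ≤ Real.exp (4 * Real.pi / κ) * (G w).im ∧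
      ‖G w - G z‖ ≤ 4 * Real.pi / κ * Real.exp (4 * Real.pi / κ) * (G z).im := by
  have hδ := h.hδ
  set s := ‖z‖ with hs
  have hs0 : 0 < s := by linarith
  have hsδ : δ < s := by linarith
  obtain ⟨θ, hθ⟩ := cc_surj z
  rw [← hs] at hθ
  have hcont : Continuous fun t : ℝ => cc s (θ + t) := (cc_cont s).comp (by fun_prop)
  set E : Set ℝ := {t | infDist (cc s (θ + t)) (⋃ i, F i) ≤ κ * s} with hE
  have hEc : IsClosed E := isClosed_le ((continuous_infDist_pt _).comp hcont) continuous_const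
  have hT : ∃ T ∈ E, 0 ≤ T ∧ T ≤ 2 * Real.pi := by
    obtain ⟨p, hp, hps⟩ := h.hit hsδ (by linarith) true
    obtain ⟨φ, hφ⟩ := cc_surj p
    rw [hps] at hφ
    have h3 := toIcoMod_mem_Ico Real.two_pi_pos θ φ
    refine ⟨toIcoMod Real.two_pi_pos θ φ - θ, ?_, by linarith [h3.1], by linarith [h3.2]⟩
    have h4 : cc s (toIcoMod Real.two_pi_pos θ φ) = p := by
      rw [← hφ, toIcoMod, zsmul_eq_mul]
      have := cc_per s φ (-toIcoDiv Real.two_pi_pos θ φ)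
      rw [← this]; congr 1; push_cast; ring
    simp only [hE, mem_ofPred_eq, add_sub_cancel, h4]
    rw [infDist_zero_of_mem (mem_iUnion.2 ⟨true, hp⟩)]; positivity
  obtain ⟨T, hTE, hT0, hT2⟩ := hT
  obtain ⟨t, htE, ht0, htT, ht⟩ := first_hit hEc hTE hT0
  have hpi := Real.pi_pos
  have hex1 : 1 ≤ Real.exp (4 * Real.pi / κ) := Real.one_le_exp (by positivity)
  rcases ht0.eq_or_lt with h00 | htp
  · subst h00
    simp only [hE, mem_ofPred_eq, add_zero, hθ] at htE
    refine ⟨z, hz, rfl, htE, le_mul_of_one_le_left (h.pos z hz).le hex1, ?_⟩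
    rw [sub_self, norm_zero]; have := h.pos z hz; positivity
  have hge : ∀ τ ∈ Icc 0 t, κ * s ≤ infDist (cc s (θ + τ)) (⋃ i, F i) := by
    intro τ hτ
    have hcl : IsClosed {τ | κ * s ≤ infDist (cc s (θ + τ)) (⋃ i, F i)} :=
      isClosed_le continuous_const ((continuous_infDist_pt _).comp hcont)
    have : Ico 0 t ⊆ {τ | κ * s ≤ infDist (cc s (θ + τ)) (⋃ i, F i)} := fun x hx => by
      have := ht x hx.1 hx.2
      simp only [hE, mem_ofPred_eq, not_le] at this
      exact this.le
    have := closure_minimal this hcl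
    rw [closure_Ico htp.ne] at this
    exact this hτ
  have hU : ∀ τ ∈ Icc 0 t, cc s (θ + τ) ∈ U := by
    intro τ hτ
    refine h.stay ((isPreconnected_Icc (a := 0) (b := t)).image _ hcont.continuousOn) ?_ ?_
      ⟨_, mem_image_of_mem _ ⟨le_rfl, ht0⟩, by simpa [hθ] using hz⟩ (mem_image_of_mem _ hτ)
    · rintro _ ⟨x, -, rfl⟩; exact cc_ann h hsδ (by linarith) _
    · rintro j _ ⟨x, hx, rfl⟩ hF
      have := hge x hx
      simp only at hF
      rw [infDist_zero_of_mem (mem_iUnion.2 ⟨j, hF⟩)] at this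
      nlinarith
  have hκs : κ * s ≤ s / 4 := by nlinarith
  have hf : ∀ τ ∈ Icc 0 t, ‖f (cc s (θ + τ)) * (cc s (θ + τ) * I)‖ ≤ 2 / κ * (G (cc s (θ + τ))).im := by
    intro τ hτ
    have hn := cc_norm hs0.le (θ + τ)
    have := h.fball (by positivity) (h.ballU (hU τ hτ) (by positivity) (hge τ hτ)
      (ball_subset_closedBall.trans (ann_ball hn (by linarith) (by linarith))))
    rw [norm_mul, norm_mul, norm_I, hn, mul_one]
    calc _ ≤ 2 * (G (cc s (θ + τ))).im / (κ * s) * s := mul_le_mul_of_nonneg_right this hs0.le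
      _ = _ := by field_simp
  have hd : ∀ τ ∈ Icc 0 t, HasDerivAt (fun τ => G (cc s (θ + τ))) (f (cc s (θ + τ)) * (cc s (θ + τ) * I)) τ := by
    intro τ hτ
    have h3 : HasDerivAt (fun τ => cc s (θ + τ)) (cc s (θ + τ) * I) τ :=
      (cc_hd s (θ + τ)).comp_const_add θ τ
    exact HasDerivAt.comp τ (h.der _ (hU τ hτ)) h3
  have hdi : ∀ τ ∈ Icc 0 t, HasDerivAt (fun τ => (G (cc s (θ + τ))).im) (f (cc s (θ + τ)) * (cc s (θ + τ) * I)).im τ :=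
    fun τ hτ => imCLM.hasFDerivAt.comp_hasDerivAt τ (hd τ hτ)
  have hg := fun τ hτ => gron hdi (fun τ hτ => (abs_im_le_norm _).trans (hf τ hτ)) (τ := τ) hτ
  simp only [add_zero, hθ] at hg
  have hle : ∀ τ ∈ Icc 0 t, Real.exp (2 / κ * τ) ≤ Real.exp (4 * Real.pi / κ) := by
    intro τ hτ
    apply Real.exp_le_exp.2
    rw [div_mul_eq_mul_div]
    exact div_le_div_of_nonneg_right (by linarith [hτ.2]) hκ.le
  have htt : t ∈ Icc 0 t := ⟨ht0, le_rfl⟩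
  have hp0 := h.pos z hz
  refine ⟨cc s (θ + t), hU t htt, cc_norm hs0.le _, htE, ?_, ?_⟩
  · refine (hg t htt).2.trans ?_
    rw [mul_comm]
    exact mul_le_mul_of_nonneg_right (hle t htt) (h.pos _ (hU t htt)).le
  · have := norm_image_sub_le_of_norm_deriv_le_segment' (f := fun τ => G (cc s (θ + τ))) (a := 0) (b := t)
      (C := 2 / κ * ((G z).im * Real.exp (4 * Real.pi / κ)))
      (fun τ hτ => (hd τ hτ).hasDerivWithinAt) (fun τ hτ => (hf τ (Ico_subset_Icc_self hτ)).trans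
        (mul_le_mul_of_nonneg_left ((hg τ (Ico_subset_Icc_self hτ)).1.trans
          (mul_le_mul_of_nonneg_left (hle τ (Ico_subset_Icc_self hτ)) hp0.le)) (by positivity))) t htt
    simp only [add_zero, hθ, sub_zero] at this
    refine this.trans ?_
    calc _ ≤ 2 / κ * ((G z).im * Real.exp (4 * Real.pi / κ)) * (2 * Real.pi) :=
          mul_le_mul_of_nonneg_left (htT.trans hT2) (by positivity)
      _ = _ := by field_simp; ring

noncomputable def MM : ℝ := 8 * Real.exp (16 * Real.pi)

lemma MM_ge : 8 ≤ MM := by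
  have : 1 ≤ Real.exp (16 * Real.pi) := Real.one_le_exp (by positivity)
  unfold MM; linarith

theorem Sol.lip (h : Sol δ U F G f) {z : ℂ} (hz : z ∈ U) (h1 : 2 * δ ≤ ‖z‖) (h2 : ‖z‖ ≤ 1 / 2) :
    ‖f z‖ ≤ MM := by
  have hδ := h.hδ
  by_cases hd : infDist z (⋃ i, F i) ≤ ‖z‖ / 4
  · obtain ⟨i, p, -, -, -, -, -, h3⟩ := h.near hz (ann_ball rfl (by linarith) (by linarith))
    exact h3.trans MM_ge
  · push Not at hd
    obtain ⟨w, hw, hwn, hwd, hzw, -⟩ := h.travel hz h1 h2 (κ := 1/4) (by norm_num) le_rfl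
    obtain ⟨i, p, -, -, -, -, h3, -⟩ := h.near hw (ann_ball hwn (by linarith) (by linarith))
    have h4 := h.fball (by linarith : 0 < ‖z‖ / 4) (h.ballU hz (by linarith) hd.le
      (ball_subset_closedBall.trans (ann_ball rfl (by linarith) (by linarith))))
    have e : 4 * Real.pi / (1/4) = 16 * Real.pi := by ring
    rw [e] at hzw
    refine h4.trans ?_
    rw [div_le_iff₀ (by linarith), MM]
    nlinarith [Real.exp_pos (16 * Real.pi)]
end

section
variable {δ : ℝ} {U : Set ℂ} {F : Bool → Set ℂ} {G f : ℂ → ℂ}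

lemma Sol.side (h : Sol δ U F G f) {V Y : Set ℂ} (hV : IsOpen V) (hY : IsOpen Y)
    (hY' : IsOpen ((U ∩ V) \ Y)) {i : Bool} {p : ℂ} (hp : p ∈ F i) (hpV : p ∈ V) :
    (∀ᶠ z in 𝓝 p, z ∈ U → z ∈ Y) ∨ (∀ᶠ z in 𝓝 p, z ∈ U → z ∉ Y) := by
  obtain ⟨ρ, hρ, hb⟩ := Metric.isOpen_iff.1 hV p hpV
  obtain ⟨ρ', hρ', K, hK, h1, h2⟩ := h.lcU hp ρ hρ
  have hcov : K ⊆ Y ∪ ((U ∩ V) \ Y) := fun z hz => by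
    by_cases hy : z ∈ Y
    · exact Or.inl hy
    · exact Or.inr ⟨⟨(h2 hz).1, hb (h2 hz).2⟩, hy⟩
  rcases isPreconnected_iff_subset_of_disjoint.1 hK _ _ hY hY' hcov
    (by ext z; simp only [mem_inter_iff, Set.mem_sdiff, mem_empty_iff_false]; tauto) with h3 | h3
  · left; filter_upwards [ball_mem_nhds p hρ'] with z hz hzU using h3 (h1 ⟨hzU, hz⟩)
  · right; filter_upwards [ball_mem_nhds p hρ'] with z hz hzU using (h3 (h1 ⟨hzU, hz⟩)).2

lemma Sol.sideConst (h : Sol δ U F G f) {V Y Q : Set ℂ} (hV : IsOpen V) (hY : IsOpen Y)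
    (hY' : IsOpen ((U ∩ V) \ Y)) {i : Bool} (hQ : IsPreconnected Q) (hQF : Q ⊆ F i) (hQV : Q ⊆ V)
    {p q : ℂ} (hp : p ∈ Q) (hq : q ∈ Q) (hs : ∀ᶠ z in 𝓝 p, z ∈ U → z ∈ Y) :
    ∀ᶠ z in 𝓝 q, z ∈ U → z ∈ Y := by
  have hcontr : ∀ x ∈ Q, (∀ᶠ z in 𝓝 x, z ∈ U → z ∈ Y) → (∀ᶠ z in 𝓝 x, z ∈ U → z ∉ Y) → False := by
    intro x hx h1 h2
    obtain ⟨z, hz, hz'⟩ := mem_closure_iff_nhds.1 (h.Fcl i (hQF hx)) _ (h1.and h2)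
    exact hz.2 hz' (hz.1 hz')
  rcases isPreconnected_iff_subset_of_disjoint.1 hQ {x | ∀ᶠ z in 𝓝 x, z ∈ U → z ∈ Y}
    {x | ∀ᶠ z in 𝓝 x, z ∈ U → z ∉ Y} isOpen_setOfPred_eventually_nhds isOpen_setOfPred_eventually_nhds
    (fun x hx => h.side hV hY hY' (hQF hx) (hQV hx))
    (by ext x; constructor
        · rintro ⟨h1, h2, h3⟩; exact hcontr x h1 h2 h3
        · exact fun h => h.elim) with h3 | h3
  · exact h3 hq
  · exact (hcontr p hp hs (h3 hp)).elim

lemma pre_frontier {S Y : Set ℂ} (hS : IsPreconnected S) (hf : ∀ x ∈ S, x ∉ frontier Y) :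
    S ⊆ Y ∨ S ⊆ Yᶜ := by
  have hc : S ⊆ interior Y ∪ interior Yᶜ := by
    rw [← compl_frontier_eq_union_interior]; exact hf
  exact (isPreconnected_iff_subset_of_disjoint.1 hS _ _ isOpen_interior isOpen_interior hc
    (by ext x; simp only [mem_inter_iff, mem_empty_iff_false, iff_false]
        exact fun h => interior_subset h.2.2 (interior_subset h.2.1))).imp
    (fun h => h.trans interior_subset) (fun h => h.trans interior_subset)

lemma Sol.circ_empty (h : Sol δ U F G f) {Y : Set ℂ} (hYU : Y ⊆ U) {s : ℝ} (h1 : δ < s) (h2 : s < 1)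
    (hf : ∀ z, ‖z‖ = s → z ∉ frontier Y) {z : ℂ} (hz : z ∈ Y) : ‖z‖ ≠ s := by
  intro hzs
  obtain ⟨q, hq, hqs⟩ := h.hit h1 h2 true
  have hS : IsPreconnected (sphere (0:ℂ) s) :=
    isPreconnected_sphere (by rw [rank_real_complex]; norm_num) 0 s
  rcases pre_frontier hS (Y := Y) (fun x hx => hf x (by simpa using hx)) with h3 | h3
  · exact h.FnotU hq (hYU (h3 (by simpa using hqs)))
  · exact h3 (show z ∈ sphere (0:ℂ) s by simpa using hzs) hz

lemma Sol.Fseg (h : Sol δ U F G f) (i : Bool) {I : Set ℝ} (hI : I.OrdConnected) :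
    IsPreconnected {p ∈ F i | (G p).re ∈ I} := by
  obtain ⟨J, γ, hS, hp, -⟩ := h.param i
  have : {p ∈ F i | (G p).re ∈ I} = γ '' (J ∩ I) := by
    ext p; constructor
    · rintro ⟨h1, h2⟩; exact ⟨_, ⟨(hp p h1).1, h2⟩, (hp p h1).2⟩
    · rintro ⟨t, ht, rfl⟩; exact ⟨hS.m t ht.1, by rw [hS.s t ht.1, ofReal_re]; exact ht.2⟩
  rw [this]
  exact ((hS.c.ordConnected.inter hI).isPreconnected).image _ (hS.k.mono inter_subset_left)

lemma ordC (τ c : ℝ) : {t : ℝ | c < τ * t}.OrdConnected := by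
  refine ⟨fun x hx y hy z hz => ?_⟩
  simp only [mem_ofPred_eq] at *
  rcases le_total 0 τ with h | h
  · exact hx.trans_le (mul_le_mul_of_nonneg_left hz.1 h)
  · exact hy.trans_le (mul_le_mul_of_nonpos_left hz.2 h)

lemma Sol.half (h : Sol δ U F G f) {i : Bool} {p₀ : ℂ} (hp : p₀ ∈ F i) (τ : ℝ) (hτ : τ = 1 ∨ τ = -1) :
    (∃ δ' > δ, ∀ p ∈ F i, 0 ≤ τ * ((G p).re - (G p₀).re) → δ' ≤ ‖p‖) ∨
    (∃ s' < 1, ∀ p ∈ F i, 0 ≤ τ * ((G p).re - (G p₀).re) → ‖p‖ ≤ s') := by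
  set s := ‖p₀‖ with hs
  obtain ⟨h1, h2⟩ : δ < s ∧ s < 1 := h.FΩ i hp
  have hSc : IsCompact (F i ∩ sphere 0 s) := by
    refine (isCompact_sphere (0:ℂ) s).of_isClosed_subset ?_ inter_subset_right
    refine isClosed_of_closure_subset fun x hx => ?_
    have hxs : x ∈ sphere 0 s := closure_minimal inter_subset_right isClosed_sphere hx
    have hxn : ‖x‖ = s := by simpa using hxs
    exact ⟨h.Frc i x ⟨by rw [hxn]; exact h1, by rw [hxn]; exact h2⟩ (closure_mono inter_subset_left hx), hxs⟩
  have hGF : ContinuousOn (fun p => τ * (G p).re) (F i ∩ sphere 0 s) :=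
    continuousOn_const.mul (continuous_re.comp_continuousOn (h.Gc.mono (inter_subset_left.trans (Sol.FX i))))
  obtain ⟨q, hq, hqm⟩ := hSc.exists_isMaxOn ⟨p₀, hp, by simp [hs]⟩ hGF
  obtain ⟨J, γ, hS, hpar, -⟩ := h.param i
  have hJ : uIcc (G p₀).re (G q).re ⊆ J := hS.c.ordConnected.uIcc_subset (hpar _ hp).1 (hpar _ hq.1).1
  have hcomp : IsCompact (γ '' uIcc (G p₀).re (G q).re) := isCompact_uIcc.image_of_continuousOn (hS.k.mono hJ)
  have hne : (γ '' uIcc (G p₀).re (G q).re).Nonempty := ⟨_, mem_image_of_mem _ left_mem_uIcc⟩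
  have hmem : ∀ p ∈ F i, 0 ≤ τ * ((G p).re - (G p₀).re) → τ * (G p).re ≤ τ * (G q).re →
      p ∈ γ '' uIcc (G p₀).re (G q).re := by
    intro p hp1 hp2 hp3
    refine ⟨_, ?_, (hpar p hp1).2⟩
    rw [mem_uIcc]
    rcases hτ with rfl | rfl
    · left; constructor <;> linarith
    · right; constructor <;> linarith
  set Q := {p ∈ F i | (G p).re ∈ {t : ℝ | τ * (G q).re < τ * t}} with hQ
  have hQp : IsPreconnected Q := h.Fseg i (ordC τ _)
  have hcase : (∀ p ∈ Q, ‖p‖ < s) ∨ ∀ p ∈ Q, s < ‖p‖ := by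
    have := isPreconnected_iff_subset_of_disjoint.1 hQp {p | ‖p‖ < s} {p | s < ‖p‖}
      (isOpen_lt continuous_norm continuous_const) (isOpen_lt continuous_const continuous_norm)
      (fun p hp => by
        rcases lt_trichotomy ‖p‖ s with h3 | h3 | h3
        · exact Or.inl h3
        · have := hqm ⟨hp.1, by simpa using h3⟩
          exact absurd (show τ * (G q).re < τ * (G p).re from hp.2) (not_lt.2 this)
        · exact Or.inr h3)
      (by ext p; simp only [mem_inter_iff, mem_ofPred_eq, mem_empty_iff_false, iff_false]; rintro ⟨-, h3, h4⟩; linarith)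
    exact this
  have hγ : ∀ x ∈ γ '' uIcc (G p₀).re (G q).re, x ∈ ann δ 1 := by
    rintro _ ⟨t, ht, rfl⟩; exact h.FΩ i (hS.m t (hJ ht))
  rcases hcase with hc | hc
  · right
    obtain ⟨m, hm, hmm⟩ := hcomp.exists_isMaxOn hne continuous_norm.continuousOn
    refine ⟨max ‖m‖ s, max_lt (hγ m hm).2 h2, fun p hp1 hp2 => ?_⟩
    by_cases hp3 : τ * (G p).re ≤ τ * (G q).re
    · exact (hmm (hmem p hp1 hp2 hp3)).trans (le_max_left _ _)
    · exact (hc p ⟨hp1, not_le.1 hp3⟩).le.trans (le_max_right _ _)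
  · left
    obtain ⟨m, hm, hmm⟩ := hcomp.exists_isMinOn hne continuous_norm.continuousOn
    refine ⟨min ‖m‖ s, lt_min (hγ m hm).1 h1, fun p hp1 hp2 => ?_⟩
    by_cases hp3 : τ * (G p).re ≤ τ * (G q).re
    · exact (min_le_left _ _).trans (hmm (hmem p hp1 hp2 hp3))
    · exact (min_le_right _ _).trans (hc p ⟨hp1, not_le.1 hp3⟩).le

lemma Sol.ends (h : Sol δ U F G f) {i : Bool} {p₀ : ℂ} (hp : p₀ ∈ F i) : ∃ σ : ℝ, (σ = 1 ∨ σ = -1) ∧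
    (∃ δ' > δ, ∀ p ∈ F i, 0 ≤ σ * ((G p).re - (G p₀).re) → δ' ≤ ‖p‖) ∧
    (∃ s' < 1, ∀ p ∈ F i, σ * ((G p).re - (G p₀).re) ≤ 0 → ‖p‖ ≤ s') := by
  have hdich : ∀ p : ℂ, 0 ≤ 1 * ((G p).re - (G p₀).re) ∨ 0 ≤ -1 * ((G p).re - (G p₀).re) := by
    intro p; rcases le_total (G p).re (G p₀).re with h | h
    · right; linarith
    · left; linarith
  rcases h.half hp 1 (Or.inl rfl) with ⟨d, hd, hd'⟩ | ⟨d, hd, hd'⟩ <;>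
  rcases h.half hp (-1) (Or.inr rfl) with ⟨e, he, he'⟩ | ⟨e, he, he'⟩
  · exfalso
    obtain ⟨x, hx, hx'⟩ := h.Fin i
    have : F i ⊆ {p | min d e ≤ ‖p‖} := fun p hp => (hdich p).elim
      (fun h3 => (min_le_left _ _).trans (hd' p hp h3)) (fun h3 => (min_le_right _ _).trans (he' p hp h3))
    have := closure_minimal this (isClosed_le continuous_const continuous_norm) hx
    rw [mem_ofPred_eq, mem_sphere_zero_iff_norm.1 hx'] at this
    exact absurd (lt_min hd he) (not_lt.2 this)
  · exact ⟨1, Or.inl rfl, ⟨d, hd, hd'⟩, e, he, fun p hp h3 => he' p hp (by linarith)⟩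
  · exact ⟨-1, Or.inr rfl, ⟨e, he, he'⟩, d, hd, fun p hp h3 => hd' p hp (by linarith)⟩
  · exfalso
    obtain ⟨x, hx, hx'⟩ := h.Fout i
    have : F i ⊆ {p | ‖p‖ ≤ max d e} := fun p hp => (hdich p).elim
      (fun h3 => (hd' p hp h3).trans (le_max_left _ _)) (fun h3 => (he' p hp h3).trans (le_max_right _ _))
    have := closure_minimal this (isClosed_le continuous_norm continuous_const) hx
    rw [mem_ofPred_eq, mem_sphere_zero_iff_norm.1 hx'] at this
    exact absurd (max_lt hd he) (not_lt.2 this)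
end

lemma arc_id (r a b θ : ℝ) : exp ((b - a) / 2 * I) * (cc r θ - cc r a) * Real.sin ((θ - b) / 2) =
    Real.sin ((θ - a) / 2) * (cc r θ - cc r b) := by
  have e : ∀ x y : ℝ, cc r x - cc r y = r * exp ((x + y) / 2 * I) * (2 * I * Real.sin ((x - y) / 2)) := by
    intro x y
    rw [cc, cc, ofReal_sin, Complex.sin]
    have h1 : (x : ℂ) * I = (x + y) / 2 * I + (x - y) / 2 * I := by ring
    have h2 : (y : ℂ) * I = (x + y) / 2 * I + -((x - y) / 2) * I := by ring
    rw [h1, h2, exp_add, exp_add]; push_cast; ring_nf; rw [I_sq]; ring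
  rw [e, e]
  have h3 : ((θ : ℂ) + b) / 2 * I = (b - a) / 2 * I + (θ + a) / 2 * I := by ring
  rw [h3, exp_add]; ring

lemma arc_iff {r a b : ℝ} (hr : 0 < r) (hab : a < b) (hb : b < a + 2 * Real.pi) {z : ℂ}
    (hza : z ≠ cc r a) (hzb : z ≠ cc r b) : (∃ θ ∈ Ioo a b, cc r θ = z) ↔
      ∃ k : ℝ, 0 < k ∧ exp ((b - a) / 2 * I) * (z - cc r a) / (z - cc r b) = -k := by
  have hzb' := sub_ne_zero.2 hzb
  have hza' := sub_ne_zero.2 hza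
  set c := exp ((b - a : ℂ) / 2 * I) with hc
  constructor
  · rintro ⟨θ, hθ, rfl⟩
    have s1 : 0 < Real.sin ((θ - a) / 2) := Real.sin_pos_of_pos_of_lt_pi (by linarith [hθ.1]) (by linarith [hθ.2])
    have s2 : 0 < Real.sin (-((θ - b) / 2)) := Real.sin_pos_of_pos_of_lt_pi (by linarith [hθ.2]) (by linarith [hθ.1])
    rw [Real.sin_neg] at s2
    refine ⟨Real.sin ((θ - a) / 2) / -Real.sin ((θ - b) / 2), by positivity, ?_⟩
    have := arc_id r a b θ
    have s3 : (Real.sin ((θ - b) / 2) : ℂ) ≠ 0 := by exact_mod_cast (by linarith : Real.sin ((θ - b) / 2) < 0).ne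
    rw [div_eq_iff hzb', ← mul_left_inj' s3, this]
    push_cast at s3 ⊢; field_simp
  · rintro ⟨k, hk, he⟩
    have hcn : ‖c‖ = 1 := by
      have : (b - a : ℂ) / 2 * I = ((b - a) / 2 : ℝ) * I := by push_cast; ring
      rw [hc, this, norm_exp_ofReal_mul_I]
    have hci : 0 < c.im := by
      have : (b - a : ℂ) / 2 * I = ((b - a) / 2 : ℝ) * I := by push_cast; ring
      rw [hc, this, exp_ofReal_mul_I_im]; exact Real.sin_pos_of_pos_of_lt_pi (by linarith) (by linarith)
    have hck : c + k ≠ 0 := by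
      intro h; have := congrArg Complex.im h; simp at this; linarith
    have hba : cc r b = cc r a * c ^ 2 := by
      rw [hc, ← exp_nat_mul, cc, cc, mul_assoc, ← exp_add]; congr 2; push_cast; ring
    rw [div_eq_iff hzb'] at he
    have hz : z * (c + k) = cc r a * c * (1 + k * c) := by rw [hba] at he; linear_combination he
    have hn : ‖(1 : ℂ) + k * c‖ = ‖c + k‖ := by
      have h1 : c * (starRingEnd ℂ) (c + k) = 1 + k * c := by
        rw [map_add, mul_add, mul_conj, normSq_eq_norm_sq, hcn, conj_ofReal]; push_cast; ring
      rw [← h1, norm_mul, hcn, one_mul, RCLike.norm_conj]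
    have hzr : ‖z‖ = r := by
      have := congrArg norm hz
      rw [norm_mul, norm_mul, norm_mul, hn, hcn, cc_norm hr.le, mul_one] at this
      exact mul_right_cancel₀ (norm_ne_zero_iff.2 hck) this
    obtain ⟨φ, hφ⟩ := cc_surj z
    rw [hzr] at hφ
    obtain ⟨θ, h1, n, rfl⟩ : ∃ θ ∈ Ico a (a + 2 * Real.pi), ∃ n : ℤ, φ = θ + n * (2 * Real.pi) := by
      refine ⟨toIcoMod Real.two_pi_pos a φ, toIcoMod_mem_Ico _ _ _, toIcoDiv Real.two_pi_pos a φ, ?_⟩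
      have := toIcoMod_add_toIcoDiv_zsmul Real.two_pi_pos a φ
      rw [zsmul_eq_mul] at this; exact this.symm
    rw [cc_per] at hφ
    have ha : θ ≠ a := fun h => hza (by rw [← hφ, h])
    have hb' : θ ≠ b := fun h => hzb (by rw [← hφ, h])
    have h1a := lt_of_le_of_ne h1.1 ha.symm
    refine ⟨θ, ⟨h1a, ?_⟩, hφ⟩
    by_contra hlt
    have hlt' : b < θ := lt_of_le_of_ne (not_lt.1 hlt) hb'.symm
    have s1 : 0 < Real.sin ((θ - a) / 2) := Real.sin_pos_of_pos_of_lt_pi (by linarith) (by linarith [h1.2])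
    have s2 : 0 < Real.sin ((θ - b) / 2) := Real.sin_pos_of_pos_of_lt_pi (by linarith) (by linarith [h1.2])
    have := arc_id r a b θ
    rw [hφ, ← hc, he] at this
    have h5 : (-k * Real.sin ((θ - b) / 2) : ℝ) = Real.sin ((θ - a) / 2) := by
      have : (-k * Real.sin ((θ - b) / 2) : ℂ) = Real.sin ((θ - a) / 2) :=
        mul_right_cancel₀ hzb' (by linear_combination this)
      exact_mod_cast this
    have := mul_pos hk s2; linarith

lemma off_sphere {z₀ : ℂ} {Y : Set ℂ} (hz : z₀ ≠ 0) (hY : Y ∈ 𝓝 z₀) : ∃ z ∈ Y, ‖z‖ ≠ ‖z₀‖ := by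
  have ht : Tendsto (fun t : ℝ => (1 + t : ℂ) * z₀) (𝓝[>] 0) (𝓝 z₀) := by
    have : Continuous fun t : ℝ => (1 + t : ℂ) * z₀ := by fun_prop
    have h := this.tendsto 0
    simp only [ofReal_zero, add_zero, one_mul] at h
    exact h.mono_left nhdsWithin_le_nhds
  obtain ⟨t, h1, h2⟩ := ((ht.eventually hY).and self_mem_nhdsWithin).exists
  refine ⟨_, h1, ?_⟩
  have h2' : 0 < t := h2
  have : ‖(1 + t : ℂ)‖ = 1 + t := by
    rw [← ofReal_one, ← ofReal_add, norm_real, Real.norm_of_nonneg (by linarith)]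
  rw [norm_mul, this]; have := norm_pos_iff.2 hz; nlinarith

structure Cut (δ r : ℝ) (U : Set ℂ) (F : Bool → Set ℂ) (G : ℂ → ℂ) (p : Bool → ℂ) (σ : Bool → ℝ)
    (α Ui Uo : Set ℂ) : Prop where
  pF : ∀ i, p i ∈ F i
  pr : ∀ i, ‖p i‖ = r
  αU : α ⊆ U
  αr : ∀ z ∈ α, ‖z‖ = r
  αc : closure α ⊆ α ∪ range p
  io : IsOpen Ui
  oo : IsOpen Uo
  iU : Ui ⊆ U
  oU : Uo ⊆ U
  dis : Disjoint Ui Uo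
  di : Disjoint Ui α
  dO : Disjoint Uo α
  cov : ∀ z ∈ U, z ∈ Ui ∨ z ∈ Uo ∨ z ∈ α
  hσ : ∀ i, σ i = 1 ∨ σ i = -1
  out : ∀ i, ∀ q ∈ F i, 0 < σ i * ((G q).re - (G (p i)).re) → ∀ᶠ z in 𝓝 q, z ∈ U → z ∈ Uo
  tail : ∀ i, ∀ q ∈ F i, σ i * ((G q).re - (G (p i)).re) < 0 → ∀ᶠ z in 𝓝 q, z ∈ U → z ∈ Ui
  inn : ∃ δ' > δ, (∀ z ∈ Uo, δ' ≤ ‖z‖) ∧ ∀ i, ∀ q ∈ F i, 0 ≤ σ i * ((G q).re - (G (p i)).re) → δ' ≤ ‖q‖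
  outr : ∃ s' < 1, (∀ z ∈ Ui, ‖z‖ ≤ s') ∧ ∀ i, ∀ q ∈ F i, σ i * ((G q).re - (G (p i)).re) ≤ 0 → ‖q‖ ≤ s'
  Gb : ∀ x ∈ α ∪ range p, ∀ y ∈ α ∪ range p, ‖G x - G y‖ ≤ 2 * Real.pi * MM * r

section
variable {δ : ℝ} {U : Set ℂ} {F : Bool → Set ℂ} {G f : ℂ → ℂ}

lemma Sol.split (h : Sol δ U F G f) {r a b : ℝ} (hr : 0 < r) (hab : a < b) (hb : b < a + 2 * Real.pi)
    {i : Bool} (hpa : cc r a ∈ F i) (hpb : cc r b ∈ F !i) (hU : ∀ θ ∈ Ioo a b, cc r θ ∈ U) :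
    ∃ Y : Bool → Set ℂ, (∀ t, IsOpen (Y t)) ∧ (∀ t, (Y t).Nonempty) ∧ (∀ t, Y t ⊆ U) ∧
      (∀ t, Disjoint (Y t) (Y !t)) ∧ (∀ t, Disjoint (Y t) (cc r '' Ioo a b)) ∧
      ∀ t, ∀ z ∈ U, z ∉ cc r '' Ioo a b → z ∈ Y t ∨ z ∈ Y !t := by
  have hne : ∀ z ∈ ann δ 1 \ (F true ∪ F false), z ≠ cc r a ∧ z ≠ cc r b := by
    rintro z ⟨-, hz⟩
    constructor <;> rintro rfl <;> apply hz
    · cases i; exacts [Or.inr hpa, Or.inl hpa]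
    · cases i; exacts [Or.inl hpb, Or.inr hpb]
  set W := ann δ 1 \ (F true ∪ F false) with hW
  set c := exp ((b - a : ℂ) / 2 * I) with hc
  obtain ⟨l, hl, hle⟩ := h.logW (m := fun z => c * (z - cc r a) / (z - cc r b))
    (fun z hz => by
      have := sub_ne_zero.2 (hne z hz).2
      exact DifferentiableAt.differentiableWithinAt (by fun_prop (disch := exact this)))
    (fun z hz => div_ne_zero (mul_ne_zero (exp_ne_zero _) (sub_ne_zero.2 (hne z hz).1)) (sub_ne_zero.2 (hne z hz).2))
  have hlU : DifferentiableOn ℂ l U := hl.mono h.UW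
  set α := cc r '' Ioo a b with hα
  have hαU : α ⊆ U := by rintro _ ⟨θ, hθ, rfl⟩; exact hU θ hθ
  have hiff : ∀ z ∈ U, (z ∈ α ↔ ∃ k : ℝ, 0 < k ∧ exp (l z) = -k) := fun z hz => by
    rw [hle z (h.UW hz)]; exact arc_iff hr hab hb (hne z (h.UW hz)).1 (hne z (h.UW hz)).2
  set z₀ := cc r ((a + b) / 2) with hz0
  have hz0α : z₀ ∈ α := ⟨_, ⟨by linarith, by linarith⟩, rfl⟩
  have him : ∀ z ∈ U, (z ∈ α ↔ ∃ n : ℤ, (l z).im = Real.pi + n * (2 * Real.pi)) := by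
    intro z hz
    rw [hiff z hz]
    constructor
    · rintro ⟨k, hk, he⟩
      have : exp (l z) = exp (Real.log k + Real.pi * I) := by
        rw [he, exp_add, exp_pi_mul_I, ← ofReal_exp, Real.exp_log hk]; ring
      obtain ⟨n, hn⟩ := exp_eq_exp_iff_exists_int.1 this
      refine ⟨n, ?_⟩
      rw [hn]; simp
    · rintro ⟨n, hn⟩
      refine ⟨Real.exp (l z).re, Real.exp_pos _, ?_⟩
      have : l z = (l z).re + (Real.pi * I + n * (2 * Real.pi * I)) := by
        apply Complex.ext <;> simp [hn]
      rw [this, exp_add, exp_periodic.int_mul, exp_pi_mul_I, ofReal_exp]; simp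
  have hconst : ∀ z ∈ α, (l z).im = (l z₀).im := by
    intro z hz
    have hpre : IsPreconnected α := isPreconnected_Ioo.image _ (cc_cont r).continuousOn
    have hcont : ContinuousOn (fun z => (((l z).im - Real.pi : ℝ) : ℂ) * I) α :=
      (continuous_ofReal.comp_continuousOn (((continuous_im.comp_continuousOn
        (hlU.continuousOn.mono hαU))).sub continuousOn_const)).mul continuousOn_const
    have := exp_const hpre hcont (fun z hz => by
      obtain ⟨n, hn⟩ := (him z (hαU hz)).1 hz
      rw [hn, exp_eq_one_iff]; exact ⟨n, by push_cast; ring⟩) hz hz0α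
    have := congrArg Complex.im this
    simpa using this
  have hset : ∀ z ∈ U, (l z).im = (l z₀).im → z ∈ α := by
    intro z hz he
    rw [him z hz, he]; exact (him z₀ (hαU hz0α)).1 hz0α
  have hopen : ∀ s : Set ℝ, IsOpen s → IsOpen {z ∈ U | (l z).im ∈ s} := fun s hs =>
    (continuous_im.comp_continuousOn hlU.continuousOn).isOpen_inter_preimage h.Uo hs
  have hmap : 𝓝 (l z₀) ≤ map l (𝓝 z₀) := by
    refine (hlU.analyticAt (h.Uo.mem_nhds (hαU hz0α))).eventually_constant_or_nhds_le_map_nhds.resolve_left ?_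
    intro hev
    have hn0 : ‖z₀‖ = r := cc_norm hr.le _
    obtain ⟨z, hz, hz'⟩ := off_sphere (z₀ := z₀) (by rw [← norm_pos_iff, hn0]; exact hr)
      (hev.and (h.Uo.mem_nhds (hαU hz0α)))
    obtain ⟨θ, -, hθ⟩ := hset z hz.2 (by rw [hz.1])
    exact hz' (by rw [← hθ, cc_norm hr.le, hn0])
  have hfind : ∀ σ : ℝ, ∀ s : Set ℝ, (∀ t > 0, (l z₀).im + σ * t ∈ s) → ∃ z ∈ U, (l z).im ∈ s := by
    intro σ s hs
    have hmem : l '' U ∈ 𝓝 (l z₀) := hmap (image_mem_map (h.Uo.mem_nhds (hαU hz0α)))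
    have ht : Tendsto (fun t : ℝ => l z₀ + (σ * t : ℝ) * I) (𝓝[>] 0) (𝓝 (l z₀)) := by
      have : Continuous fun t : ℝ => l z₀ + (σ * t : ℝ) * I := by fun_prop
      have h := this.tendsto 0
      simp only [mul_zero, ofReal_zero, zero_mul, add_zero] at h
      exact h.mono_left nhdsWithin_le_nhds
    obtain ⟨t, ⟨z, hz, hzt⟩, h2⟩ := ((ht.eventually hmem).and self_mem_nhdsWithin).exists
    exact ⟨z, hz, by rw [hzt]; simpa using hs t h2⟩
  refine ⟨fun t => {z ∈ U | (l z).im ∈ (if t then Ioi (l z₀).im else Iio (l z₀).im)}, fun t => ?_, fun t => ?_,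
    fun t z hz => hz.1, fun t => ?_, fun t => ?_, fun t z hz hzα => ?_⟩
  · exact hopen _ (by cases t <;> simp [isOpen_Ioi, isOpen_Iio])
  · obtain ⟨z, h1, h2⟩ := hfind (if t then 1 else -1) (if t then Ioi (l z₀).im else Iio (l z₀).im)
      (fun x hx => by cases t <;> simp <;> linarith)
    exact ⟨z, h1, h2⟩
  · refine Set.disjoint_left.2 fun z hz hz' => ?_
    cases t <;> simp at hz hz' <;> linarith
  · refine Set.disjoint_left.2 fun z hz hz' => ?_
    have := hconst z hz'
    cases t <;> simp at hz <;> linarith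
  · have : (l z).im ≠ (l z₀).im := fun he => hzα (hset z hz he)
    rcases lt_or_gt_of_ne this with h5 | h5 <;> cases t <;> simp [hz, h5]
end

section
variable {δ : ℝ} {U : Set ℂ} {F : Bool → Set ℂ} {G f : ℂ → ℂ}

lemma ev_contra {q : ℂ} {U Y Y' : Set ℂ} (hY : Y' ⊆ U) (hd : Disjoint Y' Y)
    (h1 : ∀ᶠ z in 𝓝 q, z ∈ U → z ∈ Y) (h2 : q ∈ closure Y') : False := by
  obtain ⟨z, hz, hz'⟩ := mem_closure_iff_nhds.1 h2 _ h1
  exact Set.disjoint_left.1 hd hz' (hz (hY hz'))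

theorem Sol.exists_cut (h : Sol δ U F G f) {r : ℝ} (hr2 : 2 * δ ≤ r) (hr1 : r ≤ 1 / 2) :
    ∃ p σ α Ui Uo, Cut δ r U F G p σ α Ui Uo := by
  have hδ := h.hδ
  have hr : 0 < r := by linarith
  obtain ⟨i, a, b, hab, hpa, hpb, hU⟩ := h.exists_arc (s := r) (by linarith) (by linarith)
  have hb : b < a + 2 * Real.pi := by
    by_contra hb
    have hper : cc r (a + 2 * Real.pi) = cc r a := by simpa using cc_per r a 1
    rcases (not_lt.1 hb).lt_or_eq with h1 | h1
    · have := hU _ ⟨by linarith [Real.pi_pos], h1⟩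
      rw [hper] at this; exact h.FnotU hpa this
    · rw [← h1, hper] at hpb; exact Set.disjoint_left.1 (h.FF i) hpa hpb
  obtain ⟨Y, Yo, Yn, YU, Yd, Yα, Yc⟩ := h.split hr hab hb hpa hpb hU
  set α := cc r '' Ioo a b with hα
  set p : Bool → ℂ := fun j => if j = i then cc r a else cc r b with hp
  have hαU : α ⊆ U := by rintro _ ⟨θ, hθ, rfl⟩; exact hU θ hθ
  have hpF : ∀ j, p j ∈ F j := by
    intro j; by_cases hj : j = i
    · simp [hp, hj, hpa]
    · simp only [hp, hj, if_false]; rw [bool_ne hj]; exact hpb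
  have hpr : ∀ j, ‖p j‖ = r := by
    intro j; simp only [hp]; split_ifs <;> exact cc_norm hr.le _
  have hIcc : cc r '' Icc a b = α ∪ range p := by
    ext z; constructor
    · rintro ⟨θ, hθ, rfl⟩
      rcases hθ.1.eq_or_lt with h1 | h1
      · exact Or.inr ⟨i, by simp [hp, ← h1]⟩
      · rcases hθ.2.eq_or_lt with h2 | h2
        · exact Or.inr ⟨!i, by simp [hp, h2]⟩
        · exact Or.inl ⟨θ, ⟨h1, h2⟩, rfl⟩
    · rintro (⟨θ, hθ, rfl⟩ | ⟨j, rfl⟩)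
      · exact ⟨θ, Ioo_subset_Icc_self hθ, rfl⟩
      · simp only [hp]; split_ifs
        · exact ⟨a, left_mem_Icc.2 hab.le, rfl⟩
        · exact ⟨b, right_mem_Icc.2 hab.le, rfl⟩
  have hαcl : IsClosed (α ∪ range p) := by
    rw [← hIcc]; exact (isCompact_Icc.image (cc_cont r)).isClosed
  have hαr : ∀ z ∈ α, ‖z‖ = r := by rintro _ ⟨θ, -, rfl⟩; exact cc_norm hr.le _
  have hFp : ∀ j, ∀ q ∈ F j, q ≠ p j → q ∉ α ∪ range p := by
    rintro j q hq hne (h1 | ⟨k, rfl⟩)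
    · exact h.FnotU hq (hαU h1)
    · have : k ≠ j := fun h => hne (by rw [h])
      rw [bool_ne this] at hq
      exact Set.disjoint_left.1 (h.FF j) hq (hpF _)
  have hV : IsOpen (α ∪ range p)ᶜ := hαcl.isOpen_compl
  have hYV : ∀ t, (U ∩ (α ∪ range p)ᶜ) \ Y t = Y !t := by
    intro t; ext z
    constructor
    · rintro ⟨⟨h1, h2⟩, h3⟩
      exact (Yc t z h1 (fun h => h2 (Or.inl h))).resolve_left h3
    · intro h1
      refine ⟨⟨YU _ h1, ?_⟩, fun h2 => Set.disjoint_left.1 (Yd t) h2 h1⟩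
      rintro (h2 | ⟨k, rfl⟩)
      · exact Set.disjoint_left.1 (Yα _) h1 h2
      · exact h.FnotU (hpF k) (YU _ h1)
  have hYo' : ∀ t, IsOpen ((U ∩ (α ∪ range p)ᶜ) \ Y t) := fun t => by rw [hYV]; exact Yo _
  have hFre : ∀ j, ∀ q ∈ F j, q ≠ p j → (G q).re - (G (p j)).re ≠ 0 := fun j q hq hne he =>
    hne (h.Finj hq (hpF j) (by linarith))
  have key : ∀ j, ∀ τ : ℝ, ∃ t, ∀ q ∈ F j, 0 < τ * ((G q).re - (G (p j)).re) →
      ∀ᶠ z in 𝓝 q, z ∈ U → z ∈ Y t := by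
    intro j τ
    by_cases hex : ∃ q ∈ F j, 0 < τ * ((G q).re - (G (p j)).re)
    · obtain ⟨q, hq, hq'⟩ := hex
      have hne : ∀ q, 0 < τ * ((G q).re - (G (p j)).re) → q ≠ p j := by
        rintro q h1 rfl; simp at h1
      have ht : ∃ t, ∀ᶠ z in 𝓝 q, z ∈ U → z ∈ Y t := by
        have hqV := hFp j q hq (hne q hq')
        rcases h.side hV (Yo true) (hYo' true) hq hqV with h1 | h1
        · exact ⟨true, h1⟩
        · refine ⟨false, ?_⟩
          filter_upwards [h1, hV.mem_nhds hqV] with z hz hzV hzU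
          have : z ∈ (U ∩ (α ∪ range p)ᶜ) \ Y true := ⟨⟨hzU, hzV⟩, hz hzU⟩
          rw [hYV] at this; exact this
      obtain ⟨t, ht⟩ := ht
      refine ⟨t, fun x hx hx' => ?_⟩
      exact h.sideConst hV (Yo t) (hYo' t) (h.Fseg j (ordC τ (τ * (G (p j)).re))) (fun y hy => hy.1)
        (fun y hy => hFp j y hy.1 (hne y (by have : τ * (G (p j)).re < τ * (G y).re := hy.2; linarith)))
        (show q ∈ _ from ⟨hq, by rw [mem_ofPred_eq]; linarith⟩) (show x ∈ _ from ⟨hx, by rw [mem_ofPred_eq]; linarith⟩) ht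
    · exact ⟨true, fun q hq hq' => (hex ⟨q, hq, hq'⟩).elim⟩
  choose σ hσ hin hout using fun j => h.ends (hpF j)
  choose d hd hd' using hin
  choose e he he' using hout
  choose o ho using fun j => key j (σ j)
  choose t ht' using fun j => key j (-σ j)
  have ht : ∀ j, ∀ q ∈ F j, σ j * ((G q).re - (G (p j)).re) < 0 → ∀ᶠ z in 𝓝 q, z ∈ U → z ∈ Y (t j) :=
    fun j q hq hq' => ht' j q hq (by linarith)
  clear ht' key
  have hdl : ∃ d' > δ, d' ≤ r ∧ ∀ j, ∀ q ∈ F j, ‖q‖ < d' → σ j * ((G q).re - (G (p j)).re) < 0 := by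
    refine ⟨min (min (d true) (d false)) r, lt_min (lt_min (hd _) (hd _)) (by linarith), min_le_right _ _, ?_⟩
    intro j q hq hlt
    by_contra hc
    have h1 := hd' j q hq (not_lt.1 hc)
    have h2 : ‖q‖ < d j := hlt.trans_le ((min_le_left _ _).trans (by cases j; exacts [min_le_right _ _, min_le_left _ _]))
    linarith
  have hel : ∃ e' < 1, r ≤ e' ∧ ∀ j, ∀ q ∈ F j, e' < ‖q‖ → 0 < σ j * ((G q).re - (G (p j)).re) := by
    refine ⟨max (max (e true) (e false)) r, max_lt (max_lt (he _) (he _)) (by linarith), le_max_right _ _, ?_⟩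
    intro j q hq hlt
    by_contra hc
    have h1 := he' j q hq (not_lt.1 hc)
    have h2 : e j < ‖q‖ := lt_of_le_of_lt (le_trans (by cases j; exacts [le_max_right _ _, le_max_left _ _]) (le_max_left _ _)) hlt
    linarith
  obtain ⟨d', hdd, hdr, hdt⟩ := hdl
  obtain ⟨e', hee, her, heo⟩ := hel
  have hnα : ∀ z, ‖z‖ ≠ r → z ∉ α := fun z hz h => hz (hαr z h)
  have hcirc : ∀ s, δ < s → s < 1 → s ≠ r → ∀ x : Bool → Bool,
      (∀ j, ∀ q ∈ F j, ‖q‖ = s → ∀ᶠ z in 𝓝 q, z ∈ U → z ∈ Y (x j)) → x true = x false := by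
    intro s h1 h2 h3 x hx
    have hs0 : 0 ≤ s := by linarith
    by_contra hne
    refine h.circle h1 h2 {θ | cc s θ ∈ Y (x true)} ?_ ?_ ?_
    · have : cc s (2 * Real.pi) = cc s 0 := by simpa using cc_per s 0 1
      simp only [mem_ofPred_eq, this]
    · intro θ hθ
      rcases Yc (x true) _ hθ (hnα _ (by rw [cc_norm hs0]; exact h3)) with h4 | h4
      · filter_upwards [(cc_cont s).continuousAt.preimage_mem_nhds ((Yo _).mem_nhds h4)] with θ' hθ'
        exact ⟨fun _ => h4, fun _ => hθ'⟩
      · filter_upwards [(cc_cont s).continuousAt.preimage_mem_nhds ((Yo _).mem_nhds h4)] with θ' hθ'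
        exact ⟨fun h => (Set.disjoint_left.1 (Yd _) h hθ').elim, fun h => (Set.disjoint_left.1 (Yd _) h h4).elim⟩
    · intro j θ hθ
      filter_upwards [(cc_cont s).continuousAt.eventually (hx j _ hθ (cc_norm hs0 _))] with θ' hθ' hU'
      have h5 := hθ' hU'
      cases j
      · simp only [mem_ofPred_eq, Bool.false_eq_true, iff_false]
        intro h6; rw [bool_ne hne] at h6
        exact Set.disjoint_left.1 (Yd _) h5 h6
      · simpa using h5
  have hemp : ∀ s, δ < s → s < 1 → s ≠ r → ∀ x : Bool,
      (∀ j, ∀ q ∈ F j, ‖q‖ = s → ∀ᶠ z in 𝓝 q, z ∈ U → z ∈ Y x) → ∀ z ∈ Y (!x), ‖z‖ ≠ s := by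
    intro s h1 h2 h3 x hx z hz
    refine h.circ_empty (YU _) h1 h2 (fun y hy hfr => ?_) hz
    have hcl := frontier_subset_closure hfr
    have hyΩ : y ∈ ann δ 1 := ⟨by rw [hy]; exact h1, by rw [hy]; exact h2⟩
    have hdd : Disjoint (Y !x) (Y x) := by simpa using Yd (!x)
    rcases h.clU y hyΩ (closure_mono (YU _) hcl) with h4 | ⟨j, hj⟩
    · rcases Yc x y h4 (hnα y (by rw [hy]; exact h3)) with h5 | h5
      · exact ev_contra (YU _) hdd (((Yo x).eventually_mem h5).mono fun z hz _ => hz) hcl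
      · rw [(Yo _).frontier_eq] at hfr; exact hfr.2 h5
    · exact ev_contra (YU _) hdd (hx j y hj hy) hcl
  have htt : t true = t false := by
    refine hcirc ((δ + d') / 2) (by linarith) (by linarith) (by linarith) t fun j q hq hs => ?_
    exact ht j q hq (hdt j q hq (by linarith))
  have hoo : o true = o false := by
    refine hcirc ((1 + e') / 2) (by linarith) (by linarith) (by linarith) o fun j q hq hs => ?_
    exact ho j q hq (heo j q hq (by linarith))
  have hto : t true = !(o true) := by
    apply bool_ne
    intro heq
    obtain ⟨z, hz⟩ := Yn (!(o true))
    have hzr : ∀ z ∈ Y (!(o true)), ‖z‖ = r := by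
      intro z hz
      by_contra hne
      refine hemp ‖z‖ (h.UΩ (YU _ hz)).1 (h.UΩ (YU _ hz)).2 hne (o true) (fun j q hq hs => ?_) z hz rfl
      have hqp : q ≠ p j := by rintro rfl; exact hne (by rw [← hs, hpr])
      have hj1 : o j = o true := by cases j; exacts [hoo.symm, rfl]
      have hj2 : t j = o true := by cases j; exacts [htt.symm.trans heq, heq]
      have h0 : σ j * ((G q).re - (G (p j)).re) ≠ 0 := mul_ne_zero (by rcases hσ j with h | h <;> rw [h] <;> norm_num) (hFre j q hq hqp)
      rcases lt_or_gt_of_ne h0 with h1 | h1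
      · rw [← hj2]; exact ht j q hq h1
      · rw [← hj1]; exact ho j q hq h1
    obtain ⟨z', hz', hne⟩ := off_sphere (z₀ := z) (by rw [← norm_pos_iff, hzr z hz]; exact hr) ((Yo _).mem_nhds hz)
    exact hne (by rw [hzr z hz, hzr z' hz'])
  have ho' : ∀ j, ∀ q ∈ F j, 0 < σ j * ((G q).re - (G (p j)).re) → ∀ᶠ z in 𝓝 q, z ∈ U → z ∈ Y (o true) := by
    intro j; have : o j = o true := by cases j; exacts [hoo.symm, rfl]
    rw [← this]; exact ho j
  have ht' : ∀ j, ∀ q ∈ F j, σ j * ((G q).re - (G (p j)).re) < 0 → ∀ᶠ z in 𝓝 q, z ∈ U → z ∈ Y (!(o true)) := by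
    intro j; have : t j = !(o true) := by cases j; exacts [htt.symm.trans hto, hto]
    rw [← this]; exact ht j
  refine ⟨p, σ, α, Y (!(o true)), Y (o true), hpF, hpr, hαU, hαr, closure_minimal subset_union_left hαcl,
    Yo _, Yo _, YU _, YU _, (Yd _).symm, Yα _, Yα _, ?_, hσ, ho', ht', ?_, ?_, ?_⟩
  · intro z hz
    by_cases h1 : z ∈ α
    · exact Or.inr (Or.inr h1)
    · rcases Yc (o true) z hz h1 with h2 | h2
      · exact Or.inr (Or.inl h2)
      · exact Or.inl h2
  · refine ⟨d', hdd, fun z hz => ?_, fun j q hq hq' => ?_⟩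
    · by_contra hlt
      refine hemp ‖z‖ (h.UΩ (YU _ hz)).1 (h.UΩ (YU _ hz)).2 (by linarith) (!(o true)) (fun j q hq hs => ?_) z (by simpa using hz) rfl
      exact ht' j q hq (hdt j q hq (by linarith))
    · by_contra hlt
      linarith [hdt j q hq (by linarith)]
  · refine ⟨e', hee, fun z hz => ?_, fun j q hq hq' => ?_⟩
    · by_contra hlt
      refine hemp ‖z‖ (h.UΩ (YU _ hz)).1 (h.UΩ (YU _ hz)).2 (by linarith) (o true) (fun j q hq hs => ?_) z hz rfl
      exact ho' j q hq (heo j q hq (by linarith))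
    · by_contra hlt
      linarith [heo j q hq (by linarith)]
  · rw [← hIcc]
    have hXc : ContinuousOn (fun θ => G (cc r θ)) (Icc a b) := by
      refine h.Gc.comp (cc_cont r).continuousOn fun θ hθ => ?_
      have : cc r θ ∈ α ∪ range p := by rw [← hIcc]; exact ⟨θ, hθ, rfl⟩
      rcases this with h1 | ⟨j, h1⟩
      · exact Or.inl (hαU h1)
      · rw [← h1]; exact Sol.FX j (hpF j)
    have hM : (0:ℝ) ≤ MM := by linarith [MM_ge]
    have hlip : LipschitzOnWith ⟨MM * r, by positivity⟩ (fun θ => G (cc r θ)) (Ioo a b) := by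
      refine Convex.lipschitzOnWith_of_nnnorm_hasDerivWithin_le (𝕜 := ℝ) (f' := fun θ => f (cc r θ) * (cc r θ * I)) (convex_Ioo a b) (fun θ hθ => ?_) (fun θ hθ => ?_)
      · exact ((h.der _ (hU θ hθ)).comp θ (cc_hd r θ)).hasDerivWithinAt
      · change ‖f (cc r θ) * (cc r θ * I)‖ ≤ MM * r
        rw [norm_mul, norm_mul, norm_I, mul_one, cc_norm hr.le]
        have := h.lip (hU θ hθ) (by rw [cc_norm hr.le]; exact hr2) (by rw [cc_norm hr.le]; exact hr1)
        exact mul_le_mul_of_nonneg_right this hr.le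
    have hlip' := hlip.closure (by rw [closure_Ioo hab.ne]; exact hXc)
    rw [closure_Ioo hab.ne] at hlip'
    rintro _ ⟨x, hx, rfl⟩ _ ⟨y, hy, rfl⟩
    have := hlip'.dist_le_mul x hx y hy
    rw [dist_eq_norm, Real.dist_eq] at this
    refine this.trans ?_
    have h3 : |x - y| ≤ 2 * Real.pi := by rw [abs_le]; constructor <;> linarith [hx.1, hx.2, hy.1, hy.2]
    calc MM * r * |x - y| ≤ MM * r * (2 * Real.pi) := by gcongr
      _ = _ := by ring
end

section
variable {δ r : ℝ} {U : Set ℂ} {F : Bool → Set ℂ} {G f : ℂ → ℂ} {p : Bool → ℂ} {σ : Bool → ℝ}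
  {α Ui Uo : Set ℂ}

lemma Sol.norm_cut (h : Sol δ U F G f) (hC : Cut δ r U F G p σ α Ui Uo) :
    ∃ G', Sol δ U F G' f ∧ Cut δ r U F G' p σ α Ui Uo ∧ G' (p true) = 0 := by
  refine ⟨fun z => G z - ((G (p true)).re : ℝ), { h with der := ?_, pos := ?_, Gc := ?_, Gr := ?_ },
    { hC with out := ?_, tail := ?_, inn := ?_, outr := ?_, Gb := ?_ }, ?_⟩
  · intro z hz; exact (h.der z hz).sub_const _
  · intro z hz; simpa using h.pos z hz
  · exact h.Gc.sub continuousOn_const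
  · intro i z hz; simpa using h.Gr i z hz
  · simpa using hC.out
  · simpa using hC.tail
  · simpa using hC.inn
  · simpa using hC.outr
  · simpa using hC.Gb
  · simp only; rw [← h.Gre (hC.pF true)]; simp

lemma Sol.openmap (h : Sol δ U F G f) {z : ℂ} (hz : z ∈ U) : 𝓝 (G z) ≤ map G (𝓝 z) := by
  have hGd : DifferentiableOn ℂ G U := fun z hz => (h.der z hz).differentiableAt.differentiableWithinAt
  refine (hGd.analyticAt (h.Uo.mem_nhds hz)).eventually_constant_or_nhds_le_map_nhds.resolve_left fun hev => ?_
  set Y := {z ∈ U | ∀ᶠ y in 𝓝 z, f y = 0} with hY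
  have hzY : z ∈ Y := by
    refine ⟨hz, ?_⟩
    filter_upwards [hev.eventually_nhds, h.Uo.mem_nhds hz] with y hy hyU
    exact (h.der y hyU).unique ((hasDerivAt_const y (G z)).congr_of_eventuallyEq hy)
  have hYo : IsOpen Y := h.Uo.inter isOpen_setOfPred_eventually_nhds
  have hΩ := h.UΩ hz
  refine h.circ_empty (Y := Y) (fun z hz => hz.1) hΩ.1 hΩ.2 (fun y hy hfr => ?_) hzY rfl
  have hcl := frontier_subset_closure hfr
  rw [hYo.frontier_eq] at hfr
  have hyΩ : y ∈ ann δ 1 := ⟨by rw [hy]; exact hΩ.1, by rw [hy]; exact hΩ.2⟩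
  rcases h.clU y hyΩ (closure_mono (fun z hz => hz.1) hcl) with h1 | ⟨i, hi⟩
  · rcases (h.fd.analyticAt (h.Uo.mem_nhds h1)).eventually_eq_zero_or_eventually_ne_zero with h2 | h2
    · exact hfr.2 ⟨h1, h2⟩
    · rw [eventually_nhdsWithin_iff] at h2
      obtain ⟨x, hx, hxY⟩ := mem_closure_iff_nhds.1 hcl _ h2
      exact hx (fun hxy => hfr.2 (by rw [← show x = y from hxy]; exact hxY)) hxY.2.self_of_nhds
  · obtain ⟨L, hL, hT, -⟩ := h.loc i y hi
    have h3 : ∀ᶠ z in 𝓝[U] y, f z ≠ 0 := hT.eventually_ne (by rw [← norm_pos_iff, hL]; norm_num)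
    rw [eventually_nhdsWithin_iff] at h3
    obtain ⟨x, hx, hxY⟩ := mem_closure_iff_nhds.1 hcl _ h3
    exact hx hxY.1 hxY.2.self_of_nhds

lemma Cut.clI (h : Sol δ U F G f) (hC : Cut δ r U F G p σ α Ui Uo) {z : ℂ} (hz : z ∈ closure Ui)
    (hΩ : z ∈ ann δ 1) : z ∈ Ui ∨ z ∈ α ∨ ∃ j, z ∈ F j ∧ σ j * ((G z).re - (G (p j)).re) ≤ 0 := by
  rcases h.clU z hΩ (closure_mono hC.iU hz) with h1 | ⟨i, hi⟩
  · rcases hC.cov z h1 with h2 | h2 | h2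
    · exact Or.inl h2
    · exact (ev_contra hC.iU hC.dis ((hC.oo.eventually_mem h2).mono fun _ h _ => h) hz).elim
    · exact Or.inr (Or.inl h2)
  · refine Or.inr (Or.inr ⟨i, hi, ?_⟩)
    by_contra hc
    exact ev_contra hC.iU hC.dis (hC.out i z hi (not_le.1 hc)) hz

lemma Cut.clO (h : Sol δ U F G f) (hC : Cut δ r U F G p σ α Ui Uo) {z : ℂ} (hz : z ∈ closure Uo)
    (hΩ : z ∈ ann δ 1) : z ∈ Uo ∨ z ∈ α ∨ ∃ j, z ∈ F j ∧ 0 ≤ σ j * ((G z).re - (G (p j)).re) := by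
  rcases h.clU z hΩ (closure_mono hC.oU hz) with h1 | ⟨i, hi⟩
  · rcases hC.cov z h1 with h2 | h2 | h2
    · exact (ev_contra hC.oU hC.dis.symm ((hC.io.eventually_mem h2).mono fun _ h _ => h) hz).elim
    · exact Or.inl h2
    · exact Or.inr (Or.inl h2)
  · refine Or.inr (Or.inr ⟨i, hi, ?_⟩)
    by_contra hc
    exact ev_contra hC.oU hC.dis.symm (hC.tail i z hi (not_le.1 hc)) hz

lemma Cut.lipO (h : Sol δ U F G f) (hC : Cut δ r U F G p σ α Ui Uo) (hr2 : 2 * δ ≤ r) (hr : r ≤ 1 / 2)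
    {z : ℂ} (hz : z ∈ Uo) (hz2 : ‖z‖ ≤ 1 / 2) : ‖f z‖ ≤ MM := by
  have hδ := h.hδ
  rcases hz2.eq_or_lt with he | hlt
  · exact h.lip (hC.oU hz) (by rw [he]; linarith) hz2
  obtain ⟨δ', hδ', h1, h2⟩ := hC.inn
  have hDo : IsOpen (Uo ∩ ball 0 (1/2)) := hC.oo.inter isOpen_ball
  refine maxLim hDo (isBounded_ball.subset inter_subset_right)
    (h.fd.mono (inter_subset_left.trans hC.oU)) (fun ζ hζ η hη => ?_) z ⟨hz, by simpa using hlt⟩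
  have hcl := frontier_subset_closure hζ
  rw [hDo.frontier_eq] at hζ
  have hc1 : ζ ∈ closure Uo := closure_mono inter_subset_left hcl
  have hn1 : δ' ≤ ‖ζ‖ := closure_minimal (t := {z : ℂ | δ' ≤ ‖z‖}) h1 (isClosed_le continuous_const continuous_norm) hc1
  have hn2 : ‖ζ‖ ≤ 1 / 2 := by
    have := closure_mono (inter_subset_right.trans ball_subset_closedBall) hcl
    rw [isClosed_closedBall.closure_eq] at this; simpa using this
  have hU : ∀ x ∈ U, ‖f x‖ ≤ MM → ∀ᶠ z in 𝓝[Uo ∩ ball 0 (1/2)] x, ‖f z‖ ≤ MM + η := fun x hx hb => by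
    have := (h.fd.differentiableAt (h.Uo.mem_nhds hx)).continuousAt.norm
    exact (this.eventually_lt_const (by linarith : ‖f x‖ < MM + η)).filter_mono nhdsWithin_le_nhds |>.mono fun _ h => h.le
  rcases hC.clO h hc1 ⟨by linarith, by linarith⟩ with h3 | h3 | ⟨j, h3, -⟩
  · have : ‖ζ‖ = 1 / 2 := le_antisymm hn2 (by
      by_contra hc; exact hζ.2 ⟨h3, by simpa using hc⟩)
    exact hU ζ (hC.oU h3) (h.lip (hC.oU h3) (by rw [this]; linarith) hn2)
  · exact hU ζ (hC.αU h3) (h.lip (hC.αU h3) (by rw [hC.αr ζ h3]; linarith) hn2)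
  · obtain ⟨L, hL, hT, -⟩ := h.loc j ζ h3
    have := hT.norm.mono_left (nhdsWithin_mono ζ (inter_subset_left.trans hC.oU : Uo ∩ ball 0 (1/2) ⊆ U))
    rw [hL] at this
    exact (this.eventually_lt_const (by linarith [MM_ge] : 1 < MM + η)).mono fun _ h => h.le

lemma Cut.G0 (hC : Cut δ r U F G p σ α Ui Uo) (h0 : G (p true) = 0) {z : ℂ} (hz : z ∈ α ∪ range p) :
    ‖G z‖ ≤ 2 * Real.pi * MM * r := by
  simpa [h0] using hC.Gb z hz (p true) (Or.inr ⟨true, rfl⟩)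

lemma Cut.GF (h : Sol δ U F G f) (hC : Cut δ r U F G p σ α Ui Uo) (h0 : G (p true) = 0) {i : Bool} {q : ℂ}
    (hq : q ∈ F i) : ‖q‖ ≤ |(G q).re| + (1 + 2 * Real.pi * MM) * r := by
  obtain ⟨J, γ, hS, hpar, hlip⟩ := h.param i
  have h1 := hlip _ (hpar q hq).1 _ (hpar _ (hC.pF i)).1
  rw [(hpar q hq).2, (hpar _ (hC.pF i)).2] at h1
  have h2 := hC.G0 h0 (z := p i) (Or.inr ⟨i, rfl⟩)
  have h3 := norm_sub_norm_le q (p i)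
  rw [hC.pr] at h3
  have h4 := abs_sub (G q).re (G (p i)).re
  have h5 := abs_re_le_norm (G (p i))
  linarith

noncomputable def BB : ℝ := 4 * Real.pi / (1/32) * Real.exp (4 * Real.pi / (1/32))
noncomputable def KK : ℝ := 5 * (1 + 2 * Real.pi * MM)

lemma BB_pos : 0 < BB := by unfold BB; positivity
lemma KK_ge : 5 ≤ KK := by
  unfold KK; have := MM_ge; have := mul_pos Real.pi_pos (by linarith : 0 < MM); linarith

lemma Sol.lipq (h : Sol δ U F G f) {w : ℂ} (hw : w ∈ U) (h2 : 2 * δ ≤ ‖w‖) (h3 : ‖w‖ ≤ 1 / 2)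
    (hd : infDist w (⋃ i, F i) ≤ 1/32 * ‖w‖) : ∃ i, ∃ q ∈ F i, ‖w - q‖ ≤ 1/32 * ‖w‖ ∧ ‖G w - G q‖ ≤ 1/4 * ‖w‖ := by
  have hδ := h.hδ
  set d := infDist w (⋃ i, F i) with hdd
  obtain ⟨i, q, hq, hd0, hdq, hb, -, -⟩ := h.near hw (ann_ball rfl (by linarith) (by linarith))
  rw [dist_eq_norm] at hdq
  refine ⟨i, q, hq, by rw [hdq]; exact hd, ?_⟩
  have hy : ∀ t ∈ Ico (0:ℝ) 1, w + t * (q - w) ∈ ball w d := by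
    intro t ht
    rw [mem_ball, dist_eq_norm, add_sub_cancel_left, norm_mul, norm_sub_rev, hdq, norm_real, Real.norm_of_nonneg ht.1]
    nlinarith [ht.2]
  have hder : ∀ t : ℝ, HasDerivAt (fun t : ℝ => w + t * (q - w)) (q - w) t := fun t => by
    simpa using ((hasDerivAt_id t).ofReal_comp.mul_const (q - w)).const_add w
  have := norm_image_sub_le_of_norm_deriv_right_le_segment (f := fun t : ℝ => G (w + t * (q - w)))
    (f' := fun t : ℝ => f (w + t * (q - w)) * (q - w)) (C := 8 * d) (a := 0) (b := 1) ?_ ?_ ?_ 1 (right_mem_Icc.2 zero_le_one)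
  · simp only [ofReal_one, one_mul, add_sub_cancel, ofReal_zero, zero_mul, add_zero, sub_zero, mul_one] at this
    rw [norm_sub_rev]; linarith
  · refine h.Gc.comp (Continuous.continuousOn (by fun_prop)) fun t ht => ?_
    rcases ht.2.eq_or_lt with h5 | h5
    · rw [h5]; simpa using Sol.FX (U := U) i hq
    · exact Or.inl (hb (hy t ⟨ht.1, h5⟩))
  · exact fun t ht => ((h.der _ (hb (hy t ht))).comp t (hder t)).hasDerivWithinAt
  · intro t ht
    have hyb := hy t ht
    set y := w + t * (q - w) with hyd
    have hyU := hb hyb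
    have hyd' : ‖y - q‖ ≤ d := by
      have : y - q = ((1 - t : ℝ) : ℂ) * (w - q) := by rw [hyd]; push_cast; ring
      rw [this, norm_mul, hdq, norm_real, Real.norm_of_nonneg (by linarith [ht.2])]
      nlinarith [ht.1]
    have hyi : infDist y (⋃ i, F i) ≤ d := by
      refine (infDist_le_dist_of_mem (mem_iUnion.2 ⟨i, hq⟩)).trans ?_
      rw [dist_eq_norm]; exact hyd'
    rw [mem_ball, dist_eq_norm] at hyb
    have h6 := norm_sub_norm_le w y
    rw [norm_sub_rev] at h6
    have h7 := norm_sub_norm_le y w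
    obtain ⟨-, -, -, -, -, -, -, h8⟩ := h.near hyU (ann_ball rfl (by linarith) (by linarith))
    rw [norm_mul, norm_sub_rev, hdq]; gcongr

lemma Cut.Glow (h : Sol δ U F G f) (hC : Cut δ r U F G p σ α Ui Uo) (h0 : G (p true) = 0) (hr2 : 2 * δ ≤ r)
    {z : ℂ} (hz : z ∈ U ∪ ⋃ i, F i) (h1 : KK * r ≤ ‖z‖) (h2 : ‖z‖ ≤ 1 / 2) : ‖z‖ ≤ 2 * (1 + BB) * ‖G z‖ := by
  have hB := BB_pos
  have hδ := h.hδ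
  have hK := KK_ge
  have hKr : (1 + 2 * Real.pi * MM) * r ≤ 1 / 5 * ‖z‖ := by unfold KK at h1; linarith
  rcases hz with hz | hz
  · obtain ⟨w, hw, hws, hwd, -, hwG⟩ := h.travel hz (by nlinarith) h2 (κ := 1/32) (by norm_num) (by norm_num)
    rw [← hws] at hwd
    obtain ⟨i, q, hq, hq1, hq2⟩ := h.lipq hw (by rw [hws]; nlinarith) (by rw [hws]; exact h2) hwd
    rw [hws] at hq1 hq2
    have h3 := hC.GF h h0 hq
    have h4 := abs_re_le_norm (G q)
    have h5 := norm_sub_norm_le w q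
    have h6 := norm_sub_norm_le (G q) (G w)
    rw [norm_sub_rev] at h6
    have h7 := norm_sub_norm_le (G w) (G z)
    have h8 : (G z).im ≤ ‖G z‖ := im_le_norm _
    have h9 : BB * (G z).im ≤ BB * ‖G z‖ := by gcongr
    have h10 : ‖G w - G z‖ ≤ BB * (G z).im := hwG
    nlinarith
  · obtain ⟨i, hi⟩ := mem_iUnion.1 hz
    have h3 := hC.GF h h0 hi
    have h4 := abs_re_le_norm (G z)
    nlinarith [norm_nonneg (G z)]
end

section
variable {δ r : ℝ} {U : Set ℂ} {F : Bool → Set ℂ} {G f : ℂ → ℂ} {p : Bool → ℂ} {σ : Bool → ℝ}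
  {α Ui Uo : Set ℂ}

lemma Sol.up (h : Sol δ U F G f) {z : ℂ} (hz : z ∈ U ∪ ⋃ i, F i) {V : Set ℂ} (hV : V ∈ 𝓝 z) :
    ∃ y ∈ V ∩ U, (G y).re = (G z).re ∧ (G z).im < (G y).im := by
  have ht : Tendsto (fun t : ℝ => G z + t * I) (𝓝[>] 0) (𝓝 (G z)) := by
    have : Continuous fun t : ℝ => G z + t * I := by fun_prop
    have h := this.tendsto 0
    simp only [ofReal_zero, zero_mul, add_zero] at h
    exact h.mono_left nhdsWithin_le_nhds
  rcases hz with hz | hz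
  · have hm : G '' (V ∩ U) ∈ 𝓝 (G z) := h.openmap hz (image_mem_map (inter_mem hV (h.Uo.mem_nhds hz)))
    obtain ⟨t, ⟨y, hy, hyt⟩, ht0⟩ := ((ht.eventually hm).and self_mem_nhdsWithin).exists
    have ht0' : 0 < t := ht0
    exact ⟨y, hy, by rw [hyt]; simp, by rw [hyt]; simpa using ht0'⟩
  · obtain ⟨i, hi⟩ := mem_iUnion.1 hz
    obtain ⟨ρ, hρ, hb⟩ := Metric.mem_nhds_iff.1 hV
    obtain ⟨s, hs, hsw⟩ := h.surj hi hρ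
    obtain ⟨t, h1, ht0⟩ := ((ht.eventually (ball_mem_nhds _ hs)).and self_mem_nhdsWithin).exists
    have ht0' : 0 < t := ht0
    have h0 := h.Gr i z hi
    obtain ⟨y, hy, hyt⟩ := hsw (G z + t * I) (by simp [h0]; exact ht0'.le) (by rwa [dist_eq_norm] at h1)
    have hyi : (G y).im = (G z).im + t := by rw [hyt]; simp
    exact ⟨y, ⟨hb hy.2, h.XU hy.1 (by rw [hyi, h0]; linarith)⟩, by rw [hyt]; simp, by rw [hyi]; linarith⟩

lemma Sol.circ_meas (h : Sol δ U F G f) {s : ℝ} (h1 : 2 * δ ≤ s) (h2 : s ≤ 1 / 2) :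
    volume ((fun θ => (G (cc s θ)).re) '' {θ ∈ Icc 0 (2 * Real.pi) | cc s θ ∈ U ∪ ⋃ i, F i}) ≤
      ENNReal.ofReal (MM * s * (2 * Real.pi)) := by
  have hδ := h.hδ
  have hs0 : 0 < s := by linarith
  have hM := MM_ge
  set Θ := {θ ∈ Icc 0 (2 * Real.pi) | cc s θ ∈ U ∪ ⋃ i, F i} with hΘ
  have hmeas : MeasurableSet Θ := by
    have : Θ = Icc 0 (2 * Real.pi) ∩ (cc s ⁻¹' U ∪ ⋃ i, cc s ⁻¹' F i) := by
      ext θ; simp [hΘ]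
    rw [this]
    refine measurableSet_Icc.inter (MeasurableSet.union (h.Uo.preimage (cc_cont s)).measurableSet
      (MeasurableSet.iUnion fun i => (h.cF_closed (by linarith) (by linarith) i).measurableSet))
  have hex : ∀ θ ∈ Θ, ∃ D : ℂ, ‖D‖ ≤ MM * s ∧ HasDerivWithinAt (fun θ => G (cc s θ)) D Θ θ := by
    intro θ hθ
    rcases hθ.2 with hU | hF
    · refine ⟨f (cc s θ) * (cc s θ * I), ?_, ((h.der _ hU).comp θ (cc_hd s θ)).hasDerivWithinAt⟩
      rw [norm_mul, norm_mul, norm_I, mul_one, cc_norm hs0.le]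
      have := h.lip hU (by rw [cc_norm hs0.le]; exact h1) (by rw [cc_norm hs0.le]; exact h2)
      gcongr
    · obtain ⟨i, hi⟩ := mem_iUnion.1 hF
      obtain ⟨L, hL, -, hexp⟩ := h.exp1 hi
      refine ⟨L * (cc s θ * I), ?_, ?_⟩
      · rw [norm_mul, norm_mul, norm_I, mul_one, cc_norm hs0.le, hL]; nlinarith
      · have hGd : HasFDerivWithinAt G ((ContinuousLinearMap.toSpanSingleton ℂ L).restrictScalars ℝ) (U ∪ ⋃ i, F i) (cc s θ) := by
          rw [hasFDerivWithinAt_iff_isLittleO, Asymptotics.isLittleO_iff]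
          intro η hη
          obtain ⟨ρ, hρ, hb⟩ := hexp η hη
          filter_upwards [self_mem_nhdsWithin, nhdsWithin_le_nhds (ball_mem_nhds _ hρ)] with x hx hxb
          have := hb _ ⟨hθ.2, mem_ball_self hρ⟩ x ⟨hx, hxb⟩
          simpa [mul_comm] using this
        have := (hGd.comp_hasDerivWithinAt (f := cc s) (f' := cc s θ * I) θ (s := Θ) (cc_hd s θ).hasDerivWithinAt
          (fun x hx => hx.2))
        simpa [mul_comm, Function.comp_def] using this
  choose! D hD hDd using hex
  have hre : ∀ θ ∈ Θ, HasFDerivWithinAt (fun θ => (G (cc s θ)).re) (ContinuousLinearMap.toSpanSingleton ℝ (D θ).re) Θ θ := by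
    intro θ hθ
    exact (reCLM.hasFDerivAt.comp_hasDerivWithinAt θ (hDd θ hθ)).hasFDerivWithinAt
  refine (addHaar_image_le_lintegral_abs_det_fderiv volume hmeas hre).trans ?_
  calc ∫⁻ x in Θ, ENNReal.ofReal |(ContinuousLinearMap.toSpanSingleton ℝ (D x).re).det|
      ≤ ∫⁻ x in Θ, ENNReal.ofReal (MM * s) := by
        refine setLIntegral_mono' hmeas fun θ hθ => ENNReal.ofReal_le_ofReal ?_
        rw [ContinuousLinearMap.det_toSpanSingleton]
        exact (abs_re_le_norm _).trans (hD θ hθ)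
    _ = ENNReal.ofReal (MM * s) * volume Θ := by rw [setLIntegral_const]
    _ ≤ ENNReal.ofReal (MM * s) * volume (Icc 0 (2 * Real.pi)) := by gcongr; exact fun θ hθ => hθ.1
    _ = _ := by
        rw [Real.volume_Icc, sub_zero, ← ENNReal.ofReal_mul (by positivity)]

lemma Cut.tailR (h : Sol δ U F G f) (hC : Cut δ r U F G p σ α Ui Uo) {s : ℝ} (hrs : r < s) (hr2 : δ < r)
    {q : ℂ} (hq : q ∈ closure Ui) (hqs : s < ‖q‖) : ∃ z ∈ U ∪ ⋃ i, F i, ‖z‖ = s ∧ (G z).re = (G q).re := by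
  by_contra hcon
  push Not at hcon
  obtain ⟨s', hs', h1, h2⟩ := hC.outr
  have hcl : ∀ z ∈ closure Ui, ‖z‖ ≤ s' := fun z hz =>
    closure_minimal (t := {z : ℂ | ‖z‖ ≤ s'}) h1 (isClosed_le continuous_norm continuous_const) hz
  set K := closure Ui ∩ {z | s ≤ ‖z‖} with hK
  have hKc : IsCompact K := (isCompact_closedBall (0:ℂ) s').of_isClosed_subset
    (isClosed_closure.inter (isClosed_le continuous_const continuous_norm)) (fun z hz => by simpa using hcl z hz.1)
  have hKann : ∀ z ∈ K, z ∈ ann δ 1 := fun z hz => ⟨by have : s ≤ ‖z‖ := hz.2; linarith, by linarith [hcl z hz.1]⟩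
  have hKX : K ⊆ U ∪ ⋃ i, F i := fun z hz => h.clX (hKann z hz) (closure_mono hC.iU hz.1)
  have hGK := h.Gc.mono hKX
  set E := K ∩ (fun z => (G z).re) ⁻¹' {(G q).re} with hE
  have hEc : IsCompact E := by
    refine hKc.of_isClosed_subset ?_ inter_subset_left
    exact (continuous_re.comp_continuousOn hGK).preimage_isClosed_of_isClosed hKc.isClosed isClosed_singleton
  obtain ⟨z, hz, hmax⟩ := hEc.exists_isMaxOn ⟨q, ⟨hq, hqs.le⟩, rfl⟩
    (continuous_im.comp_continuousOn (hGK.mono inter_subset_left))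
  have hzs : s < ‖z‖ := lt_of_le_of_ne hz.1.2 (fun he => hcon z (hKX hz.1) he.symm hz.2)
  have hnear : ∀ᶠ y in 𝓝 z, y ∈ U → y ∈ Ui := by
    rcases hC.clI h hz.1.1 (hKann z hz.1) with h3 | h3 | ⟨j, h3, h4⟩
    · exact (hC.io.eventually_mem h3).mono fun _ h _ => h
    · linarith [hC.αr z h3]
    · rcases h4.lt_or_eq with h5 | h5
      · exact hC.tail j z h3 h5
      · exfalso
        have h6 : (G z).re - (G (p j)).re = 0 := by
          rcases mul_eq_zero.1 h5 with h6 | h6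
          · rcases hC.hσ j with h | h <;> rw [h] at h6 <;> norm_num at h6
          · exact h6
        have := h.Finj h3 (hC.pF j) (by linarith)
        rw [this, hC.pr] at hzs; linarith
  obtain ⟨y, ⟨⟨hy1, hy2⟩, hyU⟩, hyre, hyim⟩ := h.up (hKX hz.1) (hnear.and ((isOpen_lt continuous_const continuous_norm).eventually_mem hzs))
  have hyE : y ∈ E := ⟨⟨subset_closure (hy1 hyU), (show s < ‖y‖ from hy2).le⟩, by
    have : (G z).re = (G q).re := hz.2
    show (G y).re = (G q).re
    rw [hyre, this]⟩
  exact absurd (hmax hyE) (not_le.2 hyim)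

noncomputable def CI : ℝ := 2 + 4 * Real.pi * MM
lemma CI_ge : 2 ≤ CI := by
  unfold CI; have := mul_pos Real.pi_pos (by linarith [MM_ge] : 0 < MM); linarith

lemma Cut.tail_le (h : Sol δ U F G f) (hC : Cut δ r U F G p σ α Ui Uo) (hr2 : 2 * δ ≤ r) (hr : r ≤ 1 / 4)
    {j : Bool} {q : ℂ} (hq : q ∈ F j) (hqt : σ j * ((G q).re - (G (p j)).re) < 0) : ‖q‖ ≤ CI * r := by
  have hδ := h.hδ
  by_contra hlt
  push Not at hlt
  have hr0 : 0 < r := by linarith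
  have hq2 : 2 * r < ‖q‖ := by nlinarith [CI_ge]
  obtain ⟨J, γ, hS, hpar, hlip⟩ := h.param j
  set a := (G q).re with ha
  set b := (G (p j)).re with hb
  have hJ : uIcc a b ⊆ J := hS.c.ordConnected.uIcc_subset (hpar _ hq).1 (hpar _ (hC.pF j)).1
  have hTc : IsCompact (uIcc a b ∩ (fun t => ‖γ t‖) ⁻¹' Iic (2 * r)) := by
    refine isCompact_uIcc.of_isClosed_subset ?_ inter_subset_left
    exact (hS.k.mono hJ).norm.preimage_isClosed_of_isClosed isCompact_uIcc.isClosed isClosed_Iic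
  obtain ⟨t, ht, hmin⟩ := hTc.exists_isMinOn ⟨b, right_mem_uIcc, by
    show ‖γ b‖ ≤ 2 * r
    rw [(hpar _ (hC.pF j)).2, hC.pr]; linarith⟩ (f := fun t => |t - a|) (by fun_prop)
  have hlen : ‖q‖ - 2 * r ≤ |t - a| := by
    have h3 := hlip _ (hpar q hq).1 t (hJ ht.1)
    rw [(hpar q hq).2, abs_sub_comm] at h3
    have h4 := norm_sub_norm_le q (γ t)
    have h5 : ‖γ t‖ ≤ 2 * r := ht.2
    linarith
  have hσ : 0 < σ j ^ 2 := by rcases hC.hσ j with h | h <;> rw [h] <;> norm_num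
  have hsub : Ioo (min a t) (max a t) ⊆ (fun θ => (G (cc (2 * r) θ)).re) '' {θ ∈ Icc 0 (2 * Real.pi) | cc (2 * r) θ ∈ U ∪ ⋃ i, F i} := by
    intro x hx
    have hxu : x ∈ uIcc a t := Ioo_subset_Icc_self hx
    have hxJ : x ∈ uIcc a b := (uIcc_subset_uIcc left_mem_uIcc ht.1) hxu
    have hxa : |x - a| < |t - a| ∧ σ j * (x - b) < 0 := by
      have hab : a ≠ b := fun h => by rw [h] at hqt; simp at hqt
      rcases le_total a t with h6 | h6
      · rw [min_eq_left h6, max_eq_right h6] at hx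
        have hab' : a < b := by
          by_contra hc; rw [uIcc_of_ge (not_lt.1 hc)] at ht; linarith [ht.1.2, hx.1, hx.2]
        rw [uIcc_of_le hab'.le] at ht
        refine ⟨by rw [abs_of_pos (by linarith [hx.1]), abs_of_nonneg (by linarith)]; linarith [hx.2], ?_⟩
        have : 0 < σ j := by by_contra hc; nlinarith
        nlinarith [ht.1.2, hx.2]
      · rw [min_eq_right h6, max_eq_left h6] at hx
        have hab' : b < a := by
          by_contra hc; rw [uIcc_of_le (not_lt.1 hc)] at ht; linarith [ht.1.1, hx.1, hx.2]
        rw [uIcc_of_ge hab'.le] at ht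
        refine ⟨by rw [abs_of_neg (by linarith [hx.2]), abs_of_nonpos (by linarith)]; linarith [hx.1], ?_⟩
        have : σ j < 0 := by by_contra hc; nlinarith
        nlinarith [ht.1.1, hx.1]
    have hγF := hS.m x (hJ hxJ)
    have hγG : (G (γ x)).re = x := by rw [hS.s x (hJ hxJ), ofReal_re]
    have hγn : 2 * r < ‖γ x‖ := by
      by_contra hc
      exact absurd (hmin ⟨hxJ, not_lt.1 hc⟩) (not_le.2 hxa.1)
    have hcl : γ x ∈ closure Ui := by
      rw [mem_closure_iff_nhds]
      intro V hV
      obtain ⟨z, hz, hzU⟩ := mem_closure_iff_nhds.1 (h.Fcl j hγF) _ (inter_mem hV (hC.tail j _ hγF (by rw [hγG]; exact hxa.2)))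
      exact ⟨z, hz.1, hz.2 hzU⟩
    obtain ⟨z, hz, hzs, hzre⟩ := hC.tailR h (s := 2 * r) (by linarith) (by linarith) hcl hγn
    obtain ⟨φ, hφ⟩ := cc_surj z
    rw [hzs] at hφ
    refine ⟨toIcoMod Real.two_pi_pos 0 φ, ⟨?_, ?_⟩, ?_⟩
    · have := toIcoMod_mem_Ico Real.two_pi_pos 0 φ; rw [zero_add] at this; exact Ico_subset_Icc_self this
    all_goals
      have : cc (2 * r) (toIcoMod Real.two_pi_pos 0 φ) = z := by
        have h7 := toIcoMod_add_toIcoDiv_zsmul Real.two_pi_pos 0 φ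
        rw [zsmul_eq_mul] at h7
        rw [← hφ, ← h7, cc_per]
        simp
    · rw [this]; exact hz
    · simp only; rw [this, hzre, hγG]
  have hv := (measure_mono hsub).trans (h.circ_meas (s := 2 * r) (by linarith) (by linarith))
  rw [Real.volume_Ioo, max_sub_min_eq_abs, ENNReal.ofReal_le_ofReal_iff (by have := MM_ge; positivity)] at hv
  unfold CI at hlt
  linarith

lemma Cut.Ui_le (h : Sol δ U F G f) (hC : Cut δ r U F G p σ α Ui Uo) (hr2 : 2 * δ ≤ r) (hr : r ≤ 1 / 4)
    {z : ℂ} (hz : z ∈ Ui) : ‖z‖ ≤ CI * r := by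
  by_contra hlt
  push Not at hlt
  have hδ := h.hδ
  have hr' : r < ‖z‖ := by nlinarith [CI_ge]
  have hΩ := h.UΩ (hC.iU hz)
  refine h.circ_empty hC.iU hΩ.1 hΩ.2 (fun y hy hfr => ?_) hz rfl
  have hcl := frontier_subset_closure hfr
  rw [hC.io.frontier_eq] at hfr
  rcases hC.clI h hcl ⟨by rw [hy]; exact hΩ.1, by rw [hy]; exact hΩ.2⟩ with h1 | h1 | ⟨j, h1, h2⟩
  · exact hfr.2 h1
  · linarith [hC.αr y h1]
  · rcases h2.lt_or_eq with h5 | h5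
    · linarith [hC.tail_le h hr2 hr h1 h5]
    · have h6 : (G y).re - (G (p j)).re = 0 := by
        rcases mul_eq_zero.1 h5 with h6 | h6
        · rcases hC.hσ j with h | h <;> rw [h] at h6 <;> norm_num at h6
        · exact h6
      have := h.Finj h1 (hC.pF j) (by linarith)
      rw [this, hC.pr] at hy; linarith
end

section
variable {S H : Set ℂ} {G : ℂ → ℂ}

lemma fib_prop (hS : IsCompact S) (hG : ContinuousOn G S) {w : ℂ} {V : Set ℂ} (hV : IsOpen V)
    (h : ∀ z ∈ S, G z = w → z ∈ V) : ∀ᶠ w' in 𝓝 w, ∀ z ∈ S, G z = w' → z ∈ V := by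
  have hc : IsCompact (G '' (S \ V)) := (hS.diff hV).image_of_continuousOn (hG.mono sdiff_subset)
  have : w ∉ G '' (S \ V) := by rintro ⟨z, hz, rfl⟩; exact hz.2 (h z hz.1 rfl)
  filter_upwards [hc.isClosed.isOpen_compl.mem_nhds this] with w' hw' z hz he
  by_contra hzV
  exact hw' ⟨z, ⟨hz, hzV⟩, he⟩

lemma cover1 (hS : IsCompact S) (hG : ContinuousOn G S) (hH : IsPreconnected H)
    (ls : ∀ z ∈ S, G z ∈ H → ∀ V ∈ 𝓝 z, ∀ᶠ w in 𝓝[H] (G z), ∃ z' ∈ S ∩ V, G z' = w)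
    (hne : ∃ z ∈ S, G z ∈ H) : ∀ w ∈ H, ∃ z ∈ S, G z = w := by
  intro w hw
  obtain ⟨z, hz, hzH⟩ := hne
  refine (hH.induction₂ (fun a b => (∃ z ∈ S, G z = a) ↔ (∃ z ∈ S, G z = b)) ?_
    (fun x y z _ _ _ h1 h2 => h1.trans h2) (fun x y _ _ h => h.symm) hzH hw).1 ⟨z, hz, rfl⟩
  intro x hx
  by_cases hxe : ∃ z ∈ S, G z = x
  · obtain ⟨y, hy, rfl⟩ := hxe
    filter_upwards [ls y hy hx univ univ_mem] with w ⟨z', hz', he⟩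
    exact ⟨fun _ => ⟨z', hz'.1, he⟩, fun _ => ⟨y, hy, rfl⟩⟩
  · refine ((fib_prop hS hG isOpen_empty (fun z hz he => (hxe ⟨z, hz, he⟩).elim)).filter_mono
      nhdsWithin_le_nhds).mono fun w hw' => ⟨fun h => (hxe h).elim, fun ⟨z, hz, he⟩ => (hw' z hz he).elim⟩

lemma cover2 (hS : IsCompact S) (hG : ContinuousOn G S) (hH : IsPreconnected H)
    (ls : ∀ z ∈ S, G z ∈ H → ∀ V ∈ 𝓝 z, ∀ᶠ w in 𝓝[H] (G z), ∃ z' ∈ S ∩ V, G z' = w)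
    (dich : ∀ z ∈ S, G z ∈ H → (∃ V ∈ 𝓝 z, InjOn G (S ∩ V)) ∨ ∀ V ∈ 𝓝 z, ∀ᶠ w in 𝓝[H] (G z),
      w ≠ G z → ∃ z₁ ∈ S ∩ V, ∃ z₂ ∈ S ∩ V, z₁ ≠ z₂ ∧ G z₁ = w ∧ G z₂ = w)
    {z₀ : ℂ} (h0 : z₀ ∈ S) (h0H : G z₀ ∈ H) (h0u : ∀ z ∈ S, G z = G z₀ → z = z₀)
    (h0g : ∃ V ∈ 𝓝 z₀, InjOn G (S ∩ V)) :
    ∀ w ∈ H, ∃ z ∈ S, G z = w ∧ (∀ z' ∈ S, G z' = w → z' = z) ∧ ∃ V ∈ 𝓝 z, InjOn G (S ∩ V) := by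
  intro w hw
  have hex := cover1 hS hG hH ls ⟨z₀, h0, h0H⟩
  set P : ℂ → Prop := fun w => ∃ z ∈ S, G z = w ∧ (∀ z' ∈ S, G z' = w → z' = z) ∧
    ∃ V ∈ 𝓝 z, InjOn G (S ∩ V) with hP
  refine (hH.induction₂ (fun a b => P a ↔ P b) ?_ (fun x y z _ _ _ h1 h2 => h1.trans h2)
    (fun x y _ _ h => h.symm) h0H hw).1 ⟨z₀, h0, rfl, h0u, h0g⟩
  intro x hx
  by_cases hPx : P x
  · obtain ⟨y, hy, rfl, hyu, V, hV, hi⟩ := id hPx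
    obtain ⟨V', hV'V, hV'o, hyV'⟩ := _root_.mem_nhds_iff.1 hV
    filter_upwards [self_mem_nhdsWithin, (fib_prop hS hG hV'o
      (fun z hz he => by rw [hyu z hz he]; exact hyV')).filter_mono nhdsWithin_le_nhds] with w hwH hwV
    obtain ⟨z, hz, he⟩ := hex w hwH
    refine ⟨fun _ => ⟨z, hz, he, fun z' hz' he' => ?_, V, ?_, hi⟩, fun _ => hPx⟩
    · exact hi ⟨hz', hV'V (hwV z' hz' he')⟩ ⟨hz, hV'V (hwV z hz he)⟩ (he'.trans he.symm)
    · exact mem_of_superset (hV'o.mem_nhds (hwV z hz he)) hV'V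
  · suffices h : ∀ᶠ w in 𝓝[H] x, w ≠ x → ¬ P w by
      filter_upwards [h] with w hw'
      by_cases hwx : w = x
      · rw [hwx]
      · exact ⟨fun h => (hPx h).elim, fun h => (hw' hwx h).elim⟩
    obtain ⟨y, hy, rfl⟩ := hex x hx
    by_cases hyu : ∀ z' ∈ S, G z' = G y → z' = y
    · rcases dich y hy hx with hg | hb
      · exact (hPx ⟨y, hy, rfl, hyu, hg⟩).elim
      · filter_upwards [hb univ univ_mem] with w hw' hwx hPw
        obtain ⟨z, hz, he, hu, -⟩ := hPw
        obtain ⟨z₁, h1, z₂, h2, hne, e1, e2⟩ := hw' hwx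
        exact hne ((hu z₁ h1.1 e1).trans (hu z₂ h2.1 e2).symm)
    · push Not at hyu
      obtain ⟨y', hy', he', hne⟩ := hyu
      obtain ⟨A, B, hA, hB, hyA, hyB, hAB⟩ := t2_separation hne
      have h1 := ls y' hy' (by rw [he']; exact hx) A (hA.mem_nhds hyA)
      rw [he'] at h1
      filter_upwards [h1, ls y hy hx B (hB.mem_nhds hyB)] with w ⟨a, ha, hae⟩ ⟨b, hb, hbe⟩ _ hPw
      obtain ⟨z, hz, he, hu, -⟩ := hPw
      have := (hu a ha.1 hae).trans (hu b hb.1 hbe).symm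
      exact Set.disjoint_left.1 hAB ha.2 (this ▸ hb.2)

lemma two_pre {z₀ : ℂ} (hG : AnalyticAt ℂ G z₀) (hd : deriv G z₀ = 0) (hnc : ¬ ∀ᶠ z in 𝓝 z₀, G z = G z₀)
    {V : Set ℂ} (hV : V ∈ 𝓝 z₀) : ∀ᶠ w in 𝓝 (G z₀), w ≠ G z₀ →
      ∃ z₁ ∈ V, ∃ z₂ ∈ V, z₁ ≠ z₂ ∧ G z₁ = w ∧ G z₂ = w := by
  have hG1 : AnalyticAt ℂ (fun z => G z - G z₀) z₀ := hG.sub analyticAt_const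
  have hord : analyticOrderAt (fun z => G z - G z₀) z₀ ≠ ⊤ := fun h => hnc (by
    rw [analyticOrderAt_eq_top] at h
    exact h.mono fun z hz => sub_eq_zero.1 hz)
  obtain ⟨g, hga, hg0, hge⟩ := (hG1.analyticOrderAt_ne_top).1 hord
  set n := analyticOrderNatAt (fun z => G z - G z₀) z₀
  simp only [smul_eq_mul] at hge
  have hn : 2 ≤ n := by
    by_contra hc
    have hn1 : n = 0 ∨ n = 1 := by omega
    rcases hn1 with h0 | h1
    · have := hge.self_of_nhds
      simp [h0] at this; exact hg0 this.symm
    · rw [h1] at hge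
      have h2 : HasDerivAt (fun z => G z - G z₀) (g z₀) z₀ := by
        refine HasDerivAt.congr_of_eventuallyEq ?_ hge
        refine ((((hasDerivAt_id z₀).sub_const z₀).pow 1).mul hga.differentiableAt.hasDerivAt).congr_deriv ?_
        simp
      have h3 := (hG.differentiableAt.hasDerivAt.sub_const (G z₀)).unique h2
      exact hg0 (h3 ▸ hd)
  set φ : ℂ → ℂ := fun z => (z - z₀) * exp (log (g z / g z₀) / n) with hφ
  have hn0 : (n : ℂ) ≠ 0 := by exact_mod_cast (by omega : n ≠ 0)
  have hφa : AnalyticAt ℂ φ z₀ := by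
    refine (analyticAt_id.sub analyticAt_const).mul (AnalyticAt.cexp ?_)
    refine AnalyticAt.div (AnalyticAt.clog (hga.div analyticAt_const hg0) ?_) analyticAt_const hn0
    simp [hg0]
  have hφd : HasDerivAt φ 1 z₀ := by
    have : DifferentiableAt ℂ (fun z => exp (log (g z / g z₀) / n)) z₀ := by
      refine (AnalyticAt.cexp (AnalyticAt.div (AnalyticAt.clog (hga.div analyticAt_const hg0) ?_) analyticAt_const hn0)).differentiableAt
      simp [hg0]
    refine (((hasDerivAt_id z₀).sub_const z₀).mul this.hasDerivAt).congr_deriv ?_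
    simp [hg0]
  have hφs : HasStrictDerivAt φ 1 z₀ := by
    have := hφa.hasStrictDerivAt; rwa [hφd.deriv] at this
  have hmap := hφs.map_nhds_eq one_ne_zero
  have hφ0 : φ z₀ = 0 := by simp [hφ]
  rw [hφ0] at hmap
  have hGφ : ∀ᶠ z in 𝓝 z₀, G z = G z₀ + g z₀ * φ z ^ n := by
    filter_upwards [hge, hga.continuousAt.eventually_ne hg0] with z hz hgz
    have : exp (log (g z / g z₀) / n) ^ n = g z / g z₀ := by
      rw [← Complex.exp_nat_mul, mul_div_cancel₀ _ hn0, exp_log (div_ne_zero hgz hg0)]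
    rw [hφ]; simp only; rw [mul_pow, this]
    rw [sub_eq_iff_eq_add'.1 hz]; field_simp
  have hW : φ '' (V ∩ {z | G z = G z₀ + g z₀ * φ z ^ n}) ∈ 𝓝 (0 : ℂ) := by
    rw [← hmap]; exact image_mem_map (inter_mem hV hGφ)
  obtain ⟨η, hη, hb⟩ := Metric.mem_nhds_iff.1 hW
  have hg0' : 0 < ‖g z₀‖ := norm_pos_iff.2 hg0
  filter_upwards [Metric.ball_mem_nhds (G z₀) (mul_pos hg0' (pow_pos hη n))] with w hw hne
  set s : ℂ := ((w - G z₀) / g z₀) ^ ((n : ℂ)⁻¹) with hs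
  have hsn : s ^ n = (w - G z₀) / g z₀ := Complex.cpow_nat_inv_pow _ (by omega)
  have hs0 : s ≠ 0 := by
    intro h; rw [h, zero_pow (by omega)] at hsn
    exact (div_ne_zero (sub_ne_zero.2 hne) hg0) hsn.symm
  have hsη : ‖s‖ < η := by
    refine lt_of_pow_lt_pow_left₀ n hη.le ?_
    rw [← norm_pow, hsn, norm_div, div_lt_iff₀ hg0', mul_comm]
    simpa [dist_eq_norm] using hw
  have hζ := Complex.isPrimitiveRoot_exp n (by omega)
  set ζ := exp (2 * Real.pi * I / n)
  obtain ⟨a, ha, hae⟩ := hb (show s ∈ ball 0 η by simpa using hsη)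
  obtain ⟨b, hb', hbe⟩ := hb (show ζ * s ∈ ball 0 η by
    simp [hζ.norm'_eq_one (by omega)]; exact hsη)
  refine ⟨a, ha.1, b, hb'.1, ?_, ?_, ?_⟩
  · rintro rfl
    rw [hae] at hbe
    exact hζ.ne_one (by omega) (mul_right_cancel₀ hs0 (by rw [← hbe, one_mul]))
  · rw [show G a = _ from ha.2, hae, hsn]; field_simp; ring
  · rw [show G b = _ from hb'.2, hbe, mul_pow, hζ.pow_eq_one, hsn]; field_simp; ring
end

def HH (a b : ℝ) : Set ℂ := {w : ℂ | 0 ≤ w.im ∧ a < ‖w‖ ∧ ‖w‖ < b}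
def HA (a b : ℝ) : Set ℂ := {w : ℂ | 0 < w.im ∧ a < ‖w‖ ∧ ‖w‖ < b}

lemma HA_HH (a b : ℝ) : HA a b ⊆ HH a b := fun _ h => ⟨h.1.le, h.2⟩
lemma HA_open (a b : ℝ) : IsOpen (HA a b) :=
  (isOpen_lt continuous_const continuous_im).inter ((isOpen_lt continuous_const continuous_norm).inter
    (isOpen_lt continuous_norm continuous_const))

lemma HH_pre {a : ℝ} (ha : 0 ≤ a) (b : ℝ) : IsPreconnected (HH a b) := by
  have : HH a b = (fun x : ℝ × ℝ => cc x.1 x.2) '' (Ioo a b ×ˢ Icc 0 Real.pi) := by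
    ext w; constructor
    · rintro ⟨h0, h1, h2⟩
      refine ⟨(‖w‖, arg w), ⟨⟨h1, h2⟩, arg_nonneg_iff.2 h0, arg_le_pi w⟩, ?_⟩
      simp only [cc]; exact norm_mul_exp_arg_mul_I w
    · rintro ⟨⟨s, θ⟩, ⟨⟨h1, h2⟩, h3, h4⟩, rfl⟩
      have hs : 0 ≤ s := ha.trans h1.le
      simp only at h1 h2 h3 h4
      refine ⟨?_, by simpa [cc_norm hs] using h1, by simpa [cc_norm hs] using h2⟩
      simp only [cc, im_ofReal_mul, exp_ofReal_mul_I_im]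
      exact mul_nonneg hs (Real.sin_nonneg_of_nonneg_of_le_pi h3 h4)
  rw [this]
  refine ((isPreconnected_Ioo).prod isPreconnected_Icc).image _ (Continuous.continuousOn ?_)
  unfold cc; fun_prop

section
variable {δ r ρ₁ ρ₂ : ℝ} {U : Set ℂ} {F : Bool → Set ℂ} {G f : ℂ → ℂ} {p : Bool → ℂ} {σ : Bool → ℝ}
  {α Ui Uo : Set ℂ}

lemma Cut.outcl (h : Sol δ U F G f) (hC : Cut δ r U F G p σ α Ui Uo) {i : Bool} {q : ℂ} (hq : q ∈ F i)
    (hs : 0 < σ i * ((G q).re - (G (p i)).re)) : q ∈ closure Uo := by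
  rw [mem_closure_iff_nhds]
  intro t ht
  obtain ⟨z, hz, hzU⟩ := mem_closure_iff_nhds.1 (h.Fcl i hq) _ (inter_mem ht (hC.out i q hq hs))
  exact ⟨z, hz.1, hz.2 hzU⟩

structure Par (δ r ρ₁ ρ₂ : ℝ) : Prop where
  r2 : 2 * δ ≤ r
  r0 : 0 < r
  rK : KK * r ≤ 1 / 4
  l1 : 2 * Real.pi * MM * r < ρ₁
  l2 : ρ₁ < ρ₂
  l3 : ρ₂ * (4 * (1 + BB)) < 1

lemma Par.r4 (h : Par δ r ρ₁ ρ₂) : r ≤ 1 / 4 := by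
  have := h.rK; have := KK_ge; have := h.r0; nlinarith
lemma Par.m0 (h : Par δ r ρ₁ ρ₂) : 0 < 2 * Real.pi * MM * r :=
  mul_pos (mul_pos Real.two_pi_pos (by linarith [MM_ge])) h.r0
lemma Par.b4 (h : Par δ r ρ₁ ρ₂) : ρ₂ < 1 / 4 := by
  have := h.l3; have := BB_pos; have := h.m0; have := h.l1; have := h.l2
  nlinarith [mul_pos BB_pos (show 0 < ρ₂ by linarith)]

lemma Cut.inS (h : Sol δ U F G f) (hC : Cut δ r U F G p σ α Ui Uo) {z : ℂ} (hz : z ∈ closure Uo)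
    (h2 : ‖z‖ ≤ 1 / 2) : z ∈ ann δ 1 := by
  obtain ⟨δ', hδ', h1, -⟩ := hC.inn
  have : δ' ≤ ‖z‖ := closure_minimal (t := {z : ℂ | δ' ≤ ‖z‖}) h1 (isClosed_le continuous_const continuous_norm) hz
  exact ⟨by linarith, by linarith⟩

lemma Cut.inX (h : Sol δ U F G f) (hC : Cut δ r U F G p σ α Ui Uo) {z : ℂ} (hz : z ∈ closure Uo)
    (h2 : ‖z‖ ≤ 1 / 2) : z ∈ U ∪ ⋃ i, F i :=
  h.clX (hC.inS h hz h2) (closure_mono hC.oU hz)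

lemma Cut.sg0 (hC : Cut δ r U F G p σ α Ui Uo) (h0 : G (p true) = 0) (hP : Par δ r ρ₁ ρ₂) {i : Bool} {t : ℝ}
    (ht : ρ₁ < |t|) : (0 ≤ σ i * (t - (G (p i)).re) → 0 < σ i * t) ∧
      (0 < σ i * t → 0 < σ i * (t - (G (p i)).re)) := by
  have h1 : |(G (p i)).re| < ρ₁ := ((abs_re_le_norm _).trans
    (hC.G0 h0 (Or.inr (mem_range_self i)))).trans_lt hP.l1
  have h2 := abs_lt.1 h1
  have h3 := hP.l1; have h4 := hP.m0
  rcases hC.hσ i with e | e <;> rw [e] <;> constructor <;> intro h5 <;>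
    rcases lt_abs.1 ht with h6 | h6 <;> nlinarith

lemma Cut.cls (h : Sol δ U F G f) (hC : Cut δ r U F G p σ α Ui Uo) (h0 : G (p true) = 0)
    (hP : Par δ r ρ₁ ρ₂) {z : ℂ} (hz : z ∈ closure Uo) (hz2 : ‖z‖ ≤ 1 / 2) (hw : G z ∈ HH ρ₁ ρ₂) :
    ‖z‖ < 1 / 2 ∧ (z ∈ Uo ∨ ∃ j, z ∈ F j ∧ 0 < σ j * ((G z).re - (G (p j)).re) ∧ 0 < σ j * (G z).re) := by
  refine ⟨hz2.lt_of_ne fun he => ?_, ?_⟩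
  · have := hC.Glow h h0 hP.r2 (hC.inX h hz hz2) (by rw [he]; linarith [hP.rK]) hz2
    rw [he] at this
    have h3 := hP.l3; have := BB_pos
    nlinarith [hw.2.2]
  · rcases hC.clO h hz (hC.inS h hz hz2) with h1 | h1 | ⟨j, hj, hs⟩
    · exact Or.inl h1
    · exact absurd (hC.G0 h0 (Or.inl h1)) (by linarith [hw.2.1, hP.l1])
    · refine Or.inr ⟨j, hj, ?_⟩
      have ha : ρ₁ < |(G z).re| := by
        have := hw.2.1; rw [h.Gre hj, norm_real] at this; simpa using this
      have h2 := (hC.sg0 (i := j) h0 hP ha).1 hs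
      exact ⟨(hC.sg0 h0 hP ha).2 h2, h2⟩

lemma Cut.ls (h : Sol δ U F G f) (hC : Cut δ r U F G p σ α Ui Uo) (h0 : G (p true) = 0)
    (hP : Par δ r ρ₁ ρ₂) {z : ℂ} (hz : z ∈ {z ∈ closure Uo | ‖z‖ ≤ 1 / 2}) (hw : G z ∈ HH ρ₁ ρ₂)
    {V : Set ℂ} (hV : V ∈ 𝓝 z) :
    ∀ᶠ w in 𝓝[HH ρ₁ ρ₂] (G z), ∃ z' ∈ {z ∈ closure Uo | ‖z‖ ≤ 1 / 2} ∩ V, G z' = w := by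
  obtain ⟨hlt, hc⟩ := hC.cls h h0 hP hz.1 hz.2 hw
  have hball : ∀ᶠ y in 𝓝 z, ‖y‖ < 1 / 2 := (isOpen_lt continuous_norm continuous_const).mem_nhds hlt
  rcases hc with h1 | ⟨j, hj, hs, -⟩
  · refine Filter.Eventually.filter_mono nhdsWithin_le_nhds ?_
    filter_upwards [h.openmap (hC.oU h1) (image_mem_map (inter_mem (inter_mem hV hball) (hC.oo.mem_nhds h1)))] with w hw
    obtain ⟨y, ⟨⟨hy1, hy2⟩, hy3⟩, he⟩ := hw
    exact ⟨y, ⟨⟨subset_closure hy3, le_of_lt hy2⟩, hy1⟩, he⟩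
  · have hGz : ∀ᶠ y in 𝓝 z, y ∈ U ∪ ⋃ i, F i → 0 < σ j * ((G y).re - (G (p j)).re) := by
      have := (continuous_re.continuousAt.comp_continuousWithinAt (h.Gc z (Sol.FX j hj))).sub_const ((G (p j)).re)
      have := (this.const_mul (σ j)).eventually_const_lt hs
      exact eventually_nhdsWithin_iff.1 this
    obtain ⟨ρ, hρ, hb⟩ := Metric.eventually_nhds_iff_ball.1
      ((hGz.and (h.Floc hj)).and ((hC.out j z hj hs).and (hball.and hV)))
    obtain ⟨η, hη, hsu⟩ := h.surj hj hρ
    filter_upwards [self_mem_nhdsWithin, nhdsWithin_le_nhds (ball_mem_nhds (G z) hη)] with w hwH hwb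
    obtain ⟨y, ⟨hyX, hyb⟩, he⟩ := hsu w hwH.1 (by simpa [dist_eq_norm] using hwb)
    obtain ⟨⟨h1, h2⟩, h3, h4, h5⟩ := hb y hyb
    refine ⟨y, ⟨⟨?_, h4.le⟩, h5⟩, he⟩
    by_cases hyU : y ∈ U
    · exact subset_closure (h3 hyU)
    · exact hC.outcl h (h2 hyX hyU) (h1 hyX)

lemma Cut.dich (h : Sol δ U F G f) (hC : Cut δ r U F G p σ α Ui Uo) (h0 : G (p true) = 0)
    (hP : Par δ r ρ₁ ρ₂) {z : ℂ} (hz : z ∈ {z ∈ closure Uo | ‖z‖ ≤ 1 / 2}) (hw : G z ∈ HH ρ₁ ρ₂) :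
    ((z ∈ U → f z ≠ 0) ∧ (∃ V ∈ 𝓝 z, InjOn G ({z ∈ closure Uo | ‖z‖ ≤ 1 / 2} ∩ V))) ∨ ∀ V ∈ 𝓝 z, ∀ᶠ w in 𝓝[HH ρ₁ ρ₂] (G z),
      w ≠ G z → ∃ z₁ ∈ {z ∈ closure Uo | ‖z‖ ≤ 1 / 2} ∩ V,
        ∃ z₂ ∈ {z ∈ closure Uo | ‖z‖ ≤ 1 / 2} ∩ V, z₁ ≠ z₂ ∧ G z₁ = w ∧ G z₂ = w := by
  obtain ⟨hlt, hc⟩ := hC.cls h h0 hP hz.1 hz.2 hw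
  have hball : ∀ᶠ y in 𝓝 z, ‖y‖ < 1 / 2 := (isOpen_lt continuous_norm continuous_const).mem_nhds hlt
  rcases hc with h1 | ⟨j, hj, hs, -⟩
  · have hzU := hC.oU h1
    have hGd : DifferentiableOn ℂ G U := fun z hz => (h.der z hz).differentiableAt.differentiableWithinAt
    have hGa : AnalyticAt ℂ G z := hGd.analyticAt (h.Uo.mem_nhds hzU)
    by_cases hf : f z = 0
    · right
      intro V hV
      have hnc : ¬ ∀ᶠ y in 𝓝 z, G y = G z := by
        intro hev
        have h2 := (h.openmap hzU).trans (map_mono (le_refl _))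
        have h3 : {G z} ∈ 𝓝 (G z) := h2 (show G ⁻¹' {G z} ∈ 𝓝 z from hev)
        exact (not_isOpen_singleton (G z)) (isOpen_singleton_iff_nhds_eq_pure _ |>.2
          (le_antisymm (by rw [le_pure_iff]; exact h3) (pure_le_nhds _)))
      refine (two_pre hGa (by rw [(h.der z hzU).deriv, hf]) hnc
        (inter_mem (inter_mem hV hball) (hC.oo.mem_nhds h1))).filter_mono nhdsWithin_le_nhds |>.mono ?_
      rintro w hw' hne
      obtain ⟨a, ha, b, hb, h5⟩ := hw' hne
      exact ⟨a, ⟨⟨subset_closure ha.2, le_of_lt ha.1.2⟩, ha.1.1⟩, b,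
        ⟨⟨subset_closure hb.2, le_of_lt hb.1.2⟩, hb.1.1⟩, h5⟩
    · left
      refine ⟨fun _ => hf, ?_⟩
      have hsd : HasStrictDerivAt G (f z) z := by
        have := hGa.hasStrictDerivAt; rwa [(h.der z hzU).deriv] at this
      refine ⟨_, ((hsd.hasStrictFDerivAt_equiv hf).toOpenPartialHomeomorph G).open_source.mem_nhds
        (hsd.hasStrictFDerivAt_equiv hf).mem_toOpenPartialHomeomorph_source, ?_⟩
      exact (((hsd.hasStrictFDerivAt_equiv hf).toOpenPartialHomeomorph G).injOn).mono inter_subset_right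
  · left
    refine ⟨fun hU => (h.FnotU hj hU).elim, ?_⟩
    obtain ⟨ρ, hρ, hb⟩ := h.bilip hj
    refine ⟨ball z ρ, ball_mem_nhds z hρ, fun a ha b hb' he => ?_⟩
    have := hb a ⟨hC.inX h ha.1.1 ha.1.2, ha.2⟩ b ⟨hC.inX h hb'.1.1 hb'.1.2, hb'.2⟩
    rw [he, sub_self, norm_zero, mul_zero] at this
    exact (sub_eq_zero.1 (norm_le_zero_iff.1 this)).symm
end

noncomputable def CK : ℝ := 2 * (1 + BB) + KK

structure Conf (ρ₁ ρ₂ : ℝ) (F : Bool → Set ℂ) (G f : ℂ → ℂ) (σ : Bool → ℝ) (Uo : Set ℂ) (K : ℂ → ℂ) : Prop where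
  inv : ∀ w ∈ HH ρ₁ ρ₂, G (K w) = w
  cl : ∀ w ∈ HH ρ₁ ρ₂, K w ∈ closure Uo
  n2 : ∀ w ∈ HH ρ₁ ρ₂, ‖K w‖ < 1 / 2
  uniq : ∀ w ∈ HH ρ₁ ρ₂, ∀ z ∈ closure Uo, ‖z‖ ≤ 1 / 2 → G z = w → z = K w
  co : ContinuousOn K (HH ρ₁ ρ₂)
  mo : ∀ w ∈ HA ρ₁ ρ₂, K w ∈ Uo
  f0 : ∀ w ∈ HA ρ₁ ρ₂, f (K w) ≠ 0
  fM : ∀ w ∈ HA ρ₁ ρ₂, ‖f (K w)‖ ≤ MM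
  der : ∀ w ∈ HA ρ₁ ρ₂, HasDerivAt K (f (K w))⁻¹ w
  real : ∀ t : ℝ, ρ₁ < |t| → |t| < ρ₂ → ∃ j, K t ∈ F j ∧ 0 < σ j * t
  lim : ∀ t : ℝ, ρ₁ < |t| → |t| < ρ₂ → Tendsto (fun w => ‖f (K w)‖) (𝓝[HA ρ₁ ρ₂] (t : ℂ)) (𝓝 1)
  gr : ∀ w ∈ HH ρ₁ ρ₂, ‖K w‖ ≤ CK * ‖w‖
  sg : σ true ≠ σ false

section
variable {δ r ρ₁ ρ₂ : ℝ} {U : Set ℂ} {F : Bool → Set ℂ} {G f : ℂ → ℂ} {p : Bool → ℂ} {σ : Bool → ℝ}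
  {α Ui Uo : Set ℂ}

lemma Cut.exists_conf (h : Sol δ U F G f) (hC : Cut δ r U F G p σ α Ui Uo) (h0 : G (p true) = 0)
    (hP : Par δ r ρ₁ ρ₂) : ∃ K, Conf ρ₁ ρ₂ F G f σ Uo K := by
  set S : Set ℂ := {z ∈ closure Uo | ‖z‖ ≤ 1 / 2} with hSd
  set H := HH ρ₁ ρ₂ with hHd
  have hρ1 : 0 < ρ₁ := hP.m0.trans hP.l1
  have hSX : S ⊆ U ∪ ⋃ i, F i := fun z hz => hC.inX h hz.1 hz.2
  have hSc : IsCompact S := by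
    have : S = closure Uo ∩ closedBall 0 (1/2) := by ext z; simp [hSd]
    rw [this]; exact (isCompact_closedBall _ _).inter_left isClosed_closure
  have hGS : ContinuousOn G S := h.Gc.mono hSX
  have hHp : IsPreconnected H := HH_pre hρ1.le _
  have ls : ∀ z ∈ S, G z ∈ H → ∀ V ∈ 𝓝 z, ∀ᶠ w in 𝓝[H] (G z), ∃ z' ∈ S ∩ V, G z' = w :=
    fun z hz hw V hV => hC.ls h h0 hP hz hw hV
  have hrH : ∀ t : ℝ, ρ₁ < |t| → |t| < ρ₂ → (t : ℂ) ∈ H := fun t h1 h2 =>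
    ⟨by simp, by simpa using h1, by simpa using h2⟩
  have hne : ∃ z ∈ S, G z ∈ H := by
    obtain ⟨J, γ, hS, hpar, hlip⟩ := h.param true
    obtain ⟨q, hq, hqn⟩ := h.hit (s := 1/2) (by linarith [hP.r4, hP.r2, h.hδ]) (by norm_num) true
    have hσq : 0 ≤ σ true * ((G q).re - (G (p true)).re) := by
      by_contra hc
      have h1 := hC.Glow h h0 hP.r2 (Sol.FX true hq) (by linarith [hP.rK]) hqn.le
      have := hC.tail_le h hP.r2 hP.r4 hq (not_le.1 hc)
      have h3 : CI ≤ KK := by unfold CI KK; nlinarith [Real.pi_pos, MM_ge, mul_pos Real.pi_pos (show 0 < MM by linarith [MM_ge])]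
      nlinarith [hP.rK, hP.r0]
    have hGq := hC.Glow h h0 hP.r2 (Sol.FX true hq) (by linarith [hP.rK]) hqn.le
    rw [hqn, h.Gre hq, norm_real, Real.norm_eq_abs] at hGq
    have hq2 : ρ₂ < |(G q).re| := by have := hP.l3; have := BB_pos; nlinarith
    rw [h0] at hσq
    set t := σ true * ((ρ₁ + ρ₂) / 2) with ht
    have hta : |t| = (ρ₁ + ρ₂) / 2 := by
      rw [ht, abs_mul, abs_of_pos (show 0 < (ρ₁ + ρ₂) / 2 by linarith [hP.l2])]
      rcases hC.hσ true with e | e <;> simp [e]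
    have htJ : t ∈ J := by
      have h00 := (hpar _ (hC.pF true)).1
      rw [h0] at h00
      rcases hC.hσ true with e | e <;> rw [e] at hσq ht <;> simp at hσq
      · rw [abs_of_nonneg hσq] at hq2
        exact hS.c.ordConnected.out h00 (hpar q hq).1 ⟨by simp; linarith [hP.l2], by linarith [hP.l2]⟩
      · rw [abs_of_nonpos hσq] at hq2
        exact hS.c.ordConnected.out (hpar q hq).1 h00 ⟨by linarith [hP.l2], by simp; linarith [hP.l2]⟩
    have hGt := hS.s t htJ
    have h1 : ρ₁ < |t| := by linarith [hP.l2]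
    have h2 : |t| < ρ₂ := by linarith [hP.l2]
    refine ⟨γ t, ⟨?_, ?_⟩, by rw [hGt]; exact hrH t h1 h2⟩
    · refine hC.outcl h (hS.m t htJ) ?_
      rw [hGt, ofReal_re]
      refine (hC.sg0 h0 hP h1).2 ?_
      rw [ht]; rcases hC.hσ true with e | e <;> rw [e] <;> linarith [hP.l2]
    · have := hlip _ htJ _ (hpar _ (hC.pF true)).1
      rw [(hpar _ (hC.pF true)).2, h0] at this
      simp only [zero_re, sub_zero] at this
      have h3 := norm_sub_norm_le (γ t) (p true)
      rw [hC.pr] at h3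
      linarith [hP.b4, hP.r4]
  have hex := cover1 hSc hGS hHp ls hne
  have hreal : ∀ z ∈ S, ∀ t : ℝ, ρ₁ < |t| → |t| < ρ₂ → G z = t → ∃ j, z ∈ F j ∧ 0 < σ j * t := by
    intro z hz t h1 h2 he
    rcases (hC.cls h h0 hP hz.1 hz.2 (by rw [he]; exact hrH t h1 h2)).2 with h3 | ⟨j, hj, -, h3⟩
    · have := h.pos z (hC.oU h3); rw [he] at this; simp at this
    · exact ⟨j, hj, by rwa [he, ofReal_re] at h3⟩
  set t₀ := (ρ₁ + ρ₂) / 2 with ht₀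
  have ht1 : ρ₁ < |t₀| := by rw [abs_of_pos] <;> linarith [hP.l2]
  have ht2 : |t₀| < ρ₂ := by rw [abs_of_pos] <;> linarith [hP.l2]
  have ht3 : 0 < t₀ := by linarith [hP.l2]
  obtain ⟨z₀, hz₀, he₀⟩ := hex t₀ (hrH _ ht1 ht2)
  obtain ⟨z₁, hz₁, he₁⟩ := hex ((-t₀ : ℝ) : ℂ) (hrH _ (by rwa [abs_neg]) (by rwa [abs_neg]))
  obtain ⟨j₀, hj₀, hs₀⟩ := hreal z₀ hz₀ t₀ ht1 ht2 he₀
  obtain ⟨j₁, hj₁, hs₁⟩ := hreal z₁ hz₁ _ (by rwa [abs_neg]) (by rwa [abs_neg]) he₁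
  have hsj : ∀ j, j ≠ j₀ → σ j < 0 := by
    intro j hj
    have : j = j₁ := by
      have h2 : j₁ ≠ j₀ := by rintro rfl; nlinarith
      rw [bool_ne hj, bool_ne h2]
    subst this; nlinarith
  have hs0 : 0 < σ j₀ := by nlinarith
  have hsg : σ true ≠ σ false := by
    rcases hb : j₀ with - | - <;> rw [hb] at hs0 hsj
    · have := hsj true (by simp); linarith
    · have := hsj false (by simp); linarith
  have h0u : ∀ z ∈ S, G z = G z₀ → z = z₀ := by
    intro z hz he
    obtain ⟨j, hj, hs⟩ := hreal z hz t₀ ht1 ht2 (he.trans he₀)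
    have : j = j₀ := by
      by_contra hc; have := hsj j hc; nlinarith
    subst this
    exact h.Finj hj hj₀ (by rw [he])
  have dich : ∀ z ∈ S, G z ∈ H → ((z ∈ U → f z ≠ 0) ∧ ∃ V ∈ 𝓝 z, InjOn G (S ∩ V)) ∨ ∀ V ∈ 𝓝 z, ∀ᶠ w in 𝓝[H] (G z),
      w ≠ G z → ∃ z₁ ∈ S ∩ V, ∃ z₂ ∈ S ∩ V, z₁ ≠ z₂ ∧ G z₁ = w ∧ G z₂ = w :=
    fun z hz hw => hC.dich h h0 hP hz hw
  have h0H : G z₀ ∈ H := by rw [he₀]; exact hrH _ ht1 ht2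
  have h0g : ∃ V ∈ 𝓝 z₀, InjOn G (S ∩ V) := by
    obtain ⟨ρ, hρ, hb⟩ := h.bilip hj₀
    refine ⟨ball z₀ ρ, ball_mem_nhds _ hρ, fun a ha b hb' he => ?_⟩
    have := hb a ⟨hSX ha.1, ha.2⟩ b ⟨hSX hb'.1, hb'.2⟩
    rw [he, sub_self, norm_zero, mul_zero] at this
    exact (sub_eq_zero.1 (norm_le_zero_iff.1 this)).symm
  have hall := cover2 hSc hGS hHp ls (fun z hz hw => (dich z hz hw).imp (fun h => h.2) id) hz₀ h0H h0u h0g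
  choose! K hKS hKi hKu hKg using hall
  have hAH : ∀ w ∈ HA ρ₁ ρ₂, w ∈ H := fun w hw => HA_HH _ _ hw
  have hmU : ∀ w ∈ HA ρ₁ ρ₂, K w ∈ Uo := fun w hw => by
    rcases (hC.cls h h0 hP (hKS w (hAH w hw)).1 (hKS w (hAH w hw)).2 (by rw [hKi w (hAH w hw)]; exact hAH w hw)).2 with h3 | ⟨j, hj, -⟩
    · exact h3
    · have := h.Gr j _ hj; rw [hKi w (hAH w hw)] at this; exact absurd this hw.1.ne'
  have hco : ContinuousOn K H := by
    intro w hw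
    rw [ContinuousWithinAt, _root_.tendsto_nhds]
    intro V hV hwV
    filter_upwards [(fib_prop hSc hGS hV (fun z hz he => by rw [hKu w hw z hz he]; exact hwV)).filter_mono
      nhdsWithin_le_nhds, self_mem_nhdsWithin] with w' h1 h2
    exact h1 _ (hKS w' h2) (hKi w' h2)
  have hf0 : ∀ w ∈ HA ρ₁ ρ₂, f (K w) ≠ 0 := by
    intro w hw
    have hwH := hAH w hw
    rcases dich (K w) (hKS w hwH) (by rw [hKi w hwH]; exact hwH) with h1 | h1
    · exact h1.1 (hC.oU (hmU w hw))
    · obtain ⟨V, hV, hi⟩ := hKg w hwH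
      have h2 := h1 V hV
      rw [hKi w hwH, eventually_nhdsWithin_iff] at h2
      have h3 : ∀ᶠ y in 𝓝[≠] w, y ∈ HA ρ₁ ρ₂ := nhdsWithin_le_nhds ((HA_open _ _).mem_nhds hw)
      obtain ⟨y, ⟨hy1, hy2⟩, hy3⟩ := ((h3.and (h2.filter_mono nhdsWithin_le_nhds)).and self_mem_nhdsWithin).exists
      obtain ⟨a, ha, b, hb, hne, e1, e2⟩ := hy2 (hAH y hy1) hy3
      exact (hne (hi ha hb (e1.trans e2.symm))).elim
  have hre : ∀ t : ℝ, ρ₁ < |t| → |t| < ρ₂ → ∃ j, K t ∈ F j ∧ 0 < σ j * t := fun t h1 h2 =>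
    hreal _ (hKS _ (hrH t h1 h2)) t h1 h2 (hKi _ (hrH t h1 h2))
  refine ⟨K, hKi, fun w hw => (hKS w hw).1, fun w hw => (hC.cls h h0 hP (hKS w hw).1 (hKS w hw).2 (by rw [hKi w hw]; exact hw)).1,
    fun w hw z h1 h2 h3 => hKu w hw z ⟨h1, h2⟩ h3, hco, hmU, hf0,
    fun w hw => hC.lipO h hP.r2 (by linarith [hP.r4]) (hmU w hw) (hKS w (hAH w hw)).2, ?_, hre, ?_, ?_, hsg⟩
  · intro w hw
    refine HasDerivAt.of_local_left_inverse (f := G) ?_ (h.der _ (hC.oU (hmU w hw))) (hf0 w hw) ?_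
    · exact (hco w (hAH w hw)).continuousAt (mem_of_superset ((HA_open _ _).mem_nhds hw) hAH)
    · filter_upwards [(HA_open _ _).mem_nhds hw] with y hy
      exact hKi y (hAH y hy)
  · intro t h1 h2
    obtain ⟨j, hj, -⟩ := hre t h1 h2
    obtain ⟨L, hL, hT, -⟩ := h.loc j _ hj
    have hT2 := hT.norm
    rw [hL] at hT2
    refine hT2.comp (tendsto_nhdsWithin_iff.2 ⟨((hco t (hrH t h1 h2)).mono hAH).tendsto, ?_⟩)
    filter_upwards [self_mem_nhdsWithin] with y hy
    exact hC.oU (hmU y hy)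
  · intro w hw
    have hB := BB_pos; have hK := KK_ge
    have hw0 : 0 ≤ ‖w‖ := norm_nonneg w
    unfold CK
    by_cases hc : KK * r ≤ ‖K w‖
    · have := hC.Glow h h0 hP.r2 (hSX (hKS w hw)) hc (hKS w hw).2
      rw [hKi w hw] at this
      nlinarith
    · have hr : r ≤ ‖w‖ := by
        have h1 := hw.2.1; have h2 := hP.l1; have := hP.r0
        have h3 : 1 ≤ 2 * Real.pi * MM := by nlinarith [Real.pi_gt_three, MM_ge]
        nlinarith
      nlinarith [not_le.1 hc]
end

noncomputable def qq (ρ : ℝ) (w : ℂ) : ℂ := ρ * w / (ρ ^ 2 - w ^ 2)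

lemma qq_im (ρ : ℝ) (w : ℂ) : (qq ρ w).im = ρ * w.im * (ρ ^ 2 + ‖w‖ ^ 2) / ‖(ρ : ℂ) ^ 2 - w ^ 2‖ ^ 2 := by
  rw [qq, div_im, ← normSq_eq_norm_sq, ← normSq_eq_norm_sq, normSq_apply w]
  simp [pow_two]; ring

lemma qq_den {ρ : ℝ} {w : ℂ} (hw : 0 < w.im) (hρ : 0 < ρ) : (ρ : ℂ) ^ 2 - w ^ 2 ≠ 0 := by
  intro h
  have : ((ρ : ℂ) - w) * (ρ + w) = 0 := by rw [← h]; ring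
  rcases mul_eq_zero.1 this with h | h <;> have := congrArg Complex.im h <;> simp at this <;> linarith

lemma qq_nn {ρ : ℝ} {w : ℂ} (hw : 0 < w.im) (hρ : 0 < ρ) : 0 ≤ (qq ρ w).im := by
  rw [qq_im]; positivity

lemma qq_sph {ρ : ℝ} {w : ℂ} (hw : 0 < w.im) (hρ : ‖w‖ = ρ) : (qq ρ w).im = ρ / (2 * w.im) := by
  have hρ0 : 0 < ρ := hρ ▸ norm_pos_iff.2 (fun h => by simp [h] at hw)
  have h1 : (ρ : ℂ) ^ 2 - w ^ 2 = w * (-(2 * w.im) * I) := by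
    have h2 : (ρ : ℂ) ^ 2 = w * (starRingEnd ℂ) w := by rw [mul_conj, normSq_eq_norm_sq, hρ]; push_cast; ring
    rw [h2]
    have h3 : (starRingEnd ℂ) w = w - 2 * w.im * I := by apply Complex.ext <;> simp; ring
    rw [h3]; ring
  rw [qq_im, h1, norm_mul, hρ]
  have : ‖-(2 * (w.im : ℂ)) * I‖ = 2 * w.im := by simp [abs_of_pos hw]
  rw [this]; field_simp; ring

lemma qq_le1 {ρ : ℝ} {w : ℂ} (hw : 0 < w.im) (hρ : 0 < ρ) (h : 2 * ‖w‖ ≤ ρ) : (qq ρ w).im ≤ 3 * w.im / ρ := by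
  have h1 : 3 / 4 * ρ ^ 2 ≤ ‖(ρ : ℂ) ^ 2 - w ^ 2‖ := by
    have := norm_sub_norm_le ((ρ : ℂ) ^ 2) (w ^ 2)
    rw [norm_pow, norm_pow, norm_real, Real.norm_eq_abs, sq_abs] at this
    nlinarith [norm_nonneg w]
  rw [qq_im, div_le_div_iff₀ (pow_pos (norm_pos_iff.2 (qq_den hw hρ)) 2) hρ]
  have h2 : 9 / 16 * ρ ^ 4 ≤ ‖(ρ : ℂ) ^ 2 - w ^ 2‖ ^ 2 := by nlinarith [sq_nonneg ρ]
  have h3 : ‖w‖ ^ 2 ≤ ρ ^ 2 / 4 := by nlinarith [norm_nonneg w]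
  have h4 : ρ ^ 2 * (ρ ^ 2 + ‖w‖ ^ 2) ≤ 3 * ‖(ρ : ℂ) ^ 2 - w ^ 2‖ ^ 2 := by nlinarith [mul_le_mul_of_nonneg_left h3 (sq_nonneg ρ), pow_pos hρ 4]
  nlinarith

lemma qq_le2 {ρ : ℝ} {w : ℂ} (hw : 0 < w.im) (hρ : 0 < ρ) (h : 2 * ρ ≤ ‖w‖) :
    (qq ρ w).im ≤ 3 * ρ * w.im / ‖w‖ ^ 2 := by
  have hw0 : 0 < ‖w‖ := by linarith
  have h1 : 3 / 4 * ‖w‖ ^ 2 ≤ ‖(ρ : ℂ) ^ 2 - w ^ 2‖ := by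
    have := norm_sub_norm_le (w ^ 2) ((ρ : ℂ) ^ 2)
    rw [norm_pow, norm_pow, norm_real, Real.norm_eq_abs, sq_abs, norm_sub_rev] at this
    nlinarith
  rw [qq_im, div_le_div_iff₀ (pow_pos (norm_pos_iff.2 (qq_den hw hρ)) 2) (by positivity)]
  have h2 : 9 / 16 * ‖w‖ ^ 4 ≤ ‖(ρ : ℂ) ^ 2 - w ^ 2‖ ^ 2 := by nlinarith [sq_nonneg ‖w‖]
  have h3 : ρ ^ 2 ≤ ‖w‖ ^ 2 / 4 := by nlinarith
  have h4 : (ρ ^ 2 + ‖w‖ ^ 2) * ‖w‖ ^ 2 ≤ 3 * ‖(ρ : ℂ) ^ 2 - w ^ 2‖ ^ 2 := by nlinarith [mul_le_mul_of_nonneg_left h3 (sq_nonneg ‖w‖), pow_pos hw0 4]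
  have : 0 ≤ ρ * w.im := by positivity
  nlinarith

lemma comp_bd {κ : ℂ → ℂ} {ρ₁ ρ₂ c : ℝ} (h1 : 0 < ρ₁) (hc : 0 ≤ c) (h12 : 4 * ρ₁ < ρ₂)
    (hd : DifferentiableOn ℂ κ (HA ρ₁ ρ₂))
    (hb : ∀ w ∈ HA ρ₁ ρ₂, 2 * ρ₁ ≤ ‖w‖ → ‖w‖ ≤ ρ₂ / 2 → ‖κ w‖ ≤ c * ‖w‖ / w.im)
    (hl : ∀ t : ℝ, ρ₁ < |t| → |t| < ρ₂ → Tendsto (fun w => ‖κ w‖) (𝓝[HA ρ₁ ρ₂] (t : ℂ)) (𝓝 1)) :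
    ∀ w ∈ HA (4 * ρ₁) (ρ₂ / 4), ‖κ w‖ ≤ Real.exp (12 * c * w.im * (1 / ρ₂ + ρ₁ / ‖w‖ ^ 2)) := by
  intro w hw
  set Q : ℂ → ℂ := fun w => qq (2 * ρ₁) w + qq (ρ₂ / 2) w with hQ
  set E : ℂ → ℂ := fun w => exp (I * (2 * c) * Q w) with hE
  have hEn : ∀ w, ‖E w‖ = Real.exp (-(2 * c * (Q w).im)) := fun w => by
    rw [hE, norm_exp]; congr 1; simp [mul_assoc]
  have hsub : HA (2 * ρ₁) (ρ₂ / 2) ⊆ HA ρ₁ ρ₂ := fun w h => ⟨h.1, by linarith [h.2.1], by linarith [h.2.2]⟩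
  have h20 : 0 < ρ₂ / 2 := by linarith
  have h10 : 0 < 2 * ρ₁ := by linarith
  have hQ0 : ∀ w : ℂ, 0 < w.im → 0 ≤ (Q w).im := fun w hw => by
    rw [hQ, add_im]; exact add_nonneg (qq_nn hw h10) (qq_nn hw h20)
  have hEd : ∀ w : ℂ, 0 < w.im → DifferentiableAt ℂ E w := fun w hw => by
    have a := qq_den hw h10; have b := qq_den hw h20
    push_cast at a b
    simp only [hE, hQ, qq]; push_cast
    fun_prop (disch := assumption)
  have key : ‖κ w * E w‖ ≤ 1 := by
    refine maxLim (Φ := fun w => κ w * E w) (HA_open (2 * ρ₁) (ρ₂ / 2)) ?_ ?_ ?_ w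
      ⟨hw.1, by linarith [hw.2.1], by linarith [hw.2.2]⟩
    · exact isBounded_ball.subset (fun w hw => mem_ball_zero_iff.2 hw.2.2)
    · exact (hd.mono hsub).mul fun w hw => (hEd w hw.1).differentiableWithinAt
    intro ζ hζ η hη
    have hcl : ζ ∈ {w : ℂ | 0 ≤ w.im ∧ 2 * ρ₁ ≤ ‖w‖ ∧ ‖w‖ ≤ ρ₂ / 2} := by
      refine closure_minimal (fun w (hw : w ∈ HA (2 * ρ₁) (ρ₂ / 2)) => ?_) ?_ (frontier_subset_closure hζ)
      · exact ⟨hw.1.le, hw.2.1.le, hw.2.2.le⟩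
      exact (isClosed_le continuous_const continuous_im).inter ((isClosed_le continuous_const continuous_norm).inter
        (isClosed_le continuous_norm continuous_const))
    obtain ⟨hi, hn1, hn2⟩ := hcl
    rcases hi.eq_or_lt with h0 | h0
    · have hζt : ζ = (ζ.re : ℂ) := by apply Complex.ext <;> simp [← h0]
      have hna : ‖ζ‖ = |ζ.re| := by rw [hζt]; simp
      have ht := hl ζ.re (by linarith) (by linarith)
      rw [← hζt] at ht
      have := (ht.mono_left (nhdsWithin_mono _ hsub)).eventually_lt_const (by linarith : (1 : ℝ) < 1 + η)
      filter_upwards [this, self_mem_nhdsWithin] with y hy hyD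
      rw [norm_mul]
      have : ‖E y‖ ≤ 1 := by
        rw [hEn, Real.exp_le_one_iff]; have := hQ0 y hyD.1; nlinarith [mul_nonneg hc this]
      nlinarith [norm_nonneg (κ y), norm_nonneg (E y)]
    · have hζA : ζ ∈ HA ρ₁ ρ₂ := ⟨h0, by linarith, by linarith⟩
      have hcont : ContinuousAt (fun w => κ w * E w) ζ :=
        ((hd.differentiableAt ((HA_open _ _).mem_nhds hζA)).mul (hEd ζ h0)).continuousAt
      have hle : ‖κ ζ * E ζ‖ ≤ 1 := by
        have hb' := hb ζ hζA hn1 hn2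
        have hX : c * ‖ζ‖ / ζ.im ≤ 2 * c * (Q ζ).im := by
          have hq : ‖ζ‖ / (2 * ζ.im) ≤ (Q ζ).im := by
            rw [(HA_open _ _).frontier_eq] at hζ
            rw [hQ, add_im]
            have a := qq_nn h0 h10; have b := qq_nn h0 h20
            by_cases hs : ‖ζ‖ = 2 * ρ₁
            · rw [qq_sph h0 hs, hs]; linarith
            · have hs2 : ‖ζ‖ = ρ₂ / 2 := by
                by_contra hne
                exact hζ.2 ⟨h0, lt_of_le_of_ne hn1 (Ne.symm hs), lt_of_le_of_ne hn2 hne⟩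
              rw [qq_sph h0 hs2, hs2]; linarith
          calc c * ‖ζ‖ / ζ.im = 2 * c * (‖ζ‖ / (2 * ζ.im)) := by field_simp
            _ ≤ _ := by gcongr
        rw [norm_mul, hEn, Real.exp_neg, ← div_eq_mul_inv, div_le_one (Real.exp_pos _)]
        linarith [Real.add_one_le_exp (2 * c * (Q ζ).im)]
      exact (hcont.norm.eventually_lt_const (by linarith : ‖κ ζ * E ζ‖ < 1 + η)).filter_mono
        nhdsWithin_le_nhds |>.mono fun _ h => h.le
  rw [norm_mul, hEn, Real.exp_neg, ← div_eq_mul_inv, div_le_one (Real.exp_pos _)] at key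
  refine key.trans (Real.exp_le_exp.2 ?_)
  have a := qq_le2 hw.1 h10 (by linarith [hw.2.1])
  have b := qq_le1 hw.1 h20 (by linarith [hw.2.2])
  have : (Q w).im ≤ 3 * (2 * ρ₁) * w.im / ‖w‖ ^ 2 + 3 * w.im / (ρ₂ / 2) := by rw [hQ, add_im]; linarith
  calc 2 * c * (Q w).im ≤ 2 * c * (3 * (2 * ρ₁) * w.im / ‖w‖ ^ 2 + 3 * w.im / (ρ₂ / 2)) := by gcongr
    _ = _ := by field_simp; ring

lemma HA_ball {a b : ℝ} {w : ℂ} (hw : w ∈ HA (2 * a) (b / 2)) {z : ℂ} (hz : ‖z - w‖ ≤ w.im / 2) :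
    z ∈ HA a b ∧ z.im ≤ 3 / 2 * w.im ∧ ‖w‖ ≤ 2 * ‖z‖ ∧ ‖z‖ ≤ 3 / 2 * ‖w‖ := by
  have h1 := abs_le.1 ((abs_im_le_norm (z - w)).trans hz)
  rw [sub_im] at h1
  have h2 := (le_abs_self _).trans (abs_im_le_norm w)
  have h3 := norm_sub_norm_le w z
  have h4 := norm_sub_norm_le z w
  rw [norm_sub_rev w z] at h3
  obtain ⟨i, j, k⟩ := hw
  exact ⟨⟨by linarith, by linarith, by linarith⟩, by linarith, by linarith, by linarith⟩

lemma kder {k : ℂ → ℂ} {a b A B c : ℝ} (hA : 0 < A) (hB : 0 < B) (hc : 0 < c) (hk : DifferentiableOn ℂ k (HA a b))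
    (h0 : ∀ w ∈ HA a b, k w ≠ 0)
    (hl : ∀ w ∈ HA a b, |Real.log ‖k w‖| ≤ c * w.im * (1 / B + A / ‖w‖ ^ 2)) {w : ℂ} (hw : w ∈ HA (2 * a) (b / 2)) :
    ‖deriv k w‖ ≤ ‖k w‖ * (72 * c * (1 / B + A / ‖w‖ ^ 2)) := by
  have hR : 0 < w.im / 2 := half_pos hw.1
  have hw0 : 0 < ‖w‖ := norm_pos_iff.2 (fun h => by have := hw.1; simp [h] at this)
  have hsub : ball w (w.im / 2) ⊆ HA a b := fun z hz => (HA_ball hw (by simpa [dist_eq_norm] using (mem_ball.1 hz).le)).1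
  have hkb := hk.mono hsub
  obtain ⟨P, hP⟩ := (DifferentiableOn.div (hkb.deriv isOpen_ball) hkb (fun z hz => h0 z (hsub hz))).isExactOn_ball
  obtain ⟨l, hld, hle⟩ := log_of_prim isOpen_ball hkb (fun z hz => h0 z (hsub hz)) hP
  set M := 6 * c * w.im * (1 / B + A / ‖w‖ ^ 2) with hM
  have hM0 : 0 < M := by have := hw.1; positivity
  have hre : ∀ z ∈ ball w (w.im / 2), |(l z).re| ≤ M := fun z hz => by
    have e : (l z).re = Real.log ‖k z‖ := by rw [← hle z hz, norm_exp, Real.log_exp]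
    rw [e]
    obtain ⟨h1, h2, h3, -⟩ := HA_ball hw (show ‖z - w‖ ≤ _ by simpa [dist_eq_norm] using (mem_ball.1 hz).le)
    refine (hl z h1).trans ?_
    have hz0 : 0 < ‖z‖ := by linarith
    have h4 : A / ‖z‖ ^ 2 ≤ 4 * (A / ‖w‖ ^ 2) := by
      rw [← mul_div_assoc, div_le_div_iff₀ (by positivity) (by positivity)]
      have : ‖w‖ ^ 2 ≤ 4 * ‖z‖ ^ 2 := by nlinarith
      nlinarith
    have h5 : 1 / B + A / ‖z‖ ^ 2 ≤ 4 * (1 / B + A / ‖w‖ ^ 2) := by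
      have : 0 < 1 / B := by positivity
      linarith
    have hz1 := h1.1
    have hw1 := hw.1
    calc c * z.im * (1 / B + A / ‖z‖ ^ 2) ≤ c * (3 / 2 * w.im) * (4 * (1 / B + A / ‖w‖ ^ 2)) := by gcongr
      _ = M := by rw [hM]; ring
  have hc := (cayley (h := fun z => I * (l z + (2 * M : ℝ))) hR ((hld.add_const _).const_mul I) (fun z hz => by
    have := abs_le.1 (hre z hz); simp; linarith)).1
  have hwb := mem_ball_self (x := w) hR
  have hlw := (hld.differentiableAt (isOpen_ball.mem_nhds hwb)).hasDerivAt
  have hkw : deriv k w = k w * deriv l w := by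
    have h1 : HasDerivAt k (exp (l w) * deriv l w) w := hlw.cexp.congr_of_eventuallyEq
      (by filter_upwards [isOpen_ball.mem_nhds hwb] with z hz; exact (hle z hz).symm)
    rw [h1.deriv, hle w hwb]
  rw [((hlw.add_const _).const_mul I).deriv] at hc
  rw [hkw, norm_mul]
  gcongr
  have h7 := (abs_le.1 (hre w hwb)).2
  calc ‖deriv l w‖ ≤ 2 * (I * (l w + (2 * M : ℝ))).im / (w.im / 2) := by simpa using hc
    _ ≤ 2 * (3 * M) / (w.im / 2) := by gcongr; simp; linarith
    _ = _ := by rw [hM]; have := hw.1; field_simp; norm_num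

lemma osc {k k' : ℂ → ℂ} {a₂ b₂ a b A B M : ℝ} (hA : 0 < A) (hB : 0 < B) (hM : 0 < M) (ha : 0 < a) (h2 : a₂ < a) (h2' : b ≤ b₂)
    (hk : ∀ w ∈ HA a₂ b₂, HasDerivAt k (k' w) w) (hb : ∀ w ∈ HA a₂ b₂, ‖k' w‖ ≤ M * (1 / B + A / ‖w‖ ^ 2)) :
    ∀ w ∈ HA a b, ‖k w - k (cc a (Real.pi / 2))‖ ≤ 5 * M * (b / B + A / a) := by
  intro w hw
  set s := ‖w‖ with hs
  have hs0 : 0 < s := ha.trans hw.2.1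
  have hcc : ∀ x ∈ Icc a s, ∀ θ ∈ Ioo 0 Real.pi, cc x θ ∈ HA a₂ b₂ := fun x hx θ hθ => by
    have hx0 : 0 < x := ha.trans_le hx.1
    refine ⟨?_, ?_, ?_⟩
    · simp only [cc, im_ofReal_mul, exp_ofReal_mul_I_im]
      exact mul_pos hx0 (Real.sin_pos_of_pos_of_lt_pi hθ.1 hθ.2)
    · rw [cc_norm hx0.le]; linarith [hx.1]
    · rw [cc_norm hx0.le]; linarith [hx.2, hw.2.2]
  have hp2 : Real.pi / 2 ∈ Ioo 0 Real.pi := ⟨by positivity, by linarith [Real.pi_pos]⟩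
  have hq : s / B + A / s ≤ b / B + A / a := by
    have := hw.2.1.le; have := hw.2.2.le; gcongr
  have harc : ‖k w - k (cc s (Real.pi / 2))‖ ≤ 4 * M * (b / B + A / a) := by
    have hθ : arg w ∈ Ioo 0 Real.pi := by
      refine ⟨(arg_nonneg_iff.2 hw.1.le).lt_of_ne fun h => ?_, (arg_le_pi w).lt_of_ne fun h => ?_⟩
      · have := (arg_eq_zero_iff.1 h.symm).2; exact hw.1.ne' this
      · have := (arg_eq_pi_iff.1 h).2; exact hw.1.ne' this
    have h1 := (convex_Ioo 0 Real.pi).norm_image_sub_le_of_norm_hasDerivWithin_le (f := fun θ => k (cc s θ))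
      (f' := fun θ => k' (cc s θ) * (cc s θ * I)) (C := M * (1 / B + A / s ^ 2) * s)
      (fun θ hθ => ((hk _ (hcc s ⟨hw.2.1.le, le_rfl⟩ θ hθ)).comp_of_eq θ (cc_hd s θ) rfl).hasDerivWithinAt)
      (fun θ hθ => by
        rw [norm_mul, norm_mul, norm_I, mul_one, cc_norm hs0.le]
        have := hb _ (hcc s ⟨hw.2.1.le, le_rfl⟩ θ hθ)
        rw [cc_norm hs0.le] at this; gcongr) hp2 hθ
    have e : cc s (arg w) = w := norm_mul_exp_arg_mul_I w
    simp only [e] at h1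
    have h3 : ‖arg w - Real.pi / 2‖ ≤ 4 := by
      rw [Real.norm_eq_abs, abs_le]; constructor <;> linarith [hθ.1, hθ.2, Real.pi_lt_four]
    calc _ ≤ M * (1 / B + A / s ^ 2) * s * 4 := h1.trans (by gcongr)
      _ = 4 * M * (s / B + A / s) := by field_simp
      _ ≤ _ := by gcongr
  have hrad : ‖k (cc s (Real.pi / 2)) - k (cc a (Real.pi / 2))‖ ≤ M * (b / B + A / a) := by
    have hd : ∀ x ∈ Icc a s, HasDerivAt (fun x : ℝ => k (cc x (Real.pi / 2)) - k (cc a (Real.pi / 2)))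
        (k' (cc x (Real.pi / 2)) * exp (((Real.pi / 2 : ℝ) : ℂ) * I)) x := fun x hx => by
      refine HasDerivAt.sub_const _ ((hk _ (hcc x hx _ hp2)).comp_of_eq x ?_ rfl)
      refine ((HasDerivAt.ofReal_comp (hasDerivAt_id x)).mul_const _).congr_deriv (by simp)
    have hBd : ∀ x ∈ Icc a s, HasDerivAt (fun x : ℝ => M * (x / B - A / x) - M * (a / B - A / a)) (M * (1 / B + A / x ^ 2)) x := fun x hx => by
      have hx0 : x ≠ 0 := (ha.trans_le hx.1).ne'
      refine ((((hasDerivAt_id x).div_const B).sub ((hasDerivAt_inv hx0).const_mul A)).const_mul M).sub_const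
        (M * (a / B - A / a)) |>.congr_deriv ?_
      field_simp; ring
    have := image_norm_le_of_norm_deriv_right_le_deriv_boundary' (fun x hx => (hd x hx).continuousAt.continuousWithinAt)
      (fun x hx => (hd x (Ico_subset_Icc_self hx)).hasDerivWithinAt) (by simp)
      (fun x hx => (hBd x hx).continuousAt.continuousWithinAt)
      (fun x hx => (hBd x (Ico_subset_Icc_self hx)).hasDerivWithinAt)
      (fun x hx => by
        rw [norm_mul, norm_exp_ofReal_mul_I, mul_one]
        have h4 := hb _ (hcc x (Ico_subset_Icc_self hx) _ hp2)
        rwa [cc_norm (ha.trans_le hx.1).le] at h4) (right_mem_Icc.2 hw.2.1.le)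
    refine this.trans ?_
    have h5 : 0 < A / s := by positivity
    have h6 : 0 < a / B := by positivity
    have h7 : s / B ≤ b / B := by have := hw.2.2.le; gcongr
    nlinarith
  have := norm_sub_le_norm_sub_add_norm_sub (k w) (k (cc s (Real.pi / 2))) (k (cc a (Real.pi / 2)))
  linarith

lemma CK_pos : 0 < CK := by unfold CK; linarith [BB_pos, KK_ge]

lemma Conf.slope {ε : ℝ} (hε : 0 < ε) : ∃ A : ℝ, 9 ≤ A ∧ ∀ (ρ₁ ρ₂ : ℝ) (F : Bool → Set ℂ) (G f : ℂ → ℂ) (σ : Bool → ℝ)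
    (Uo : Set ℂ) (K : ℂ → ℂ), Conf ρ₁ ρ₂ F G f σ Uo K → 0 < ρ₁ → A * (A * ρ₁) ≤ ρ₂ →
    ∃ θ : ℝ, ∀ w ∈ HA (A * ρ₁) (ρ₂ / A), ‖(f (K w))⁻¹ - exp (θ * I)‖ ≤ ε := by
  set c := 4 * CK + MM with hcd
  have hc : 0 < c := by linarith [CK_pos, MM_ge]
  set M := Real.exp (6 * c) * (72 * (12 * c)) with hM
  have hM0 : 0 < M := by positivity
  refine ⟨9 + 24 * c + (10 * M + 48 * c) / ε, by have : 0 < (10 * M + 48 * c) / ε := by positivity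
                                                 linarith, ?_⟩
  set A := 9 + 24 * c + (10 * M + 48 * c) / ε with hA
  intro ρ₁ ρ₂ F G f σ Uo K hK h1 hA2
  have hA0 : 0 < (10 * M + 48 * c) / ε := by positivity
  have hA9 : 9 < A := by linarith
  have hAc : 24 * c < A := by linarith
  have hAε : (10 * M + 48 * c) / A ≤ ε := by
    rw [div_le_iff₀ (by linarith)]
    have : (10 * M + 48 * c) / ε ≤ A := by linarith
    rw [div_le_iff₀ hε] at this; linarith
  have h12 : 81 * ρ₁ < ρ₂ := by nlinarith [mul_pos (sub_pos.2 hA9) h1, mul_pos (mul_pos (sub_pos.2 hA9) h1) (show 0 < A by linarith)]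
  have h2 : 0 < ρ₂ := by linarith
  set k := fun w => (f (K w))⁻¹ with hk
  have hdk : ∀ w ∈ HA ρ₁ ρ₂, deriv K w = k w := fun w hw => (hK.der w hw).deriv
  have hKd : DifferentiableOn ℂ K (HA ρ₁ ρ₂) := fun w hw => (hK.der w hw).differentiableAt.differentiableWithinAt
  have hkd : DifferentiableOn ℂ k (HA ρ₁ ρ₂) := (hKd.deriv (HA_open _ _)).congr fun w hw => (hdk w hw).symm
  have hk0 : ∀ w ∈ HA ρ₁ ρ₂, k w ≠ 0 := fun w hw => inv_ne_zero (hK.f0 w hw)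
  have yle : ∀ w : ℂ, w.im ≤ ‖w‖ := fun w => (le_abs_self _).trans (abs_im_le_norm w)
  have b1 := comp_bd (κ := k) h1 hc.le (by linarith) hkd (fun w hw ha hb => by
    have hy := hw.1
    have hin : ∀ z, ‖z - w‖ ≤ w.im / 3 → z ∈ HA ρ₁ ρ₂ ∧ ‖z‖ ≤ 4 / 3 * ‖w‖ := fun z hz => by
      have h1 := abs_le.1 ((abs_im_le_norm (z - w)).trans hz)
      rw [sub_im] at h1
      have h3 := norm_sub_norm_le w z
      have h4 := norm_sub_norm_le z w
      rw [norm_sub_rev w z] at h3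
      have := yle w
      exact ⟨⟨by linarith, by linarith, by linarith⟩, by linarith⟩
    have hcl : closedBall w (w.im / 3) ⊆ HA ρ₁ ρ₂ := fun z hz => (hin z (by simpa [dist_eq_norm] using hz)).1
    have := norm_deriv_le_of_forall_mem_sphere_norm_le (f := K) (c := w) (R := w.im / 3) (C := CK * (4 / 3 * ‖w‖)) (by linarith)
      ((hKd.mono hcl).diffContOnCl_ball subset_rfl) (fun z hz => by
        obtain ⟨i, j⟩ := hin z (by simpa [dist_eq_norm] using (mem_sphere.1 hz).le)
        have := CK_pos
        refine (hK.gr z (HA_HH _ _ i)).trans ?_; gcongr)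
    rw [hdk w hw] at this
    refine this.trans ?_
    rw [show CK * (4 / 3 * ‖w‖) / (w.im / 3) = 4 * CK * ‖w‖ / w.im by field_simp]
    have : 4 * CK ≤ c := by linarith [MM_ge]
    gcongr) (fun t i j => by simpa [hk] using (hK.lim t i j).inv₀ one_ne_zero)
  have b2 := comp_bd (κ := fun w => f (K w)) h1 hc.le (by linarith)
    ((hkd.inv hk0).congr fun w hw => by simp [hk]) (fun w hw ha hb => by
    have hy := hw.1
    refine (hK.fM w hw).trans ?_
    rw [le_div_iff₀ hy]
    have : MM ≤ c := by linarith [CK_pos]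
    have := yle w
    gcongr) hK.lim
  have hs : HA (4 * ρ₁) (ρ₂ / 4) ⊆ HA ρ₁ ρ₂ := fun w hw => ⟨hw.1, by linarith [hw.2.1], by linarith [hw.2.2]⟩
  have hl : ∀ w ∈ HA (4 * ρ₁) (ρ₂ / 4), |Real.log ‖k w‖| ≤ 12 * c * w.im * (1 / ρ₂ + ρ₁ / ‖w‖ ^ 2) := fun w hw => by
    have k0 : 0 < ‖k w‖ := norm_pos_iff.2 (hk0 w (hs hw))
    rw [abs_le]
    constructor
    · have := (Real.log_le_iff_le_exp (norm_pos_iff.2 (hK.f0 w (hs hw)))).2 (b2 w hw)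
      simp only [hk, norm_inv, Real.log_inv]; linarith
    · exact (Real.log_le_iff_le_exp k0).2 (b1 w hw)
  have hl' : ∀ w ∈ HA (4 * ρ₁) (ρ₂ / 4), |Real.log ‖k w‖| ≤ 12 * c * (‖w‖ / ρ₂ + ρ₁ / ‖w‖) := fun w hw => by
    have hw0 : 0 < ‖w‖ := by linarith [hw.2.1]
    refine (hl w hw).trans ?_
    rw [show ‖w‖ / ρ₂ + ρ₁ / ‖w‖ = ‖w‖ * (1 / ρ₂ + ρ₁ / ‖w‖ ^ 2) by field_simp, ← mul_assoc]
    have := yle w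
    gcongr
  have hkb : ∀ w ∈ HA (4 * ρ₁) (ρ₂ / 4), ‖k w‖ ≤ Real.exp (6 * c) := fun w hw => by
    have hw0 : 0 < ‖w‖ := by linarith [hw.2.1]
    refine (Real.log_le_iff_le_exp (norm_pos_iff.2 (hk0 w (hs hw)))).1 (((le_abs_self _).trans (hl' w hw)).trans ?_)
    have i : ‖w‖ / ρ₂ ≤ 1 / 4 := by rw [div_le_iff₀ h2]; linarith [hw.2.2]
    have j : ρ₁ / ‖w‖ ≤ 1 / 4 := by rw [div_le_iff₀ hw0]; linarith [hw.2.1]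
    nlinarith
  have hss : HA (2 * (4 * ρ₁)) (ρ₂ / 4 / 2) ⊆ HA (4 * ρ₁) (ρ₂ / 4) := fun w hw =>
    ⟨hw.1, by linarith [hw.2.1], by linarith [hw.2.2]⟩
  have hkp := fun w (hw : w ∈ HA (2 * (4 * ρ₁)) (ρ₂ / 4 / 2)) => kder (k := k) h1 h2 (show 0 < 12 * c by positivity) (hkd.mono hs) (fun w hw => hk0 w (hs hw)) hl hw
  have ha : 0 < A * ρ₁ := by positivity
  have haρ : A * ρ₁ / ρ₂ ≤ 1 / A := by rw [div_le_div_iff₀ h2 (by linarith)]; linarith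
  have hosc := osc (k := k) (k' := deriv k) (a₂ := 2 * (4 * ρ₁)) (b₂ := ρ₂ / 4 / 2) (a := A * ρ₁) (b := ρ₂ / A) h1 h2 hM0 ha
    (by nlinarith) (by rw [div_div]; gcongr; linarith)
    (fun w hw => (hkd.differentiableAt ((HA_open _ _).mem_nhds (hs (hss hw)))).hasDerivAt)
    (fun w hw => by
      refine (hkp w hw).trans ?_
      rw [hM, mul_assoc (Real.exp _)]
      have := hkb w (hss hw)
      gcongr)
  set w₀ := cc (A * ρ₁) (Real.pi / 2) with hw₀
  have hw0n : ‖w₀‖ = A * ρ₁ := cc_norm ha.le _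
  have hw0 : w₀ ∈ HA (4 * ρ₁) (ρ₂ / 4) := by
    refine ⟨?_, ?_, ?_⟩
    · simp only [hw₀, cc, im_ofReal_mul, exp_ofReal_mul_I_im, Real.sin_pi_div_two]; linarith
    · rw [hw0n]; nlinarith
    · rw [hw0n]; nlinarith
  have hL : |Real.log ‖k w₀‖| ≤ 24 * c / A := by
    refine (hl' w₀ hw0).trans ?_
    rw [hw0n, show ρ₁ / (A * ρ₁) = 1 / A by field_simp]
    calc _ ≤ 12 * c * (1 / A + 1 / A) := by gcongr
      _ = _ := by ring
  have hL1 : |Real.log ‖k w₀‖| ≤ 1 := hL.trans (by rw [div_le_one (by linarith)]; exact hAc.le)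
  have hn := Real.abs_exp_sub_one_le hL1
  rw [Real.exp_log (norm_pos_iff.2 (hk0 _ (hs hw0)))] at hn
  refine ⟨arg (k w₀), fun w hw => ?_⟩
  have e : ‖k w₀ - exp (arg (k w₀) * I)‖ ≤ 48 * c / A := by
    have e1 : k w₀ - exp (arg (k w₀) * I) = ((‖k w₀‖ - 1 : ℝ) : ℂ) * exp (arg (k w₀) * I) := by
      have := norm_mul_exp_arg_mul_I (k w₀)
      push_cast; rw [sub_mul, this, one_mul]
    rw [e1, norm_mul, norm_exp_ofReal_mul_I, mul_one, norm_real, Real.norm_eq_abs]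
    refine hn.trans ((mul_le_mul_of_nonneg_left hL (by norm_num)).trans_eq (by ring))
  refine (norm_sub_le_norm_sub_add_norm_sub _ (k w₀) _).trans (le_trans ?_ hAε)
  have h5 := hosc w hw
  rw [show ρ₂ / A / ρ₂ + ρ₁ / (A * ρ₁) = 2 / A by field_simp; norm_num] at h5
  refine (add_le_add h5 e).trans_eq (by ring)

lemma solveE {V : Type*} [NormedAddCommGroup V] [CompleteSpace V] {E : V → V} {c : ℝ≥0} (hc : c < 1)
    (hE : LipschitzWith c E) (z : V) : ∃ x, x + E x = z := by
  have : ContractingWith c (fun x => z - E x) := ⟨hc, LipschitzWith.of_dist_le_mul fun x y => by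
    rw [dist_sub_left]; exact hE.dist_le_mul x y⟩
  refine ⟨this.fixedPoint, ?_⟩
  have h := this.fixedPoint_isFixedPt
  rw [Function.IsFixedPt] at h
  nth_rw 1 [← h]; abel

lemma graphE {E : ℂ → ℂ} {c : ℝ≥0} (hc : c ≤ 1 / 4) (hE : LipschitzWith c E) (hd : ∀ t : ℝ, DifferentiableAt ℝ (fun s : ℝ => E s) t) :
    ∃ g : ℝ → ℝ, Differentiable ℝ g ∧ (∀ x, |deriv g x| ≤ 2 * c) ∧
      ∀ z, ∃ w, w + E w = z ∧ (0 < w.im ↔ g z.re < z.im) := by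
  have hc' : (c : ℝ) ≤ 1 / 4 := by exact_mod_cast hc
  have hc1 : c < 1 := hc.trans_lt (by rw [one_div]; exact inv_lt_one_of_one_lt₀ (by norm_num))
  have hEn : ∀ z w, ‖E z - E w‖ ≤ c * ‖z - w‖ := fun z w => by simpa [dist_eq_norm] using hE.dist_le_mul z w
  have hrn : ∀ s t : ℝ, ‖E s - E t‖ ≤ c * |s - t| := fun s t => by
    have := hEn s t; rwa [← ofReal_sub, norm_real, Real.norm_eq_abs] at this
  have hre : LipschitzWith c (fun s : ℝ => (E s).re) := LipschitzWith.of_dist_le_mul fun s t => by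
    rw [Real.dist_eq, Real.dist_eq, ← sub_re]; exact (abs_re_le_norm _).trans (hrn s t)
  choose T hT using solveE hc1 hre
  have hTl : ∀ x y, |T x - T y| ≤ 4 / 3 * |x - y| := fun x y => by
    have h1 := hre.dist_le_mul (T x) (T y)
    rw [Real.dist_eq, Real.dist_eq] at h1
    have h2 : T x - T y = (x - y) - ((E (T x)).re - (E (T y)).re) := by linarith [hT x, hT y]
    have h3 := abs_sub (x - y) ((E (T x)).re - (E (T y)).re)
    rw [← h2] at h3
    nlinarith [abs_nonneg (T x - T y)]
  have hTc : Continuous T := (LipschitzWith.of_dist_le_mul (K := 4 / 3) fun x y => by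
    rw [Real.dist_eq, Real.dist_eq]; simpa using hTl x y).continuous
  have hdre : ∀ t, DifferentiableAt ℝ (fun s : ℝ => (E s).re) t := fun t => reCLM.differentiableAt.comp t (hd t)
  have hTd : Differentiable ℝ T := fun x => by
    have h1 := (hasDerivAt_id (T x)).add (hdre (T x)).hasDerivAt
    refine (HasDerivAt.of_local_left_inverse hTc.continuousAt h1 (fun h => ?_) (Eventually.of_forall hT)).differentiableAt
    have := norm_deriv_le_of_lipschitz (x₀ := T x) hre
    rw [Real.norm_eq_abs, abs_le] at this
    linarith
  have hgd : Differentiable ℝ (fun x => (E (T x)).im) := fun x =>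
    (imCLM.differentiableAt.comp (T x) (hd (T x))).comp x (hTd x)
  refine ⟨fun x => (E (T x)).im, hgd, fun x => ?_, fun z => ?_⟩
  · have : LipschitzWith (2 * c) (fun x => (E (T x)).im) := LipschitzWith.of_dist_le_mul fun x y => by
      rw [Real.dist_eq, Real.dist_eq, ← sub_im]
      refine (abs_im_le_norm _).trans ((hrn _ _).trans ?_)
      have := hTl x y
      have := abs_nonneg (x - y)
      push_cast
      nlinarith [c.2, mul_nonneg c.2 this]
    simpa using norm_deriv_le_of_lipschitz (x₀ := x) this
  · obtain ⟨w, hw⟩ := solveE hc1 hE z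
    refine ⟨w, hw, ?_⟩
    set x : ℂ := (T z.re : ℂ) with hx
    set τ := z.im - (E x).im with hτ
    have e : w - x + (E w - E x) = (τ : ℂ) * I := by
      have h1 : x + E x = z.re + (E x).im * I := by
        apply Complex.ext
        · simp [hx, hT z.re]
        · simp [hx]
      have h2 : z = z.re + z.im * I := (re_add_im z).symm
      have : w - x + (E w - E x) = (w + E w) - (x + E x) := by ring
      rw [this, hw, h1]
      have h3 : (τ : ℂ) = z.im - (E x).im := by rw [hτ]; push_cast; rfl
      rw [h3]; linear_combination h2
    have h1 := hEn w x
    have h2 : ‖w - x‖ ≤ |τ| + ‖E w - E x‖ := by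
      have : w - x = (τ : ℂ) * I - (E w - E x) := by rw [← e]; ring
      rw [this]; refine (norm_sub_le _ _).trans_eq (by simp)
    have h3 : ‖E w - E x‖ ≤ |τ| / 3 := by nlinarith [norm_nonneg (w - x)]
    have h4 := abs_le.1 ((abs_im_le_norm _).trans h3)
    have h5 : w.im + (E w - E x).im = τ := by
      have := congrArg Complex.im e; simpa [hx] using this
    have h6 : (0 < τ ↔ (E x).im < z.im) := by rw [hτ, sub_pos]
    rw [← h6]
    constructor
    · intro h; by_contra h7; rw [abs_of_nonpos (not_lt.1 h7)] at h4; linarith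
    · intro h; rw [abs_of_pos h] at h4; linarith

noncomputable def bmp : ContDiffBump (0 : ℂ) := ⟨1, 2, one_pos, one_lt_two⟩

lemma bmp_lip : ∃ L : ℝ≥0, LipschitzWith L bmp :=
  ContDiff.lipschitzWith_of_hasCompactSupport bmp.hasCompactSupport (bmp.contDiff (n := 1)) one_ne_zero

noncomputable def LB : ℝ≥0 := bmp_lip.choose

noncomputable def cutE (s : ℝ) (E : ℂ → ℂ) (w : ℂ) : ℂ := (bmp ((s : ℂ)⁻¹ * w) : ℂ) * E w

lemma bmp_one {s : ℝ} (hs : 0 < s) {w : ℂ} (h : ‖w‖ ≤ s) : bmp ((s : ℂ)⁻¹ * w) = 1 :=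
  bmp.one_of_mem_closedBall (by
    simp only [mem_closedBall, dist_zero_right, norm_mul, norm_inv, norm_real, Real.norm_eq_abs, abs_of_pos hs]
    rw [inv_mul_le_iff₀ hs]; simpa [bmp] using h)

lemma bmp_zero {s : ℝ} (hs : 0 < s) {w : ℂ} (h : 2 * s ≤ ‖w‖) : bmp ((s : ℂ)⁻¹ * w) = 0 :=
  bmp.zero_of_le_dist (by
    simp only [dist_zero_right, norm_mul, norm_inv, norm_real, Real.norm_eq_abs, abs_of_pos hs]
    rw [le_inv_mul_iff₀ hs]; simpa [bmp, mul_comm] using h)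

lemma cutE_lip {s : ℝ} (hs : 0 < s) {E : ℂ → ℂ} {c : ℝ≥0} (hE : LipschitzWith c E) (h0 : E 0 = 0) :
    LipschitzWith (c * (1 + 2 * LB)) (cutE s E) := by
  have key : ∀ w w' : ℂ, ‖w'‖ ≤ ‖w‖ → ‖cutE s E w - cutE s E w'‖ ≤ c * (1 + 2 * LB) * ‖w - w'‖ := fun w w' hww => by
    have hEn : ∀ z w, ‖E z - E w‖ ≤ c * ‖z - w‖ := fun z w => by simpa [dist_eq_norm] using hE.dist_le_mul z w
    have e : cutE s E w - cutE s E w' = (bmp ((s : ℂ)⁻¹ * w) : ℂ) * (E w - E w') +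
        ((bmp ((s : ℂ)⁻¹ * w) - bmp ((s : ℂ)⁻¹ * w') : ℝ) : ℂ) * E w' := by simp only [cutE]; push_cast; ring
    have h1 : ‖(bmp ((s : ℂ)⁻¹ * w) : ℂ) * (E w - E w')‖ ≤ 1 * (c * ‖w - w'‖) := by
      rw [norm_mul, norm_real, Real.norm_eq_abs, abs_of_nonneg bmp.nonneg]
      exact mul_le_mul bmp.le_one (hEn _ _) (norm_nonneg _) zero_le_one
    have h2 : ‖((bmp ((s : ℂ)⁻¹ * w) - bmp ((s : ℂ)⁻¹ * w') : ℝ) : ℂ) * E w'‖ ≤ 2 * LB * c * ‖w - w'‖ := by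
      rcases le_or_gt (2 * s) ‖w'‖ with h | h
      · rw [bmp_zero hs h, bmp_zero hs (h.trans hww)]; simp; positivity
      · have h3 := bmp_lip.choose_spec.dist_le_mul ((s : ℂ)⁻¹ * w) ((s : ℂ)⁻¹ * w')
        rw [Real.dist_eq, dist_eq_norm, ← mul_sub, norm_mul, norm_inv, norm_real, Real.norm_eq_abs, abs_of_pos hs] at h3
        have h4 := hEn w' 0
        rw [h0, sub_zero, sub_zero] at h4
        rw [norm_mul, norm_real, Real.norm_eq_abs]
        calc _ ≤ (LB * (s⁻¹ * ‖w - w'‖)) * (c * (2 * s)) := by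
              refine mul_le_mul h3 (h4.trans (by gcongr)) (norm_nonneg _) (by positivity)
          _ = _ := by field_simp
    rw [e]
    refine (norm_add_le _ _).trans ((add_le_add h1 h2).trans_eq (by ring))
  refine LipschitzWith.of_dist_le_mul fun w w' => ?_
  rw [dist_eq_norm, dist_eq_norm]; push_cast
  rcases le_total ‖w'‖ ‖w‖ with h | h
  · exact key w w' h
  · rw [norm_sub_rev, norm_sub_rev w]; exact key w' w h

lemma bmp_diff (s : ℝ) (t : ℝ) : DifferentiableAt ℝ (fun x : ℝ => (bmp ((s : ℂ)⁻¹ * x) : ℂ)) t := by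
  have h1 : Differentiable ℝ bmp := (bmp.contDiff (n := 1)).differentiable one_ne_zero
  have h2 : Differentiable ℝ (fun x : ℝ => (s : ℂ)⁻¹ * (x : ℂ)) := ofRealCLM.differentiable.const_mul _
  exact ofRealCLM.differentiableAt.comp t ((h1.comp h2) t)

noncomputable def LX : ℝ≥0 := lipschitzExtensionConstant ℂ * (1 + (1 + 2 * LB)) * (1 + 2 * LB)

lemma extE {φ : ℂ → ℂ} {a b : ℝ} {c : ℝ≥0} (ha : 0 < a) (hab : 16 * a < b) (hL : LipschitzOnWith c φ (HH a b))
    (hd : ∀ t : ℝ, a < |t| → |t| < b → DifferentiableAt ℝ (fun s : ℝ => φ s) t) :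
    ∃ E : ℂ → ℂ, LipschitzWith (c * LX) E ∧ (∀ t : ℝ, DifferentiableAt ℝ (fun s : ℝ => E s) t) ∧
      ∀ w ∈ HH (4 * a) (b / 4), E w = φ w := by
  obtain ⟨e, he, heq⟩ := hL.extend_finite_dimension
  set e₀ := fun w => e w - e 0 with he0
  have he₀ : LipschitzWith (lipschitzExtensionConstant ℂ * c) e₀ := LipschitzWith.of_dist_le_mul fun x y => by
    simpa [he0] using he.dist_le_mul x y
  have hb : 0 < b / 4 := by linarith
  set e₁ := fun w => e₀ w - cutE (2 * a) e₀ w with he1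
  have he₁ := he₀.sub (cutE_lip (s := 2 * a) (by linarith) he₀ (by simp [he0]))
  have he₂ := cutE_lip hb he₁ (by simp [he0, cutE])
  have z1 : ∀ w, ‖w‖ ≤ 2 * a → e₁ w = 0 := fun w h => by
    simp only [he1, cutE]; rw [bmp_one (show 0 < 2 * a by linarith) h]; simp
  refine ⟨fun w => e 0 + cutE (b / 4) e₁ w, LipschitzWith.of_dist_le_mul fun x y => ?_, fun t => ?_, fun w hw => ?_⟩
  · rw [dist_add_left]
    refine (he₂.dist_le_mul x y).trans_eq ?_
    simp only [LX]; push_cast; ring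
  · refine DifferentiableAt.const_add _ ?_
    rcases lt_or_ge |t| (2 * a) with h | h
    · refine (differentiableAt_const (0 : ℂ)).congr_of_eventuallyEq ?_
      filter_upwards [(isOpen_lt continuous_abs continuous_const).mem_nhds h] with x hx
      simp only [cutE]; rw [z1 x (by simpa using (show |x| < 2 * a from hx).le), mul_zero]
    rcases lt_or_ge |t| b with h' | h'
    · refine (bmp_diff _ _).mul ?_
      have h1 : DifferentiableAt ℝ (fun s : ℝ => e₀ s) t := by
        refine ((hd t (by linarith) h').sub_const (e 0)).congr_of_eventuallyEq ?_
        filter_upwards [(isOpen_lt continuous_abs continuous_const).mem_nhds h',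
          (isOpen_lt continuous_const continuous_abs).mem_nhds (show a < |t| by linarith)] with x h1 h2
        simp only [he0]; rw [heq ⟨by simp, by simpa using h2, by simpa using h1⟩]
      exact h1.sub ((bmp_diff _ _).mul h1)
    · refine (differentiableAt_const (0 : ℂ)).congr_of_eventuallyEq ?_
      filter_upwards [(isOpen_lt continuous_const continuous_abs).mem_nhds (show b / 2 < |t| by linarith)] with x hx
      have hx' : b / 2 < |x| := hx
      simp only [cutE]; rw [bmp_zero hb (by simp only [norm_real, Real.norm_eq_abs]; linarith)]; simp
  · have h1 := hw.2.1
    have h2 := hw.2.2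
    simp only [cutE, he1]
    rw [bmp_one hb h2.le, bmp_zero (s := 2 * a) (by linarith) (by linarith), heq ⟨hw.1, by linarith, by linarith⟩]
    simp [he0]

section
variable {δ r ρ₁ ρ₂ : ℝ} {U : Set ℂ} {F : Bool → Set ℂ} {G f K : ℂ → ℂ} {p : Bool → ℂ} {σ : Bool → ℝ}
  {α Ui Uo : Set ℂ}

lemma qconv {K k : ℂ → ℂ} {a b η : ℝ} {L : ℂ} (hK : ∀ w ∈ HA a b, HasDerivAt K (k w) w) (hb : ∀ w ∈ HA a b, ‖k w - L‖ ≤ η)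
    {w w' : ℂ} (hw : w ∈ HA (2 * a) (b / 3)) (hw' : w' ∈ HA (2 * a) (b / 3)) :
    ‖K w' - K w - L * (w' - w)‖ ≤ 3 * η * ‖w' - w‖ := by
  set d := ‖w' - w‖ with hd
  have d0 : 0 ≤ d := norm_nonneg _
  have db : d ≤ 2 * (b / 3) := (norm_sub_le _ _).trans (by linarith [hw.2.2, hw'.2.2])
  have e0 : ‖((d : ℝ) : ℂ) * I‖ = d := by simp [abs_of_nonneg d0]
  have up : ∀ v ∈ HA (2 * a) (b / 3), ∀ x ∈ segment ℝ v (v + d * I), x ∈ HA a b ∧ ‖k x - L‖ ≤ η := fun v hv x hx => by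
    obtain ⟨t, ht, rfl⟩ := segm_sg hx
    have e : sg v (v + d * I) t = v + ((t * d : ℝ) : ℂ) * I := by simp [sg]; ring
    rw [e]
    have t0 : 0 ≤ t * d := mul_nonneg ht.1 d0
    have t1 : t * d ≤ d := mul_le_of_le_one_left d0 ht.2
    have i1 : (v + ((t * d : ℝ) : ℂ) * I).im = v.im + t * d := by simp
    have n1 : ‖v‖ ≤ ‖v + ((t * d : ℝ) : ℂ) * I‖ := by
      rw [← sq_le_sq₀ (norm_nonneg _) (norm_nonneg _), ← normSq_eq_norm_sq, ← normSq_eq_norm_sq, normSq_apply, normSq_apply, i1]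
      have := hv.1
      simp; nlinarith
    have n2 : ‖v + ((t * d : ℝ) : ℂ) * I‖ ≤ ‖v‖ + t * d := (norm_add_le _ _).trans_eq (by simp [abs_of_nonneg d0, abs_of_nonneg ht.1])
    have := hv.2.1; have := hv.2.2
    have hin : v + ((t * d : ℝ) : ℂ) * I ∈ HA a b := ⟨by rw [i1]; linarith [hv.1], by
      have := norm_nonneg v
      rcases le_or_gt 0 a with h | h <;> linarith, by linarith⟩
    exact ⟨hin, hb _ hin⟩
  have m1 := seg_mvt hK (up w hw)
  have m3 := seg_mvt hK (up w' hw')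
  have m2 := seg_mvt hK (a := w + d * I) (b := w' + d * I) (L := L) (η := η) (fun x hx => by
    obtain ⟨t, ht, rfl⟩ := segm_sg hx
    have e : sg (w + d * I) (w' + d * I) t = w + d * I + t * (w' - w) := by simp [sg]
    rw [e]
    have i1 : (w + d * I + t * (w' - w)).im = (1 - t) * w.im + t * w'.im + d := by simp; ring
    have i2 : d ≤ (w + d * I + t * (w' - w)).im := by
      rw [i1]; linarith [mul_nonneg (sub_nonneg.2 ht.2) hw.1.le, mul_nonneg ht.1 hw'.1.le]
    have i3 : 0 < (w + d * I + t * (w' - w)).im := by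
      rw [i1]
      have := hw.1; have := hw'.1
      rcases ht.1.eq_or_lt with h | h
      · rw [← h]; linarith
      · linarith [mul_nonneg (sub_nonneg.2 ht.2) hw.1.le, mul_pos h hw'.1]
    have i4 := (le_abs_self _).trans (abs_im_le_norm (w + d * I + t * (w' - w)))
    have n0 : ‖(t : ℂ) * (w' - w)‖ ≤ d := by
      rw [norm_mul, norm_real, Real.norm_eq_abs, abs_of_nonneg ht.1]; exact mul_le_of_le_one_left d0 ht.2
    have n1 : ‖w + d * I‖ ≤ ‖w + d * I + t * (w' - w)‖ + d := by
      have := norm_sub_le (w + d * I + t * (w' - w)) (t * (w' - w))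
      rw [add_sub_cancel_right] at this; linarith
    have n2 : ‖w‖ ≤ ‖w + d * I‖ := by
      rw [← sq_le_sq₀ (norm_nonneg _) (norm_nonneg _), ← normSq_eq_norm_sq, ← normSq_eq_norm_sq, normSq_apply, normSq_apply]
      have := hw.1
      simp; nlinarith
    have n3 : ‖w + d * I + t * (w' - w)‖ < b := by
      have e2 : w + d * I + t * (w' - w) = ((1 - t : ℝ) : ℂ) * w + ((t : ℝ) : ℂ) * w' + d * I := by push_cast; ring
      rw [e2]
      refine (norm_add_le _ _).trans_lt ((add_le_add_left (norm_add_le _ _) _).trans_lt ?_)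
      rw [e0, norm_mul, norm_mul, norm_real, norm_real, Real.norm_eq_abs, Real.norm_eq_abs, abs_of_nonneg ht.1, abs_of_nonneg (sub_nonneg.2 ht.2)]
      have h1 := hw.2.2; have h2 := hw'.2.2
      have h3 : (1 - t) * ‖w‖ + t * ‖w'‖ < b / 3 := by
        rcases ht.1.eq_or_lt with h | h
        · rw [← h]; linarith
        · nlinarith [mul_le_mul_of_nonneg_left h1.le (sub_nonneg.2 ht.2), mul_lt_mul_of_pos_left h2 h]
      linarith
    have hin : w + d * I + t * (w' - w) ∈ HA a b := ⟨i3, by linarith [hw.2.1], n3⟩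
    exact ⟨hin, hb _ hin⟩)
  rw [add_sub_cancel_left, e0] at m1 m3
  rw [add_sub_add_right_eq_sub, ← hd] at m2
  have e : K w' - K w - L * (w' - w) = (K (w + d * I) - K w - L * (d * I)) + (K (w' + d * I) - K (w + d * I) - L * (w' - w))
    - (K (w' + d * I) - K w' - L * (d * I)) := by ring
  rw [e]
  refine (norm_sub_le _ _).trans ?_
  have := norm_add_le (K (w + d * I) - K w - L * (d * I)) (K (w' + d * I) - K (w + d * I) - L * (w' - w))
  linarith

lemma Conf.qconvH (hK : Conf ρ₁ ρ₂ F G f σ Uo K) {a b η : ℝ} {L : ℂ} (ha0 : 0 ≤ a) (ha : ρ₁ ≤ a) (hb' : b ≤ ρ₂) (hb : ∀ w ∈ HA a b, ‖(f (K w))⁻¹ - L‖ ≤ η)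
    {w w' : ℂ} (hw : w ∈ HH (2 * a) (b / 3)) (hw' : w' ∈ HH (2 * a) (b / 3)) :
    ‖K w' - K w - L * (w' - w)‖ ≤ 3 * η * ‖w' - w‖ := by
  have hs : HA a b ⊆ HA ρ₁ ρ₂ := fun w hw => ⟨hw.1, ha.trans_lt hw.2.1, hw.2.2.trans_le hb'⟩
  have ap : ∀ v ∈ HH (2 * a) (b / 3), Tendsto (fun t : ℝ => v + t * I) (𝓝[>] 0) (𝓝 v) ∧
      ∀ᶠ t : ℝ in 𝓝[>] 0, v + t * I ∈ HA (2 * a) (b / 3) := fun v hv => by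
    have ht : Tendsto (fun t : ℝ => v + t * I) (𝓝[>] 0) (𝓝 v) := by
      have : Continuous (fun t : ℝ => v + t * I) := by fun_prop
      simpa using (this.tendsto 0).mono_left nhdsWithin_le_nhds
    refine ⟨ht, ?_⟩
    filter_upwards [ht.norm.eventually (Ioo_mem_nhds hv.2.1 hv.2.2), self_mem_nhdsWithin] with t h1 h2
    exact ⟨by simpa using add_pos_of_nonneg_of_pos hv.1 h2, h1⟩
  have kt : ∀ v ∈ HH (2 * a) (b / 3), Tendsto (fun t : ℝ => K (v + t * I)) (𝓝[>] 0) (𝓝 (K v)) := fun v hv => by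
    have hv0 : v ∈ HH ρ₁ ρ₂ := ⟨hv.1, by linarith [hv.2.1], by
      have := norm_nonneg v
      linarith [hv.2.2]⟩
    refine (hK.co v hv0).tendsto.comp (tendsto_nhdsWithin_iff.2 ⟨(ap v hv).1, ?_⟩)
    filter_upwards [(ap v hv).2] with t ht
    exact ⟨ht.1.le, by linarith [ht.2.1], by
      have := norm_nonneg (v + t * I)
      linarith [ht.2.2]⟩
  have d := (ap w' hw').1.sub (ap w hw).1
  refine le_of_tendsto_of_tendsto (((kt w' hw').sub (kt w hw)).sub (d.const_mul L)).norm (d.norm.const_mul (3 * η)) ?_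
  filter_upwards [(ap w hw).2, (ap w' hw').2] with t h1 h2
  exact qconv (fun w hw => hK.der w (hs hw)) hb h1 h2

lemma Conf.rdiff (hK : Conf ρ₁ ρ₂ F G f σ Uo K) (h : Sol δ U F G f) (hC : Cut δ r U F G p σ α Ui Uo) {t : ℝ} (h1 : ρ₁ < |t|) (h2 : |t| < ρ₂) :
    DifferentiableAt ℝ (fun s : ℝ => K s) t := by
  obtain ⟨j, hj, -⟩ := hK.real t h1 h2
  obtain ⟨L, hL, -, hx⟩ := h.exp1 hj
  have hm : ∀ᶠ s : ℝ in 𝓝 t, (s : ℂ) ∈ HH ρ₁ ρ₂ := by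
    filter_upwards [(isOpen_lt continuous_abs continuous_const).mem_nhds h2,
      (isOpen_lt continuous_const continuous_abs).mem_nhds h1] with s i j
    exact ⟨by simp, by simpa using j, by simpa using i⟩
  have hKc : Tendsto (fun s : ℝ => K s) (𝓝 t) (𝓝 (K t)) :=
    (hK.co t hm.self_of_nhds).tendsto.comp (tendsto_nhdsWithin_iff.2 ⟨continuous_ofReal.continuousAt, hm⟩)
  have hKX : ∀ s : ℝ, (s : ℂ) ∈ HH ρ₁ ρ₂ → K s ∈ U ∪ ⋃ i, F i := fun s hs => hC.inX h (hK.cl _ hs) (hK.n2 _ hs).le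
  refine HasDerivAt.differentiableAt (f' := L⁻¹) ?_
  rw [hasDerivAt_iff_isLittleO, Asymptotics.isLittleO_iff]
  intro η hη
  obtain ⟨ρ, hρ, hb⟩ := hx (min (η / 2) (1 / 2)) (by positivity)
  filter_upwards [hm, hKc.eventually (ball_mem_nhds _ hρ)] with s i k
  have h3 := hb _ ⟨hKX t hm.self_of_nhds, mem_ball_self hρ⟩ _ ⟨hKX s i, k⟩
  rw [hK.inv _ i, hK.inv _ hm.self_of_nhds] at h3
  have L0 : L ≠ 0 := fun h => by simp [h] at hL
  have e : K s - K t - (s - t) • L⁻¹ = -(L⁻¹ * ((s : ℂ) - t - L * (K s - K t))) := by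
    rw [real_smul]; push_cast; field_simp; ring
  have e2 : ‖(s : ℂ) - t - L * (K s - K t)‖ = ‖K s - K t - (s - t) • L⁻¹‖ := by
    rw [e, norm_neg, norm_mul, norm_inv, hL, inv_one, one_mul]
  rw [e2] at h3
  have h4 : ‖(s - t) • L⁻¹‖ = ‖s - t‖ := by rw [norm_smul, norm_inv, hL]; simp
  have h5 := norm_sub_norm_le (K s - K t) ((s - t) • L⁻¹)
  rw [h4] at h5
  have m1 := min_le_left (η / 2) (1 / 2)
  have m2 := min_le_right (η / 2) (1 / 2)
  have n0 := norm_nonneg (K s - K t)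
  have h6 : ‖K s - K t‖ ≤ 2 * ‖s - t‖ := by nlinarith
  nlinarith

lemma Conf.model {ε : ℝ} (hε : 0 < ε) : ∃ A : ℝ, 9 ≤ A ∧ ∀ (δ r ρ₁ ρ₂ : ℝ) (U : Set ℂ) (F : Bool → Set ℂ) (G f : ℂ → ℂ) (p : Bool → ℂ)
    (σ : Bool → ℝ) (α Ui Uo : Set ℂ) (K : ℂ → ℂ), Sol δ U F G f → Cut δ r U F G p σ α Ui Uo → Conf ρ₁ ρ₂ F G f σ Uo K → 0 < ρ₁ →
    A * (A * ρ₁) * 96 < ρ₂ → ∃ (θ : ℝ) (g : ℝ → ℝ) (E : ℂ → ℂ), Differentiable ℝ g ∧ (∀ x, |deriv g x| ≤ ε) ∧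
      (∀ w w', ‖E w - E w'‖ ≤ 1 / 8 * ‖w - w'‖) ∧ (∀ w ∈ HH (8 * A * ρ₁) (ρ₂ / (12 * A)), exp (θ * I) * (w + E w) = K w) ∧
      ∀ z, ∃ w, w + E w = z ∧ (0 < w.im ↔ g z.re < z.im) := by
  set c₁ : ℝ := min (ε / 2) (1 / 8) with hc1
  have hc0 : 0 < c₁ := by positivity
  set η : ℝ := c₁ / (LX + 1) / 3 with hη
  have hη0 : 0 < η := by positivity
  obtain ⟨A, hA, hs⟩ := Conf.slope hη0
  refine ⟨A, hA, fun δ r ρ₁ ρ₂ U F G f p σ α Ui Uo K h hC hK hρ hAρ => ?_⟩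
  have hAρ0 : 0 < A * ρ₁ := by positivity
  obtain ⟨θ, hθ⟩ := hs ρ₁ ρ₂ F G f σ Uo K hK hρ (by nlinarith)
  have hρ2 : 0 < ρ₂ := by nlinarith
  set φ := fun w => exp (-(θ * I)) * K w - w with hφ
  have ee : exp (-(θ * I)) * exp (θ * I) = 1 := by rw [← exp_add]; simp
  have ee' : exp (θ * I) * exp (-(θ * I)) = 1 := by rw [mul_comm]; exact ee
  have hbA : ρ₂ / A ≤ ρ₂ := div_le_self hρ2.le (by linarith)
  have haA : ρ₁ ≤ A * ρ₁ := by nlinarith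
  have hL : LipschitzOnWith (3 * η).toNNReal φ (HH (2 * (A * ρ₁)) (ρ₂ / A / 3)) := LipschitzOnWith.of_dist_le_mul fun w' hw' w hw => by
    have := hK.qconvH hAρ0.le haA hbA hθ hw hw'
    rw [dist_eq_norm, dist_eq_norm, Real.coe_toNNReal _ (by positivity)]
    have e : φ w' - φ w = exp (-(θ * I)) * (K w' - K w - exp (θ * I) * (w' - w)) := by
      simp only [hφ]; linear_combination (w' - w) * ee
    rw [e, norm_mul, show -((θ : ℂ) * I) = ((-θ : ℝ) : ℂ) * I by push_cast; ring, norm_exp_ofReal_mul_I, one_mul]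
    exact this
  have hAA : 16 * (2 * (A * ρ₁)) < ρ₂ / A / 3 := by
    rw [div_div, lt_div_iff₀ (by positivity)]; linarith
  obtain ⟨E, hE, hEd, hEφ⟩ := extE (by positivity) hAA hL (fun t h1 h2 => by
    have h2' : |t| < ρ₂ := by have := abs_nonneg t; linarith
    exact ((hK.rdiff h hC (by linarith) h2').const_mul _).sub ofRealCLM.differentiableAt)
  have hcE : (((3 * η).toNNReal * LX : ℝ≥0) : ℝ) ≤ c₁ := by
    push_cast; rw [Real.coe_toNNReal _ (by positivity), hη, show 3 * (c₁ / (LX + 1) / 3) * LX = c₁ * (LX / (LX + 1) : ℝ) by field_simp]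
    refine mul_le_of_le_one_right hc0.le ((div_le_one (by positivity)).2 (by linarith))
  have m1 := min_le_left (ε / 2) (1 / 8)
  have m2 := min_le_right (ε / 2) (1 / 8)
  obtain ⟨g, hg, hg', hgz⟩ := graphE (by rw [← NNReal.coe_le_coe]; push_cast at hcE ⊢; linarith) hE hEd
  refine ⟨θ, g, E, hg, fun x => (hg' x).trans (by linarith), fun w w' => ?_, fun w hw => ?_, hgz⟩
  · have := hE.dist_le_mul w w'
    rw [dist_eq_norm, dist_eq_norm] at this
    exact this.trans (mul_le_mul_of_nonneg_right (hcE.trans m2) (norm_nonneg _))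
  · rw [hEφ w ⟨hw.1, by linarith [hw.2.1], hw.2.2.trans_eq (by field_simp; norm_num)⟩]
    simp only [hφ]; linear_combination K w * ee'
end

lemma HA_pre {a : ℝ} (ha : 0 ≤ a) (b : ℝ) : IsPreconnected (HA a b) := by
  have : HA a b = (fun x : ℝ × ℝ => cc x.1 x.2) '' (Ioo a b ×ˢ Ioo 0 Real.pi) := by
    ext w; constructor
    · rintro ⟨h0, h1, h2⟩
      refine ⟨(‖w‖, arg w), ⟨⟨h1, h2⟩, (arg_nonneg_iff.2 h0.le).lt_of_ne fun h => ?_, (arg_le_pi w).lt_of_ne fun h => ?_⟩,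
        norm_mul_exp_arg_mul_I w⟩
      · exact h0.ne' (arg_eq_zero_iff.1 h.symm).2
      · exact h0.ne' (arg_eq_pi_iff.1 h).2
    · rintro ⟨⟨s, θ⟩, ⟨⟨h1, h2⟩, h3, h4⟩, rfl⟩
      simp only at h1 h2 h3 h4
      have hs : 0 < s := ha.trans_lt h1
      refine ⟨?_, by simpa [cc_norm hs.le] using h1, by simpa [cc_norm hs.le] using h2⟩
      simp only [cc, im_ofReal_mul, exp_ofReal_mul_I_im]
      exact mul_pos hs (Real.sin_pos_of_pos_of_lt_pi h3 h4)
  rw [this]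
  refine ((isPreconnected_Ioo).prod isPreconnected_Ioo).image _ (Continuous.continuousOn ?_)
  unfold cc; fun_prop

lemma ray_mono {x y e₁ e₂ : ℂ} {t : ℝ} (ht : 0 ≤ t) (hy : y = t * x) (h1 : ‖e₁‖ ≤ ‖x‖ / 4) (h2 : ‖e₂‖ ≤ ‖y‖ / 4) :
    ‖x + e₁‖ ≤ ‖x + e₁ + (y + e₂)‖ := by
  have hyn : ‖y‖ = t * ‖x‖ := by rw [hy, norm_mul, norm_real, Real.norm_eq_abs, abs_of_nonneg ht]
  have hin : 0 ≤ inner ℝ (x + e₁) (y + e₂) := by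
    rw [inner_add_left, inner_add_right, inner_add_right]
    have a1 : inner ℝ x y = ‖x‖ * ‖y‖ := by
      rw [hyn, hy, ← real_smul, inner_smul_right, real_inner_self_eq_norm_sq]; ring
    have a2 := abs_le.1 (abs_real_inner_le_norm x e₂)
    have a3 := abs_le.1 (abs_real_inner_le_norm e₁ y)
    have a4 := abs_le.1 (abs_real_inner_le_norm e₁ e₂)
    have b2 := mul_le_mul_of_nonneg_left h2 (norm_nonneg x)
    have b3 := mul_le_mul_of_nonneg_right h1 (norm_nonneg y)
    have b4 := mul_le_mul h1 h2 (norm_nonneg e₂) (by positivity)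
    nlinarith [mul_nonneg (norm_nonneg x) (norm_nonneg y)]
  rw [← sq_le_sq₀ (norm_nonneg _) (norm_nonneg _), norm_add_sq_real (x + e₁)]
  nlinarith [sq_nonneg ‖y + e₂‖]

section
variable {δ r ρ₁ ρ₂ : ℝ} {U : Set ℂ} {F : Bool → Set ℂ} {G f K : ℂ → ℂ} {p : Bool → ℂ} {σ : Bool → ℝ}
  {α Ui Uo : Set ℂ}

lemma comp_cl {W T : Set ℂ} {z₀ : ℂ} (hW : IsOpen W) (hT : T = connectedComponentIn W z₀) : IsOpen T ∧ IsOpen (W \ T) := by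
  refine ⟨hT ▸ hW.connectedComponentIn, ?_⟩
  rw [isOpen_iff_mem_nhds]
  intro x hx
  filter_upwards [(hW.connectedComponentIn (x := x)).mem_nhds (mem_connectedComponentIn hx.1)] with y hy
  refine ⟨connectedComponentIn_subset _ _ hy, fun hyT => hx.2 ?_⟩
  rw [hT] at hyT ⊢
  rw [connectedComponentIn_eq hyT, ← connectedComponentIn_eq hy]
  exact mem_connectedComponentIn hx.1

lemma Conf.reach (h : Sol δ U F G f) (hC : Cut δ r U F G p σ α Ui Uo) (h0 : G (p true) = 0) (hP : Par δ r ρ₁ ρ₂)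
    (hK : Conf ρ₁ ρ₂ F G f σ Uo K) {T : Set ℂ} {R : ℝ} (hR : R < ρ₂) (hR1 : 16 * ρ₁ < R) (hρ : (1 + 2 * Real.pi * MM) * r ≤ ρ₁)
    (hTU : T ⊆ U ∩ ball 0 R) (hTo : IsOpen T) (hTc : IsOpen ((U ∩ ball 0 R) \ T))
    (hTδ : (closure T ∩ sphere 0 δ).Nonempty) : ∃ t : ℝ, |t| = R / 4 ∧ ∀ᶠ z in 𝓝 (K t), z ∈ U → z ∈ T := by
  obtain ⟨y, hyT, hyδ⟩ := hTδ
  obtain ⟨δ', hδ', hin, hinF⟩ := hC.inn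
  obtain ⟨z, hz, hzT⟩ := mem_closure_iff_nhds.1 hyT _ (ball_mem_nhds y (sub_pos.2 hδ'))
  have hρ1 : 0 < ρ₁ := hP.m0.trans hP.l1
  have hb4 := hP.b4
  have hzd : ‖z‖ < δ' := by
    have h1 := norm_sub_norm_le z y
    rw [mem_ball, dist_eq_norm] at hz
    rw [mem_sphere_zero_iff_norm] at hyδ
    linarith
  have hzR : ‖z‖ < R := by simpa using (hTU hzT).2
  have hzδ := (h.UΩ (hTU hzT).1).1
  obtain ⟨ζ, hζn, hζ⟩ : ∃ ζ, ‖ζ‖ = ‖z‖ ∧ ζ ∈ frontier T := by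
    by_contra hc
    push Not at hc
    exact h.circ_empty (fun x hx => (hTU hx).1) hzδ (by linarith) hc hzT rfl
  have hζT : ζ ∉ T := fun hh => hζ.2 (hTo.interior_eq.symm ▸ hh)
  have hζV : ζ ∈ ball (0:ℂ) R := by simpa [hζn] using hzR
  have hζU : ζ ∉ U := fun hh => by
    obtain ⟨x, hx, hxT⟩ := mem_closure_iff_nhds.1 hζ.1 _ (hTc.mem_nhds ⟨⟨hh, hζV⟩, hζT⟩)
    exact hx.2 hxT
  obtain ⟨i, hi⟩ := (h.clU ζ ⟨by rw [hζn]; exact hzδ, by rw [hζn]; linarith⟩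
    (closure_mono (fun x hx => (hTU hx).1) hζ.1)).resolve_left hζU
  have htail : σ i * ((G ζ).re - (G (p i)).re) < 0 := by
    by_contra hc
    have := hinF i ζ hi (not_lt.1 hc); linarith
  have hside : ∀ᶠ z in 𝓝 ζ, z ∈ U → z ∈ T := by
    rcases h.side isOpen_ball hTo hTc hi hζV with hh | hh
    · exact hh
    · obtain ⟨x, hx, hxT⟩ := mem_closure_iff_nhds.1 hζ.1 _ hh
      exact absurd hxT (hx (hTU hxT).1)
  have hGp : |(G (p i)).re| < ρ₁ := ((abs_re_le_norm _).trans (hC.G0 h0 (Or.inr ⟨i, rfl⟩))).trans_lt hP.l1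
  have hσa : |σ i| = 1 := by rcases hC.hσ i with e | e <;> simp [e]
  have hσσ : σ i * σ i = 1 := by rcases hC.hσ i with e | e <;> simp [e]
  have hσp := abs_lt.1 (show |σ i * (G (p i)).re| < ρ₁ by rwa [abs_mul, hσa, one_mul])
  have hr0 := hP.r0
  refine ⟨σ i * (R / 4), by rw [abs_mul, hσa, one_mul, abs_of_pos (by linarith)], ?_⟩
  set t := σ i * (R / 4) with ht
  have hta : |t| = R / 4 := by rw [abs_mul, hσa, one_mul, abs_of_pos (by linarith)]
  have hKt : K t ∈ F i := by
    obtain ⟨j, hj, hjt⟩ := hK.real t (by linarith) (by linarith)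
    by_cases hij : j = i
    · rwa [← hij]
    · exfalso
      have hne : σ j ≠ σ i := by
        have := hK.sg
        cases i <;> cases j <;> simp_all
        exact fun e => this e.symm
      have : σ j = - σ i := by
        rcases hC.hσ i with e | e <;> rcases hC.hσ j with e' | e' <;> simp_all
      rw [this, ht] at hjt; nlinarith
  have hI : {x : ℝ | σ i * x ≤ R / 4}.OrdConnected := by
    refine ⟨fun x hx y hy z hz => ?_⟩
    simp only [mem_ofPred_eq] at hx hy ⊢
    rcases hC.hσ i with e | e <;> rw [e] at hx hy ⊢ <;> linarith [hz.1, hz.2]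
  have hQ := h.Fseg i hI
  refine h.sideConst isOpen_ball hTo hTc hQ (fun x hx => hx.1) (fun x hx => ?_) ⟨hi, ?_⟩ ⟨hKt, ?_⟩ hside
  · rw [mem_ball_zero_iff]
    have hxI : σ i * (G x).re ≤ R / 4 := hx.2
    rcases lt_or_ge (σ i * ((G x).re - (G (p i)).re)) 0 with hh | hh
    · have := hC.tail_le h hP.r2 hP.r4 hx.1 hh
      have e : CI * r = 2 * ((1 + 2 * Real.pi * MM) * r) := by unfold CI; ring
      linarith
    · have h1 := hC.GF h h0 hx.1
      have : |(G x).re| ≤ R / 4 := by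
        rw [← one_mul |(G x).re|, ← hσa, ← abs_mul, abs_le]
        constructor <;> linarith
      linarith
  · show σ i * (G ζ).re ≤ R / 4
    linarith
  · show σ i * (G (K t)).re ≤ R / 4
    rw [hK.inv t ⟨by simp, by simp only [norm_real, Real.norm_eq_abs]; linarith, by simp only [norm_real, Real.norm_eq_abs]; linarith⟩, ofReal_re, ht, ← mul_assoc, hσσ, one_mul]

lemma Conf.stayT (h : Sol δ U F G f) (hC : Cut δ r U F G p σ α Ui Uo) (h0 : G (p true) = 0) (hP : Par δ r ρ₁ ρ₂)
    (hK : Conf ρ₁ ρ₂ F G f σ Uo K) {T : Set ℂ} {R b₁ : ℝ} (hb : b₁ < ρ₂) (hb1 : ρ₁ < b₁) (hR : R ≤ 1 / 2)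
    (hTU : T ⊆ U ∩ ball 0 R) (hTp : IsPreconnected T) (hTδ : (closure T ∩ sphere 0 δ).Nonempty)
    (hlow : ∀ w ∈ HH ρ₁ ρ₂, ‖w‖ = b₁ → R ≤ ‖K w‖) {z : ℂ} (hz : z ∈ T) : z ∈ Ui ∨ ‖G z‖ < b₁ := by
  have hGc : ContinuousOn G U := h.Gc.mono subset_union_left
  set Y := Ui ∪ (U ∩ G ⁻¹' ball 0 b₁) with hY
  have hYo : IsOpen Y := hC.io.union (hGc.isOpen_inter_preimage h.Uo isOpen_ball)
  have hα : ∀ x ∈ α, x ∈ Y := fun x hx => Or.inr ⟨hC.αU hx, by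
    rw [mem_preimage, mem_ball_zero_iff]; linarith [hC.G0 h0 (Or.inl hx), hP.l1]⟩
  obtain ⟨y, hyT, hyδ⟩ := hTδ
  obtain ⟨δ', hδ', hin, -⟩ := hC.inn
  obtain ⟨x, hx, hxT⟩ := mem_closure_iff_nhds.1 hyT _ (ball_mem_nhds y (sub_pos.2 hδ'))
  have hxY : x ∈ Y := by
    rcases hC.cov x (hTU hxT).1 with hh | hh | hh
    · exact Or.inl hh
    · have h1 := norm_sub_norm_le x y
      rw [mem_ball, dist_eq_norm] at hx
      rw [mem_sphere_zero_iff_norm] at hyδ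
      linarith [hin x hh]
    · exact hα x hh
  rcases pre_frontier hTp (Y := Y) (fun x hx hf => by
    have hxn : x ∉ Y := fun hh => hf.2 (hYo.interior_eq.symm ▸ hh)
    have hxU := (hTU hx).1
    have hxR : ‖x‖ < R := by simpa using (hTU hx).2
    have hxo : x ∈ Uo := by
      rcases hC.cov x hxU with hh | hh | hh
      · exact absurd (Or.inl hh) hxn
      · exact hh
      · exact absurd (hα x hh) hxn
    have hxG : b₁ ≤ ‖G x‖ := by
      by_contra hc
      exact hxn (Or.inr ⟨hxU, by rw [mem_preimage, mem_ball_zero_iff]; exact not_le.1 hc⟩)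
    rcases hxG.eq_or_lt with e | hlt
    · have hw : G x ∈ HH ρ₁ ρ₂ := ⟨(h.pos x hxU).le, by linarith, by linarith⟩
      have := hlow _ hw e.symm
      rw [← hK.uniq _ hw x (subset_closure hxo) (by linarith) rfl] at this
      linarith
    · have hO : Uo ∩ (U ∩ G ⁻¹' (closedBall 0 b₁)ᶜ) ∈ 𝓝 x :=
        (hC.oo.inter (hGc.isOpen_inter_preimage h.Uo isClosed_closedBall.isOpen_compl)).mem_nhds
          ⟨hxo, hxU, by simpa using hlt⟩
      obtain ⟨v, ⟨v1, -, v2⟩, hv⟩ := mem_closure_iff_nhds.1 hf.1 _ hO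
      rcases hv with hv | hv
      · exact Set.disjoint_left.1 hC.dis hv v1
      · exact v2 (ball_subset_closedBall hv.2)) with hh | hh
  · exact (hh hz).imp id fun h' => by simpa using h'.2
  · exact absurd hxY (hh hxT)

lemma Conf.main_iff (h : Sol δ U F G f) (hC : Cut δ r U F G p σ α Ui Uo) (h0 : G (p true) = 0) (hP : Par δ r ρ₁ ρ₂)
    (hK : Conf ρ₁ ρ₂ F G f σ Uo K) {T : Set ℂ} {R a b N θ : ℝ} {E : ℂ → ℂ} {z₀ : ℂ} (hρ : (1 + 2 * Real.pi * MM) * r ≤ ρ₁)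
    (hE : ∀ w w', ‖E w - E w'‖ ≤ 1 / 8 * ‖w - w'‖) (hKE : ∀ w ∈ HH a b, exp (θ * I) * (w + E w) = K w)
    (ha : 8 * ρ₁ ≤ a) (hb : b ≤ ρ₂) (hN : N = 2 * CK + 3) (hR : 2 * R ≤ b) (hRa : 32 * (N * a) < R)
    (hT : T = connectedComponentIn (U ∩ ball 0 R) z₀) (hTδ : (closure T ∩ sphere 0 δ).Nonempty)
    {z w : ℂ} (hz : 16 * (N * a) * (1 + BB) < ‖z‖) (hzR : ‖z‖ < R) (hw : w + E w = z) : exp (θ * I) * z ∈ T ↔ 0 < w.im := by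
  have hρ1 : 0 < ρ₁ := hP.m0.trans hP.l1
  have ha0 : 0 < a := by linarith
  have hN3 : 3 ≤ N := by linarith [CK_pos]
  have hNa : 3 * a ≤ N * a := by gcongr
  have hb4 := hP.b4
  have hW : IsOpen (U ∩ ball 0 R) := h.Uo.inter isOpen_ball
  obtain ⟨hTo, hTc⟩ := comp_cl hW hT
  have hTU : T ⊆ U ∩ ball 0 R := hT ▸ connectedComponentIn_subset _ _
  have hTp : IsPreconnected T := hT ▸ isPreconnected_connectedComponentIn
  have hTm : ∀ S : Set ℂ, IsPreconnected S → S ⊆ U ∩ ball 0 R → ∀ x ∈ S, x ∈ T → S ⊆ T := fun S hS hSW x hx hxT => by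
    rw [hT] at hxT ⊢
    rw [connectedComponentIn_eq hxT]; exact hS.subset_connectedComponentIn hx hSW
  have nrm : ∀ v, ‖exp (θ * I) * v‖ = ‖v‖ := fun v => by rw [norm_mul, norm_exp_ofReal_mul_I, one_mul]
  have hHH : HH a b ⊆ HH ρ₁ ρ₂ := fun v hv => ⟨hv.1, by linarith [hv.2.1], hv.2.2.trans_le hb⟩
  have hE0 : ‖E 0‖ ≤ N * a := by
    have hv : ((2 * a : ℝ) : ℂ) ∈ HH a b := ⟨by simp, by rw [norm_real, Real.norm_eq_abs, abs_of_pos (by linarith)]; linarith,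
      by rw [norm_real, Real.norm_eq_abs, abs_of_pos (by linarith)]; nlinarith⟩
    have h1 := hK.gr _ (hHH hv)
    rw [← hKE _ hv, nrm] at h1
    have h2 := hE 0 ((2 * a : ℝ) : ℂ)
    have h3 := norm_sub_norm_le (E 0) (E ((2 * a : ℝ) : ℂ))
    have h4 := norm_sub_norm_le (E ((2 * a : ℝ) : ℂ)) (-((2 * a : ℝ) : ℂ))
    rw [sub_neg_eq_add, norm_neg, add_comm (E _)] at h4
    rw [zero_sub, norm_neg] at h2
    have h5 : ‖((2 * a : ℝ) : ℂ)‖ = 2 * a := by rw [norm_real, Real.norm_eq_abs, abs_of_pos (by linarith)]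
    rw [h5] at h1 h2 h4
    rw [hN]; nlinarith
  have hEw : ∀ v, ‖E v‖ ≤ N * a + 1 / 8 * ‖v‖ := fun v => by
    have h1 := hE v 0
    have h2 := norm_sub_norm_le (E v) (E 0)
    rw [sub_zero] at h1; linarith
  have hEw4 : ∀ v, 8 * (N * a) ≤ ‖v‖ → ‖E v‖ ≤ ‖v‖ / 4 := fun v hv => by linarith [hEw v]
  have hlo : ∀ v, ‖v‖ ≤ ‖v + E v‖ + ‖E v‖ := fun v => by
    have := norm_sub_le (v + E v) (E v); rwa [add_sub_cancel_right] at this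
  have hup : ∀ v, ‖v + E v‖ ≤ ‖v‖ + ‖E v‖ := fun v => norm_add_le _ _
  have hB : 16 * (N * a) ≤ 16 * (N * a) * (1 + BB) := le_mul_of_one_le_right (by linarith) (by linarith [BB_pos])
  have hHAb : ∀ v, 0 < v.im → 8 * (N * a) < ‖v‖ → ‖v‖ < b → v ∈ HA a b := fun v h1 h2 h3 => ⟨h1, by linarith, h3⟩
  have hHA : HA a b ⊆ HA ρ₁ ρ₂ := fun v hv => ⟨hv.1, by linarith [hv.2.1], hv.2.2.trans_le hb⟩
  have hKU : ∀ v ∈ HA a b, ‖v + E v‖ < R → K v ∈ U ∩ ball 0 R := fun v hv hn => by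
    refine ⟨hC.oU (hK.mo v (hHA hv)), ?_⟩
    rw [mem_ball_zero_iff, ← hKE v (HA_HH _ _ hv), nrm]; exact hn
  constructor
  · intro hzT
    have hlow : ∀ v ∈ HH ρ₁ ρ₂, ‖v‖ = 3 / 2 * R → R ≤ ‖K v‖ := fun v hv hn => by
      rw [← hKE v ⟨hv.1, by linarith, by linarith⟩, nrm]
      linarith [hlo v, hEw4 v (by linarith)]
    have hU := (hTU hzT).1
    have hzn := nrm z
    have e1 : CI * r = 2 * ((1 + 2 * Real.pi * MM) * r) := by unfold CI; ring
    have e2 : KK * r = 5 * ((1 + 2 * Real.pi * MM) * r) := by unfold KK; ring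
    have e3 : r ≤ KK * r := by have := hP.r0; have := KK_ge; nlinarith
    have hnUi : exp (θ * I) * z ∉ Ui := fun hh => by
      have := hC.Ui_le h hP.r2 hP.r4 hh; linarith
    have hG := (hK.stayT h hC h0 hP (b₁ := 3 / 2 * R) (R := R) (by linarith) (by linarith) (by linarith) hTU hTp hTδ hlow hzT).resolve_left hnUi
    have hUo : exp (θ * I) * z ∈ Uo := by
      rcases hC.cov _ hU with hh | hh | hh
      · exact absurd hh hnUi
      · exact hh
      · have := hC.αr _ hh; linarith
    have hGl := hC.Glow h h0 hP.r2 (Or.inl hU) (by linarith) (by linarith)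
    rw [hzn] at hGl
    have hG8 : 8 * (N * a) < ‖G (exp (θ * I) * z)‖ := by
      by_contra hc
      have := mul_le_mul_of_nonneg_left (not_lt.1 hc) (show 0 ≤ 2 * (1 + BB) by linarith [BB_pos])
      linarith
    have hm := hHAb _ (h.pos _ hU) hG8 (by linarith)
    have e4 := hK.uniq _ (hHH (HA_HH _ _ hm)) _ (subset_closure hUo) (by linarith) rfl
    rw [← hKE _ (HA_HH _ _ hm)] at e4
    have e5 := mul_left_cancel₀ (exp_ne_zero _) e4
    set v := G (exp (θ * I) * z)
    have e6 : w = v := by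
      have h1 := hE w v
      have h2 : w - v = -(E w - E v) := by linear_combination hw + e5
      have h3 : ‖w - v‖ = ‖E w - E v‖ := by rw [h2, norm_neg]
      have : ‖w - v‖ = 0 := by linarith [norm_nonneg (w - v)]
      exact sub_eq_zero.1 (norm_eq_zero.1 this)
    rw [e6]; exact hm.1
  · intro hwi
    have hw8 : 8 * (N * a) < ‖w‖ := by
      have := hup w; have := hEw w; rw [hw] at *; linarith
    have hwE := hEw4 w hw8.le
    have hwb : ‖w‖ < b := by have := hlo w; rw [hw] at this; linarith
    have hwA := hHAb w hwi hw8 hwb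
    rw [← hw, hKE w (HA_HH _ _ hwA)]
    have hcK : ContinuousOn K (HA a b) := fun v hv => (hK.der v (hHA hv)).continuousAt.continuousWithinAt
    have hH2 : HA (8 * (N * a)) (R / 2) ⊆ HA a b := fun v hv => hHAb v hv.1 hv.2.1 (by linarith [hv.2.2])
    have hall : K '' HA (8 * (N * a)) (R / 2) ⊆ T := by
      obtain ⟨t, ht, hev⟩ := hK.reach h hC h0 hP (R := R) (by linarith) (by linarith) hρ hTU hTo hTc hTδ
      have htH : (t : ℂ) ∈ HH ρ₁ ρ₂ := ⟨by simp, by rw [norm_real, Real.norm_eq_abs]; linarith, by rw [norm_real, Real.norm_eq_abs]; linarith⟩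
      have hlim : Tendsto (fun s : ℝ => (t : ℂ) + s * I) (𝓝[>] 0) (𝓝 t) := by
        have : Continuous (fun s : ℝ => (t : ℂ) + s * I) := by fun_prop
        simpa using (this.tendsto 0).mono_left nhdsWithin_le_nhds
      have hin : ∀ᶠ s : ℝ in 𝓝[>] 0, (t : ℂ) + s * I ∈ HA (8 * (N * a)) (R / 2) := by
        filter_upwards [hlim.norm.eventually (Ioo_mem_nhds (a := 8 * (N * a)) (b := R / 2) (by rw [norm_real, Real.norm_eq_abs]; linarith)
          (by rw [norm_real, Real.norm_eq_abs]; linarith)), self_mem_nhdsWithin] with s h1 h2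
        exact ⟨by simpa using h2, h1⟩
      have hKl : Tendsto (fun s : ℝ => K (t + s * I)) (𝓝[>] 0) (𝓝 (K t)) :=
        (hK.co t htH).tendsto.comp (tendsto_nhdsWithin_iff.2 ⟨hlim, hin.mono fun s hs => hHH (HA_HH _ _ (hH2 hs))⟩)
      obtain ⟨s, h1, h2⟩ := (hin.and (hKl.eventually hev)).exists
      refine hTm _ ((HA_pre (by linarith) _).image _ (hcK.mono hH2)) ?_ _ (mem_image_of_mem K h1) (h2 (hC.oU (hK.mo _ (hHA (hH2 h1)))))
      rintro _ ⟨v, hv, rfl⟩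
      exact hKU v (hH2 hv) (by linarith [hup v, hEw4 v hv.2.1.le, hv.2.2])
    rcases lt_or_ge ‖w‖ (R / 2) with hlt | hge
    · exact hall ⟨w, ⟨hwi, hw8, hlt⟩, rfl⟩
    have hw0 : 0 < ‖w‖ := by linarith
    set τ := R / 4 / ‖w‖ with hτ
    have hτ0 : 0 < τ := div_pos (by linarith) hw0
    have hτw : τ * ‖w‖ = R / 4 := div_mul_cancel₀ _ hw0.ne'
    have hτ1 : τ ≤ 1 := (div_le_one hw0).2 (by linarith)
    have hsn : ∀ s : ℝ, τ ≤ s → ‖(s : ℂ) * w‖ = s * ‖w‖ := fun s hs => by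
      rw [norm_mul, norm_real, Real.norm_eq_abs, abs_of_pos (hτ0.trans_le hs)]
    have hs8 : ∀ s : ℝ, τ ≤ s → R / 4 ≤ ‖(s : ℂ) * w‖ := fun s hs => by rw [hsn s hs, ← hτw]; gcongr
    have hsA : ∀ s ∈ Icc τ 1, (s : ℂ) * w ∈ HA a b := fun s hs => by
      refine hHAb _ ?_ (by linarith [hs8 s hs.1]) ?_
      · rw [im_ofReal_mul]; exact mul_pos (hτ0.trans_le hs.1) hwi
      · rw [hsn s hs.1]; exact (mul_le_of_le_one_left hw0.le hs.2).trans_lt hwb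
    have hS : IsPreconnected ((fun s : ℝ => K (s * w)) '' Icc τ 1) :=
      isPreconnected_Icc.image _ (hcK.comp (Continuous.continuousOn (by fun_prop)) hsA)
    refine hTm _ hS ?_ (K (τ * w)) ⟨τ, ⟨le_rfl, hτ1⟩, rfl⟩ (hall ⟨_, ⟨(hsA τ ⟨le_rfl, hτ1⟩).1, by linarith [hs8 τ le_rfl], ?_⟩, rfl⟩)
      ⟨1, ⟨hτ1, le_rfl⟩, by simp⟩
    · rintro _ ⟨s, hs, rfl⟩
      have hs0 := hτ0.trans_le hs.1
      refine hKU _ (hsA s hs) (lt_of_le_of_lt ?_ hzR)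
      have := ray_mono (x := s * w) (y := ((1 - s) / s : ℝ) * (s * w)) (e₁ := E (s * w)) (e₂ := E w - E (s * w))
        (div_nonneg (by linarith [hs.2]) hs0.le) rfl (hEw4 _ (by linarith [hs8 s hs.1])) (by
          have h1 := hE w (s * w)
          have e : ((((1 - s) / s : ℝ) : ℂ)) * (s * w) = w - s * w := by
            have : (s : ℂ) ≠ 0 := ofReal_ne_zero.2 hs0.ne'
            push_cast; field_simp
          rw [e]; linarith [norm_nonneg (w - s * w)])
      refine this.trans_eq ?_
      have : (s : ℂ) ≠ 0 := ofReal_ne_zero.2 hs0.ne'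
      rw [← hw]; congr 1; push_cast; field_simp; ring
    · rw [hsn τ le_rfl, hτw]; linarith
end

/-- effective removable singularities theorem for free boundaries. -/
theorem effective_removable_singularities :
    ∀ ε : ℝ, 0 < ε → ∃ δ₀ C : ℝ, 0 < δ₀ ∧ 0 < C ∧
    ∀ δ : ℝ, 0 < δ → δ < δ₀ →
    ∀ u : ℂ → ℝ, IsClassicalSolution (ann δ 1) u → ConditionA δ 1 u →
    ∀ T : Set ℂ,
      (∃ z₀ ∈ {z : ℂ | δ < ‖z‖ ∧ ‖z‖ < 1 / C ∧ 0 < u z},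
        T = connectedComponentIn {z : ℂ | δ < ‖z‖ ∧ ‖z‖ < 1 / C ∧ 0 < u z} z₀) →
      (closure T ∩ Metric.sphere 0 δ).Nonempty →
      ∃ θ : ℝ, ∃ g : ℝ → ℝ, Differentiable ℝ g ∧ (∀ x : ℝ, |deriv g x| ≤ ε) ∧
        ∀ z : ℂ, C * δ < ‖z‖ → ‖z‖ < 1 / C →
          (rot θ z ∈ T ↔ g z.re < z.im) := by
  intro ε hε
  obtain ⟨A, hA, hmod⟩ := Conf.model hε
  set m := 2 * Real.pi * MM with hm
  have hMM := MM_ge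
  have hB := BB_pos
  have hm0 : 0 < m := by have := Real.pi_pos; positivity
  set N := 2 * CK + 3 with hN
  have hN3 : 3 ≤ N := by linarith [CK_pos]
  set ρ₂ := 1 / (8 * (1 + BB)) with hρ2
  have hρ20 : 0 < ρ₂ := by positivity
  have hρ2e : ρ₂ * (8 * (1 + BB)) = 1 := by rw [hρ2]; field_simp
  set D := 16 * A * (1 + m) with hD
  have hD0 : 144 * (1 + m) ≤ D := by rw [hD]; gcongr; linarith
  have hDp : 0 < D := by linarith
  set C := 16 * N * D * (1 + BB) + 24 * A / ρ₂ with hC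
  have hx1 : 0 < 16 * N * D * (1 + BB) := by positivity
  have hx2 : 0 < 24 * A / ρ₂ := by positivity
  have hC0 : 0 < C := by positivity
  refine ⟨1 / (C * (32 * N * D)), C, by positivity, hC0, ?_⟩
  intro δ hδ hδ0 u hu hcA T hT hTδ
  set R := 1 / C with hR
  have hR0 : 0 < R := by positivity
  have hCR : C * R = 1 := by rw [hR]; field_simp
  have hRρ : R * (24 * A) ≤ ρ₂ := by
    have h1 : 24 * A ≤ ρ₂ * C := by
      have : 24 * A / ρ₂ ≤ C := by linarith
      rwa [div_le_iff₀' hρ20] at this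
    calc R * (24 * A) ≤ R * (ρ₂ * C) := by gcongr
      _ = ρ₂ * (C * R) := by ring
      _ = ρ₂ := by rw [hCR, mul_one]
  have hRa : 32 * N * D * δ < R := by
    rw [lt_div_iff₀ (by positivity)] at hδ0
    rw [hR, lt_div_iff₀ hC0]; linarith
  have hρ1 : ρ₂ < 1 / 8 := by nlinarith
  have hR8 : R < 1 / 8 := by nlinarith
  obtain ⟨F, G₀, f, h₀⟩ := exists_Sol hδ hu hcA
  set U := posSet (ann δ 1) u with hU
  have hDδ : 144 * (1 + m) * δ ≤ D * δ := by gcongr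
  have hNDδ : 3 * (D * δ) ≤ N * (D * δ) := by gcongr
  have hmδ : 0 < (1 + m) * δ := by positivity
  obtain ⟨p, σ, α, Ui, Uo, hcut₀⟩ := h₀.exists_cut (r := 2 * δ) le_rfl (by nlinarith)
  obtain ⟨G, h, hcut, h0⟩ := h₀.norm_cut hcut₀
  have hP : Par δ (2 * δ) ((1 + m) * (2 * δ)) ρ₂ :=
    { r2 := le_rfl
      r0 := by linarith
      rK := by rw [KK, ← hm]; linarith
      l1 := by rw [← hm]; linarith
      l2 := by nlinarith
      l3 := by linarith }
  obtain ⟨K, hK⟩ := hcut.exists_conf h h0 hP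
  have ha : 8 * A * ((1 + m) * (2 * δ)) = D * δ := by rw [hD]; ring
  obtain ⟨θ, g, E, hg, hg', hE, hKE, hgz⟩ := hmod _ _ _ _ _ _ _ _ _ _ _ _ _ _ h hcut hK (by linarith) (by
    have e : A * (A * ((1 + m) * (2 * δ))) * 96 = 12 * A * (D * δ) := by rw [hD]; ring
    rw [e]
    have : D * δ < R := by linarith
    nlinarith)
  rw [ha] at hKE
  refine ⟨θ, g, hg, hg', fun z hz hzR => ?_⟩
  obtain ⟨w, hw, hiff⟩ := hgz z
  rw [← hiff, rot]
  have hset : {z : ℂ | δ < ‖z‖ ∧ ‖z‖ < R ∧ 0 < u z} = U ∩ ball 0 R := by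
    ext x
    simp only [mem_ofPred_eq, hU, posSet, ann, mem_inter_iff, mem_ball_zero_iff]
    constructor
    · rintro ⟨h1, h2, h3⟩; exact ⟨⟨⟨h1, by linarith⟩, h3⟩, h2⟩
    · rintro ⟨⟨⟨h1, -⟩, h3⟩, h2⟩; exact ⟨h1, h2, h3⟩
  rw [hset] at hT
  obtain ⟨z₀, -, hT⟩ := hT
  refine hK.main_iff h hcut h0 hP (a := D * δ) (b := ρ₂ / (12 * A)) (N := N) (R := R) (by rw [← hm]) hE hKE (by linarith)
    (div_le_self hρ20.le (by linarith)) hN (by rw [le_div_iff₀ (by positivity)]; linarith) (by linarith) hT hTδ ?_ hzR hw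
  refine lt_of_le_of_lt ?_ hz
  have : 16 * N * D * (1 + BB) * δ ≤ C * δ := by gcongr; linarith
  linarith
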